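/- arXiv:2304.11613 — 2 statements merged into one kernel-verified Lean document; each statement's English description precedes it below -/
import Mathlib

section
/- Over the class of finitely-branching Kripke trees, CoWMPL is strictly less expressive than CoWMTL, and CoWMTL is strictly less expressive than CoWMSO: CoWMPL < CoWMTL < CoWMSO. -/
/-! ## Trees over ℕ* -/

abbrev Node : Type := List ℕ

/-- `T` is a tree with root `r`: `r ∈ T`, every node extends `r`, and `T` is
prefix-closed above `r`. -/
def IsTreeRooted (T : Set Node) (r : Node) : Prop :=
  r ∈ T ∧ (∀ τ ∈ T, r <+: τ) ∧
    ∀ σ σ' : List ℕ, r ++ σ ∈ T → σ' <+: σ → r ++ σ' ∈ T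

/-- `T ⊆ ℕ*` is a tree. -/
def IsTree (T : Set Node) : Prop := ∃ r : Node, IsTreeRooted T r

/-- `τ'` is a child of `τ` in `T`. -/
def childIn (T : Set Node) (τ τ' : Node) : Prop := τ' ∈ T ∧ ∃ n : ℕ, τ' = τ ++ [n]

/-- every node of `T` has a child in `T`. -/
def NonBlocking (T : Set Node) : Prop := ∀ τ ∈ T, ∃ n : ℕ, τ ++ [n] ∈ T

/-- every node of `T` has finitely many children in `T`. -/
def FinBranching (T : Set Node) : Prop := ∀ τ ∈ T, {τ' : Node | childIn T τ τ'}.Finite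

/-- `S` is a subtree of `T`. -/
def IsSubtree (T S : Set Node) : Prop := S ⊆ T ∧ IsTree S

/-- `P` is a path of `T`: a subtree totally ordered by the child relation
(each node has at most one child in `P`). -/
def IsPathOf (T P : Set Node) : Prop :=
  IsSubtree T P ∧ ∀ τ ∈ P, ∀ n m : ℕ, τ ++ [n] ∈ P → τ ++ [m] ∈ P → n = m

/-- `T` is a chain: a tree in which each node has at most one child. -/
def IsChainTree (T : Set Node) : Prop :=
  IsTree T ∧ ∀ τ ∈ T, ∀ n m : ℕ, τ ++ [n] ∈ T → τ ++ [m] ∈ T → n = m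

/-- `T` is dense: it contains a subtree every node of which has a descendant
in the subtree with at least two distinct children in the subtree. -/
def DenseTree (T : Set Node) : Prop :=
  ∃ S : Set Node, IsSubtree T S ∧ ∀ τ ∈ S, ∃ τ' ∈ S, τ <+: τ' ∧
    ∃ n m : ℕ, n ≠ m ∧ τ' ++ [n] ∈ S ∧ τ' ++ [m] ∈ S

/-- A Kripke tree over `AP`: a non-blocking tree together with a labelling. -/
structure KripkeTree (AP : Type) where
  T : Set Node
  root : Node
  rooted : IsTreeRooted T root
  nonblocking : NonBlocking T
  Lab : Node → Set AP

/-! ## MSOL syntax -/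

inductive MSOL (AP : Type) : Type
  | atom : AP → ℕ → MSOL AP          -- P_a(x)
  | le   : ℕ → ℕ → MSOL AP           -- x ≤ y
  | mem  : ℕ → ℕ → MSOL AP           -- x ∈ X
  | not  : MSOL AP → MSOL AP
  | and  : MSOL AP → MSOL AP → MSOL AP
  | exFO : ℕ → MSOL AP → MSOL AP     -- ∃x. φ
  | exSO : ℕ → MSOL AP → MSOL AP     -- ∃X. φ

namespace MSOL

def freeFO {AP : Type} : MSOL AP → Set ℕ
  | atom _ x => {x}
  | le x y => {x, y}
  | mem x _ => {x}
  | not φ => φ.freeFO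
  | and φ ψ => φ.freeFO ∪ ψ.freeFO
  | exFO x φ => φ.freeFO \ {x}
  | exSO _ φ => φ.freeFO

def freeSO {AP : Type} : MSOL AP → Set ℕ
  | atom _ _ => ∅
  | le _ _ => ∅
  | mem _ X => {X}
  | not φ => φ.freeSO
  | and φ ψ => φ.freeSO ∪ ψ.freeSO
  | exFO _ φ => φ.freeSO
  | exSO X φ => φ.freeSO \ {X}

/-- A sentence is a formula with no free variables. -/
def IsSentence {AP : Type} (φ : MSOL AP) : Prop := φ.freeFO = ∅ ∧ φ.freeSO = ∅

/-- The first-order fragment: no second-order variables. -/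
def IsFO {AP : Type} : MSOL AP → Prop
  | atom _ _ => True
  | le _ _ => True
  | mem _ _ => False
  | not φ => φ.IsFO
  | and φ ψ => φ.IsFO ∧ ψ.IsFO
  | exFO _ φ => φ.IsFO
  | exSO _ _ => False

end MSOL

/-! ## MSOL semantics, parametrized by the range of second-order quantifiers -/

/-- A second-order domain: for each tree, the collection of sets that
second-order quantifiers range over. -/
abbrev SODom : Type := Set Node → Set (Set Node)

def Sat {AP : Type} (D : SODom) (K : KripkeTree AP) :
    (ℕ → Node) → (ℕ → Set Node) → MSOL AP → Prop
  | V1, _,  .atom a x => V1 x ∈ K.T ∧ a ∈ K.Lab (V1 x)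
  | V1, _,  .le x y => V1 x ∈ K.T ∧ V1 y ∈ K.T ∧ V1 x <+: V1 y
  | V1, V2, .mem x X => V1 x ∈ V2 X
  | V1, V2, .not φ => ¬ Sat D K V1 V2 φ
  | V1, V2, .and φ ψ => Sat D K V1 V2 φ ∧ Sat D K V1 V2 ψ
  | V1, V2, .exFO x φ => ∃ τ ∈ K.T, Sat D K (Function.update V1 x τ) V2 φ
  | V1, V2, .exSO X φ => ∃ S ∈ D K.T, Sat D K V1 (Function.update V2 X S) φ

/-- A logic: a syntactic fragment of MSOL together with a second-order domain. -/
structure MLogic (AP : Type) where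
  syn : MSOL AP → Prop
  dom : SODom

namespace MLogic

/-- A Kripke tree satisfies a sentence. -/
def KSat {AP : Type} (L : MLogic AP) (K : KripkeTree AP) (φ : MSOL AP) : Prop :=
  ∃ V1 V2, Sat L.dom K V1 V2 φ

/-- `L ≤ L'` over the class `M`. -/
def Leq {AP : Type} (M : Set (KripkeTree AP)) (L L' : MLogic AP) : Prop :=
  ∀ φ : MSOL AP, φ.IsSentence → L.syn φ →
    ∃ φ' : MSOL AP, φ'.IsSentence ∧ L'.syn φ' ∧
      ∀ K ∈ M, (L.KSat K φ ↔ L'.KSat K φ')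

/-- `L < L'` over the class `M`. -/
def Lt {AP : Type} (M : Set (KripkeTree AP)) (L L' : MLogic AP) : Prop :=
  Leq M L L' ∧ ¬ Leq M L' L

/-- `L ≡ L'` over the class `M`. -/
def EquivExp {AP : Type} (M : Set (KripkeTree AP)) (L L' : MLogic AP) : Prop :=
  Leq M L L' ∧ Leq M L' L

/-- `L` and `L'` are expressively incomparable over the class `M`. -/
def Incomp {AP : Type} (M : Set (KripkeTree AP)) (L L' : MLogic AP) : Prop :=
  ¬ Leq M L L' ∧ ¬ Leq M L' L

end MLogic

/-! ## The concrete logics -/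

def MSOdom : SODom := fun T => {S | S ⊆ T}
def MTLdom : SODom := fun T => {S | S ⊆ T ∧ IsTree S}
def MPLdom : SODom := fun T => {S | IsPathOf T S}
def weakDom (D : SODom) : SODom := fun T => {S | S ∈ D T ∧ S.Finite}
def coweakDom (D : SODom) : SODom := fun T => {S | S ∈ D T ∧ S.Infinite}

def MSO (AP : Type) : MLogic AP := ⟨fun _ => True, MSOdom⟩
def MTL (AP : Type) : MLogic AP := ⟨fun _ => True, MTLdom⟩
def MPL (AP : Type) : MLogic AP := ⟨fun _ => True, MPLdom⟩
def WMSO (AP : Type) : MLogic AP := ⟨fun _ => True, weakDom MSOdom⟩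
def WMTL (AP : Type) : MLogic AP := ⟨fun _ => True, weakDom MTLdom⟩
def WMPL (AP : Type) : MLogic AP := ⟨fun _ => True, weakDom MPLdom⟩
def CoWMSO (AP : Type) : MLogic AP := ⟨fun _ => True, coweakDom MSOdom⟩
def CoWMTL (AP : Type) : MLogic AP := ⟨fun _ => True, coweakDom MTLdom⟩
def CoWMPL (AP : Type) : MLogic AP := ⟨fun _ => True, coweakDom MPLdom⟩
def FOL (AP : Type) : MLogic AP := ⟨MSOL.IsFO, MSOdom⟩

/-! ## Classes of Kripke trees -/

def allKT (AP : Type) : Set (KripkeTree AP) := Set.univ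
def finBrKT (AP : Type) : Set (KripkeTree AP) := {K | FinBranching K.T}
/-- Kripke trees whose underlying tree is an infinite chain
(every node has exactly one child). -/
def chainKT (AP : Type) : Set (KripkeTree AP) :=
  {K | ∀ τ ∈ K.T, ∃! τ' : Node, childIn K.T τ τ'}

namespace CW

/-! ### Formula helpers -/
section
variable {AP : Type}

def imp (φ ψ : MSOL AP) : MSOL AP := .not (.and φ (.not ψ))
def all (x : ℕ) (φ : MSOL AP) : MSOL AP := .not (.exFO x (.not φ))

@[simp] theorem sat_imp (D : SODom) (K : KripkeTree AP) (V1 V2) (φ ψ : MSOL AP) :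
    Sat D K V1 V2 (imp φ ψ) ↔ (Sat D K V1 V2 φ → Sat D K V1 V2 ψ) := by
  simp [imp, Sat]

@[simp] theorem sat_all (D : SODom) (K : KripkeTree AP) (V1 V2) (x : ℕ) (φ : MSOL AP) :
    Sat D K V1 V2 (all x φ) ↔ ∀ τ ∈ K.T, Sat D K (Function.update V1 x τ) V2 φ := by
  simp [all, Sat]

@[simp] theorem freeFO_imp (φ ψ : MSOL AP) : (imp φ ψ).freeFO = φ.freeFO ∪ ψ.freeFO := rfl
@[simp] theorem freeSO_imp (φ ψ : MSOL AP) : (imp φ ψ).freeSO = φ.freeSO ∪ ψ.freeSO := rfl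
@[simp] theorem freeFO_all (x : ℕ) (φ : MSOL AP) : (all x φ).freeFO = φ.freeFO \ {x} := rfl
@[simp] theorem freeSO_all (x : ℕ) (φ : MSOL AP) : (all x φ).freeSO = φ.freeSO := rfl

theorem sat_congr (D : SODom) (K : KripkeTree AP) (φ : MSOL AP) :
    ∀ V1 V2 V1' V2', (∀ x ∈ φ.freeFO, V1 x = V1' x) → (∀ x ∈ φ.freeSO, V2 x = V2' x) →
      (Sat D K V1 V2 φ ↔ Sat D K V1' V2' φ) := by
  induction φ with
  | atom a x => intro V1 V2 V1' V2' h1 h2; simp_all [Sat, MSOL.freeFO, MSOL.freeSO]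
  | le x y => intro V1 V2 V1' V2' h1 h2; simp_all [Sat, MSOL.freeFO, MSOL.freeSO]
  | mem x X => intro V1 V2 V1' V2' h1 h2; simp_all [Sat, MSOL.freeFO, MSOL.freeSO]
  | not φ ih => intro V1 V2 V1' V2' h1 h2; simp only [Sat]; rw [ih _ _ _ _ h1 h2]
  | and φ ψ ih ih2 =>
    intro V1 V2 V1' V2' h1 h2; simp only [Sat]
    rw [ih _ _ _ _ (fun x hx => h1 x (Or.inl hx)) (fun x hx => h2 x (Or.inl hx)),
      ih2 _ _ _ _ (fun x hx => h1 x (Or.inr hx)) (fun x hx => h2 x (Or.inr hx))]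
  | exFO x φ ih =>
    intro V1 V2 V1' V2' h1 h2; simp only [Sat]
    refine exists_congr fun τ => and_congr_right fun _ => ih _ _ _ _ ?_ h2
    intro y hy
    by_cases h : y = x
    · subst h; simp
    · simp [h, h1 y ⟨hy, h⟩]
  | exSO x φ ih =>
    intro V1 V2 V1' V2' h1 h2; simp only [Sat]
    refine exists_congr fun τ => and_congr_right fun _ => ih _ _ _ _ h1 ?_
    intro y hy
    by_cases h : y = x
    · subst h; simp
    · simp [h, h2 y ⟨hy, h⟩]

/-! ### Relativization -/

def rel (θ : ℕ → MSOL AP) : MSOL AP → MSOL AP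
  | .atom a x => .atom a x
  | .le x y => .le x y
  | .mem x X => .mem x X
  | .not φ => .not (rel θ φ)
  | .and φ ψ => .and (rel θ φ) (rel θ ψ)
  | .exFO x φ => .exFO x (rel θ φ)
  | .exSO X φ => .exSO X (.and (θ X) (rel θ φ))

theorem rel_free (θ : ℕ → MSOL AP) (h1 : ∀ X, (θ X).freeFO = ∅) (h2 : ∀ X, (θ X).freeSO = {X})
    (φ : MSOL AP) : (rel θ φ).freeFO = φ.freeFO ∧ (rel θ φ).freeSO = φ.freeSO := by
  induction φ <;> simp_all [rel, MSOL.freeFO, MSOL.freeSO]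

theorem rel_sat (θ : ℕ → MSOL AP) (D D' : SODom) (K : KripkeTree AP)
    (h : ∀ V1 V2 X S, (S ∈ D K.T ↔ S ∈ D' K.T ∧ Sat D' K V1 (Function.update V2 X S) (θ X)))
    (φ : MSOL AP) : ∀ V1 V2, Sat D K V1 V2 φ ↔ Sat D' K V1 V2 (rel θ φ) := by
  induction φ with
  | atom a x => intros; rfl
  | le x y => intros; rfl
  | mem x X => intros; rfl
  | not φ ih => intro V1 V2; simp only [Sat, rel, ih]
  | and φ ψ ih ih2 => intro V1 V2; simp only [Sat, rel, ih, ih2]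
  | exFO x φ ih => intro V1 V2; simp only [Sat, rel, ih]
  | exSO X φ ih =>
    intro V1 V2; simp only [Sat, rel, ih]
    refine exists_congr fun S => ?_
    rw [h V1 V2 X S, and_assoc]

theorem leq_of_rel (θ : ℕ → MSOL AP) (D D' : SODom) (M : Set (KripkeTree AP))
    (h1 : ∀ X, (θ X).freeFO = ∅) (h2 : ∀ X, (θ X).freeSO = {X})
    (h : ∀ K : KripkeTree AP, ∀ V1 V2 X S,
      (S ∈ D K.T ↔ S ∈ D' K.T ∧ Sat D' K V1 (Function.update V2 X S) (θ X))) :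
    MLogic.Leq M ⟨fun _ => True, D⟩ ⟨fun _ => True, D'⟩ := by
  intro φ hφ _
  refine ⟨rel θ φ, ⟨?_, ?_⟩, trivial, ?_⟩
  · rw [(rel_free θ h1 h2 φ).1]; exact hφ.1
  · rw [(rel_free θ h1 h2 φ).2]; exact hφ.2
  · intro K _
    exact exists_congr fun V1 => exists_congr fun V2 => rel_sat θ D D' K (h K) φ V1 V2

def fChain (X : ℕ) : MSOL AP :=
  all 0 (all 1 (imp (.mem 0 X) (imp (.mem 1 X) (imp (.not (.le 0 1)) (.le 1 0)))))

def fTree (X : ℕ) : MSOL AP :=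
  .exFO 0 (.and (.mem 0 X) (all 1 (imp (.mem 1 X) (.and (.le 0 1)
    (all 2 (imp (.le 0 2) (imp (.le 2 1) (.mem 2 X))))))))

theorem chain_aux (S : Set Node) (hp : ∀ τ ∈ S, ∀ n m : ℕ, τ ++ [n] ∈ S → τ ++ [m] ∈ S → n = m)
    (u : List ℕ) : ∀ (v r : List ℕ), (∀ s, s <+: u → r ++ s ∈ S) → (∀ s, s <+: v → r ++ s ∈ S) →
      u <+: v ∨ v <+: u := by
  induction u with
  | nil => intro v r _ _; exact Or.inl List.nil_prefix
  | cons a u ih =>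
    intro v r hu hv
    cases v with
    | nil => exact Or.inr List.nil_prefix
    | cons b v =>
      have hr : r ∈ S := by simpa using hu [] List.nil_prefix
      have hab : a = b := hp r hr a b (hu [a] (by simp)) (hv [b] (by simp))
      subst hab
      have := ih v (r ++ [a]) (fun s hs => by
          have := hu (a :: s) (by simpa [List.cons_prefix_cons] using hs)
          simpa using this) (fun s hs => by
          have := hv (a :: s) (by simpa [List.cons_prefix_cons] using hs)
          simpa using this)
      simpa [List.cons_prefix_cons] using this

theorem path_iff_chain (S : Set Node) (hS : IsTree S) :
    (∀ τ ∈ S, ∀ n m : ℕ, τ ++ [n] ∈ S → τ ++ [m] ∈ S → n = m) ↔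
      ∀ x ∈ S, ∀ y ∈ S, x <+: y ∨ y <+: x := by
  constructor
  · intro hp x hx y hy
    obtain ⟨r, hr, h1, h2⟩ := hS
    obtain ⟨u, rfl⟩ := h1 x hx
    obtain ⟨v, rfl⟩ := h1 y hy
    have := chain_aux S hp u v r (fun s hs => h2 u s hx hs) (fun s hs => h2 v s hy hs)
    simpa [List.prefix_append_right_inj] using this
  · intro h τ _ n m hn hm
    have := h _ hn _ hm
    simp [List.prefix_append_right_inj, List.cons_prefix_cons] at this
    omega

theorem isTree_iff (S : Set Node) : IsTree S ↔
    ∃ r ∈ S, ∀ y ∈ S, r <+: y ∧ ∀ z, r <+: z → z <+: y → z ∈ S := by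
  constructor
  · rintro ⟨r, hr, h1, h2⟩
    refine ⟨r, hr, fun y hy => ⟨h1 y hy, ?_⟩⟩
    rintro z ⟨u, rfl⟩ hz
    obtain ⟨v, rfl⟩ := h1 y hy
    exact h2 v u hy (by simpa [List.prefix_append_right_inj] using hz)
  · rintro ⟨r, hr, h⟩
    refine ⟨r, hr, fun y hy => (h y hy).1, fun u v hu hv => ?_⟩
    exact (h _ hu).2 _ (List.prefix_append _ _) (by simpa [List.prefix_append_right_inj] using hv)

theorem mem_of_between (K : KripkeTree AP) {x y z : Node} (hx : x ∈ K.T) (hy : y ∈ K.T)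
    (hxz : x <+: z) (hzy : z <+: y) : z ∈ K.T := by
  obtain ⟨r, hr, h⟩ := (isTree_iff K.T).1 ⟨_, K.rooted⟩
  exact (h y hy).2 z ((h x hx).1.trans hxz) hzy

theorem leq1 (M : Set (KripkeTree AP)) : MLogic.Leq M (CoWMPL AP) (CoWMTL AP) := by
  refine leq_of_rel fChain _ _ M ?_ ?_ ?_
  · intro X; ext x; simp [fChain, MSOL.freeFO]
  · intro X; ext x; simp [fChain, MSOL.freeSO]
  · intro K V1 V2 X S
    simp only [coweakDom, MPLdom, MTLdom, IsPathOf, IsSubtree, Set.mem_ofPred_eq, fChain]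
    simp [Sat, Function.update]
    constructor
    · rintro ⟨⟨⟨h1, h2⟩, h3⟩, h4⟩
      refine ⟨⟨⟨h1, h2⟩, h4⟩, ?_⟩
      intro x hx y hy hxS hyS h
      rcases (path_iff_chain S h2).1 h3 x hxS y hyS with h5 | h5
      · exact absurd h5 (h hx hy)
      · exact ⟨hy, hx, h5⟩
    · rintro ⟨⟨⟨h1, h2⟩, h4⟩, h⟩
      refine ⟨⟨⟨h1, h2⟩, (path_iff_chain S h2).2 ?_⟩, h4⟩
      intro x hx y hy
      by_cases hxy : x <+: y
      · exact Or.inl hxy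
      · exact Or.inr (h x (h1 hx) y (h1 hy) hx hy (fun _ _ => hxy)).2.2

theorem leq2 (M : Set (KripkeTree AP)) : MLogic.Leq M (CoWMTL AP) (CoWMSO AP) := by
  refine leq_of_rel fTree _ _ M ?_ ?_ ?_
  · intro X; ext x; simp [fTree, MSOL.freeFO]; grind
  · intro X; ext x; simp [fTree, MSOL.freeSO]
  · intro K V1 V2 X S
    simp only [coweakDom, MTLdom, MSOdom, Set.mem_ofPred_eq, fTree, isTree_iff]
    simp [Sat, Function.update]
    constructor
    · rintro ⟨⟨h1, r, hr, h⟩, h4⟩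
      refine ⟨⟨h1, h4⟩, r, h1 hr, hr, ?_⟩
      intro y hy hyS
      refine ⟨⟨h1 hr, hy, (h y hyS).1⟩, ?_⟩
      intro z hz _ _ h5 _ _ h6
      exact (h y hyS).2 z h5 h6
    · rintro ⟨⟨h1, h4⟩, r, hrT, hr, h⟩
      refine ⟨⟨h1, r, hr, ?_⟩, h4⟩
      intro y hy
      obtain ⟨⟨_, _, h5⟩, h6⟩ := h y (h1 hy) hy
      refine ⟨h5, fun z hz1 hz2 => ?_⟩
      have hz := mem_of_between K hrT (h1 hy) hz1 hz2
      exact h6 z hz hrT hz hz1 hz (h1 hy) hz2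
end

/-! ### The nodes used -/

def node (i j : ℕ) : Node := List.replicate i 0 ++ List.replicate j 1

theorem node_succ (i j : ℕ) : node (i + 1) j = 0 :: node i j := by
  simp [node, List.replicate_succ]

theorem node_zero (j : ℕ) : node 0 j = List.replicate j 1 := by simp [node]

theorem node_prefix (i j i' j' : ℕ) :
    node i j <+: node i' j' ↔ (i = i' ∧ j ≤ j') ∨ (j = 0 ∧ i ≤ i') := by
  induction i generalizing i' with
  | zero =>
    cases i' with
    | zero =>
      simp only [node_zero]
      constructor
      · intro h; have := h.length_le; simp at this; exact Or.inl ⟨trivial, this⟩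
      · intro h
        obtain ⟨m, rfl⟩ : ∃ m, j' = j + m := ⟨j' - j, by omega⟩
        exact ⟨List.replicate m 1, by simp [List.replicate_append_replicate]⟩
    | succ i' =>
      cases j with
      | zero => simp [node_zero]
      | succ j => simp [node_zero, node_succ, List.replicate_succ, List.cons_prefix_cons]
  | succ i ih =>
    cases i' with
    | zero =>
      cases j' with
      | zero => simp [node_zero, node_succ]
      | succ j' => simp [node_zero, node_succ, List.replicate_succ, List.cons_prefix_cons]
    | succ i' =>
      simp [node_succ, List.cons_prefix_cons, ih]

theorem node_inj {i j i' j' : ℕ} : node i j = node i' j' ↔ i = i' ∧ j = j' := by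
  constructor
  · intro h
    have h1 := (node_prefix i j i' j').1 (by rw [h])
    have h2 := (node_prefix i' j' i j).1 (by rw [h])
    omega
  · rintro ⟨rfl, rfl⟩; rfl

theorem prefix_node {τ : Node} {i j : ℕ} (h : τ <+: node i j) : ∃ p q, τ = node p q := by
  induction i generalizing τ with
  | zero =>
    rw [node_zero] at h
    refine ⟨0, τ.length, ?_⟩
    rw [node_zero]
    refine List.eq_replicate_iff.2 ⟨rfl, fun b hb => ?_⟩
    exact List.eq_of_mem_replicate (h.subset hb)
  | succ i ih =>
    cases τ with
    | nil => exact ⟨0, 0, rfl⟩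
    | cons a τ =>
      rw [node_succ, List.cons_prefix_cons] at h
      obtain ⟨p, q, rfl⟩ := ih h.2
      exact ⟨p + 1, q, by rw [node_succ, h.1]⟩

/-- allowed coordinates -/
def ok (c : Prop) (n i j : ℕ) : Prop := j = 0 ∨ i = n ∨ (c ∧ i ≤ n)

def Tr (c : Prop) (n : ℕ) : Set Node := {τ | ∃ i j, τ = node i j ∧ ok c n i j}

theorem mem_Tr {c : Prop} {n i j : ℕ} : node i j ∈ Tr c n ↔ ok c n i j := by
  constructor
  · rintro ⟨i', j', h, h'⟩
    obtain ⟨rfl, rfl⟩ := node_inj.1 h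
    exact h'
  · intro h; exact ⟨i, j, rfl, h⟩

theorem tree_iff (S : Set Node) (hS : ∀ τ ∈ S, ∃ i j, τ = node i j) : IsTree S ↔
    ∃ a b, node a b ∈ S ∧ ∀ i j, node i j ∈ S → ((a = i ∧ b ≤ j) ∨ (b = 0 ∧ a ≤ i)) ∧
      ∀ p q, ((a = p ∧ b ≤ q) ∨ (b = 0 ∧ a ≤ p)) → ((p = i ∧ q ≤ j) ∨ (q = 0 ∧ p ≤ i)) →
        node p q ∈ S := by
  rw [isTree_iff]
  constructor
  · rintro ⟨r, hr, h⟩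
    obtain ⟨a, b, rfl⟩ := hS r hr
    refine ⟨a, b, hr, fun i j hij => ⟨(node_prefix _ _ _ _).1 (h _ hij).1, fun p q h1 h2 => ?_⟩⟩
    exact (h _ hij).2 _ ((node_prefix _ _ _ _).2 h1) ((node_prefix _ _ _ _).2 h2)
  · rintro ⟨a, b, hr, h⟩
    refine ⟨_, hr, ?_⟩
    intro y hy
    obtain ⟨i, j, rfl⟩ := hS y hy
    refine ⟨(node_prefix _ _ _ _).2 (h _ _ hy).1, ?_⟩
    intro z hz1 hz2
    obtain ⟨p, q, rfl⟩ := prefix_node hz2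
    exact (h _ _ hy).2 p q ((node_prefix _ _ _ _).1 hz1) ((node_prefix _ _ _ _).1 hz2)

theorem Tr_nodes (c : Prop) (n : ℕ) : ∀ τ ∈ Tr c n, ∃ i j, τ = node i j := by
  rintro τ ⟨i, j, h, _⟩; exact ⟨i, j, h⟩

theorem Tr_rooted (c : Prop) (n : ℕ) : IsTreeRooted (Tr c n) [] := by
  refine ⟨⟨0, 0, rfl, Or.inl rfl⟩, fun τ _ => List.nil_prefix, ?_⟩
  rintro σ σ' ⟨i, j, h, hok⟩ hp
  simp only [List.nil_append] at *
  subst h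
  obtain ⟨p, q, rfl⟩ := prefix_node hp
  rw [node_prefix] at hp
  rw [mem_Tr]
  unfold ok at *
  by_cases hc : c <;> grind

theorem Tr_nonblocking (c : Prop) (n : ℕ) : NonBlocking (Tr c n) := by
  rintro τ ⟨i, j, rfl, h⟩
  rcases h with rfl | h
  · refine ⟨0, ?_⟩
    have : node i 0 ++ [0] = node (i + 1) 0 := by simp [node, List.replicate_succ']
    rw [this, mem_Tr]; exact Or.inl rfl
  · refine ⟨1, ?_⟩
    have : node i j ++ [1] = node i (j + 1) := by simp [node, List.replicate_succ']
    rw [this, mem_Tr]; exact Or.inr h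

theorem Tr_fin (c : Prop) (n : ℕ) : FinBranching (Tr c n) := by
  intro τ _
  refine Set.Finite.subset (Set.toFinite {τ ++ [0], τ ++ [1]}) ?_
  rintro _ ⟨⟨i, j, h, _⟩, k, rfl⟩
  have : k ∈ node i j := by rw [← h]; simp
  simp [node] at this
  rcases this with h | h <;> simp [h.2]

def KT (AP : Type) (c : Prop) (n : ℕ) : KripkeTree AP where
  T := Tr c n
  root := []
  rooted := Tr_rooted c n
  nonblocking := Tr_nonblocking c n
  Lab := fun _ => ∅

/-! ### Shapes -/

def shape (F : Prop) (a e t : ℕ) (I : Prop) (U : Set ℕ) : Set Node :=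
  {τ | ∃ i j, τ = node i j ∧ ((F ∧ j = 0 ∧ a ≤ i ∧ (i ≤ e ∨ I)) ∨ (i = t ∧ j ∈ U))}

theorem mem_shape {F a e t I U i j} : node i j ∈ shape F a e t I U ↔
    ((F ∧ j = 0 ∧ a ≤ i ∧ (i ≤ e ∨ I)) ∨ (i = t ∧ j ∈ U)) := by
  constructor
  · rintro ⟨i', j', h, h'⟩
    obtain ⟨rfl, rfl⟩ := node_inj.1 h
    exact h'
  · intro h; exact ⟨i, j, rfl, h⟩

theorem shape_nodes (F a e t I U) : ∀ τ ∈ shape F a e t I U, ∃ i j, τ = node i j := by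
  rintro τ ⟨i, j, h, _⟩; exact ⟨i, j, h⟩

structure Good (F : Prop) (a e t : ℕ) (I : Prop) (U : Set ℕ) : Prop where
  ne : F → a ≤ e ∨ I
  att : F → U.Nonempty → a ≤ t ∧ (t ≤ e ∨ I)
  ini : F → ∀ j ∈ U, ∀ l, 1 ≤ l → l ≤ j → l ∈ U
  conv : ¬ F → ∀ j ∈ U, ∀ l ∈ U, ∀ m, j ≤ m → m ≤ l → m ∈ U
  zero : 0 ∉ U
  inf : (F ∧ I) ∨ U.Infinite

theorem Good.tree {F a e t I U} (h : Good F a e t I U) : IsTree (shape F a e t I U) := by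
  rw [tree_iff _ (shape_nodes _ _ _ _ _ _)]
  simp only [mem_shape]
  by_cases hF : F
  · refine ⟨a, 0, ?_, ?_⟩
    · have := h.ne hF; simp [hF, this]
    · intro i j hij
      have hz := h.zero
      rcases hij with ⟨_, rfl, h1, h2⟩ | ⟨rfl, hj⟩
      · refine ⟨Or.inr ⟨rfl, h1⟩, fun p q h3 h4 => Or.inl ⟨hF, by omega, by omega, ?_⟩⟩
        rcases h2 with h2 | h2
        · left; omega
        · exact Or.inr h2
      · have hat := h.att hF ⟨j, hj⟩
        refine ⟨Or.inr ⟨rfl, hat.1⟩, fun p q h3 h4 => ?_⟩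
        by_cases hq : q = 0
        · refine Or.inl ⟨hF, hq, by omega, ?_⟩
          rcases hat.2 with h5 | h5
          · left; omega
          · exact Or.inr h5
        · refine Or.inr ⟨by omega, h.ini hF j hj q (by omega) (by omega)⟩
  · have hU : U.Infinite := by
      rcases h.inf with h | h
      · exact absurd h.1 hF
      · exact h
    classical
    have hex := hU.nonempty
    refine ⟨t, sInf U, ?_, ?_⟩
    · simp [hF, Nat.sInf_mem hex]
    · simp only [hF, false_and, false_or]
      rintro i j ⟨rfl, hj⟩
      refine ⟨Or.inl ⟨rfl, Nat.sInf_le hj⟩, fun p q h3 h4 => ?_⟩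
      have hne : sInf U ≠ 0 := fun h0 => h.zero (h0 ▸ Nat.sInf_mem hex)
      exact ⟨by omega, h.conv hF _ (Nat.sInf_mem hex) j hj q (by omega) (by omega)⟩

theorem Good.infinite {F a e t I U} (h : Good F a e t I U) : (shape F a e t I U).Infinite := by
  rcases h.inf with ⟨hF, hI⟩ | hU
  · refine Set.infinite_of_injective_forall_mem (f := fun m : ℕ => node (a + m) 0) ?_ ?_
    · intro x y hxy; simpa [node_inj] using hxy
    · intro m; simp [mem_shape, hF, hI]
  · refine (hU.image (f := fun j => node t j) ?_).mono ?_
    · intro x _ y _ hxy; simpa [node_inj] using hxy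
    · rintro _ ⟨j, hj, rfl⟩; simp [mem_shape, hj]

theorem classify (S : Set Node) (t : ℕ) (hS : IsTree S) (hinf : S.Infinite)
    (hn : ∀ τ ∈ S, ∃ i j, τ = node i j ∧ (j = 0 ∨ i = t)) :
    ∃ F a e I U, S = shape F a e t I U ∧ Good F a e t I U := by
  classical
  have hn' : ∀ τ ∈ S, ∃ i j, τ = node i j := fun τ h => by
    obtain ⟨i, j, h, _⟩ := hn τ h; exact ⟨i, j, h⟩
  have hnt : ∀ i j, node i j ∈ S → j = 0 ∨ i = t := by
    intro i j h
    obtain ⟨i', j', h1, h2⟩ := hn _ h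
    obtain ⟨rfl, rfl⟩ := node_inj.1 h1
    exact h2
  obtain ⟨a, b, hab, h⟩ := (tree_iff S hn').1 hS
  set U : Set ℕ := {j | 1 ≤ j ∧ node t j ∈ S} with hU
  by_cases hF : ∃ i, node i 0 ∈ S
  · have hb : b = 0 := by
      obtain ⟨i, hi⟩ := hF
      have := (h i 0 hi).1; omega
    subst hb
    -- upper end
    by_cases hI : ∀ i, a ≤ i → node i 0 ∈ S
    · refine ⟨True, a, a, True, U, ?_, ?_⟩
      · ext τ
        constructor
        · intro hτ
          obtain ⟨i, j, rfl, h1⟩ := hn τ hτ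
          rw [mem_shape]
          have := (h i j hτ).1
          by_cases hj : j = 0
          · left; simp [hj]; omega
          · right
            have : i = t := by omega
            subst this
            exact ⟨rfl, by omega, hτ⟩
        · rintro ⟨i, j, rfl, ⟨_, rfl, h1, _⟩ | ⟨rfl, h1⟩⟩
          · exact hI i h1
          · exact h1.2
      · refine ⟨by simp, ?_, ?_, by simp, by simp [hU], by simp⟩
        · rintro _ ⟨j, hj⟩
          have := (h _ _ hj.2).1
          simp; omega
        · intro _ j hj l hl hlj
          refine ⟨hl, (h _ _ hj.2).2 t l ?_ (by omega)⟩
          have := (h _ _ hj.2).1; omega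
    · push Not at hI
      obtain ⟨m, hm, hmS⟩ := hI
      have hbd : ∀ i, node i 0 ∈ S → i < m := by
        intro i hi
        by_contra hlt
        exact hmS ((h i 0 hi).2 m 0 (by omega) (by omega))
      have hfind : ∃ e, node e 0 ∈ S ∧ ∀ i, node i 0 ∈ S → i ≤ e := by
        have hfin : {i | node i 0 ∈ S}.Finite := (Set.finite_lt_nat m).subset hbd
        obtain ⟨e, he, hmax⟩ := hfin.exists_maximal ⟨a, hab⟩
        exact ⟨e, he, fun i hi => by
          by_contra hlt
          exact hlt (hmax hi (by omega))⟩
      obtain ⟨e, he, hmax⟩ := hfind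
      have hSeq : S = shape True a e t False U := by
        ext τ
        constructor
        · intro hτ
          obtain ⟨i, j, rfl, h1⟩ := hn τ hτ
          rw [mem_shape]
          have := (h i j hτ).1
          by_cases hj : j = 0
          · left
            subst hj
            have := hmax i hτ
            simp; omega
          · right
            have : i = t := by omega
            subst this
            exact ⟨rfl, by omega, hτ⟩
        · rintro ⟨i, j, rfl, ⟨_, rfl, h1, h2⟩ | ⟨rfl, h1⟩⟩
          · simp at h2
            exact (h e 0 he).2 i 0 (by omega) (by omega)
          · exact h1.2
      refine ⟨True, a, e, False, U, hSeq, ?_⟩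
      refine ⟨?_, ?_, ?_, by simp, by simp [hU], ?_⟩
      · have := (h e 0 he).1; intro _; left; omega
      · rintro _ ⟨j, hj⟩
        have h1 := (h _ _ hj.2).1
        have h2 := hmax t ((h _ _ hj.2).2 t 0 (by omega) (by omega))
        exact ⟨by omega, Or.inl h2⟩
      · intro _ j hj l hl hlj
        refine ⟨hl, (h _ _ hj.2).2 t l ?_ (by omega)⟩
        have := (h _ _ hj.2).1; omega
      · right
        intro hfin
        apply hinf
        rw [hSeq]
        refine Set.Finite.subset (((Set.finite_le_nat e).image (fun i => node i 0)).union
          (hfin.image (fun j => node t j))) ?_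
        rintro _ ⟨i, j, rfl, ⟨_, rfl, h1, h2⟩ | ⟨rfl, h1⟩⟩
        · simp at h2; exact Or.inl ⟨i, h2, rfl⟩
        · exact Or.inr ⟨j, h1, rfl⟩
  · push Not at hF
    have hSeq : S = shape False 0 0 t False U := by
      ext τ
      constructor
      · intro hτ
        obtain ⟨i, j, rfl, h1⟩ := hn τ hτ
        rw [mem_shape]
        right
        have hj : j ≠ 0 := by rintro rfl; exact hF i hτ
        have : i = t := by omega
        subst this
        exact ⟨rfl, by omega, hτ⟩
      · rintro ⟨i, j, rfl, ⟨h1, _⟩ | ⟨rfl, h1⟩⟩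
        · exact h1.elim
        · exact h1.2
    refine ⟨False, 0, 0, False, U, hSeq, by simp, by simp, by simp, ?_, by simp [hU], ?_⟩
    · intro _ j hj l hl m h1 h2
      have := hj.1
      have h3 := (h _ _ hj.2).1
      exact ⟨by omega, (h _ _ hl.2).2 t m (by omega) (by omega)⟩
    · right
      intro hfin
      apply hinf
      rw [hSeq]
      refine Set.Finite.subset (hfin.image (fun j => node t j)) ?_
      rintro _ ⟨i, j, rfl, ⟨h1, _⟩ | ⟨rfl, h1⟩⟩
      · exact h1.elim
      · exact ⟨j, h1, rfl⟩

/-! ### The back-and-forth system -/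

def Dist (d : ℕ) (A : Finset (ℕ × ℕ)) : Prop :=
  ∀ p ∈ A, ∀ q ∈ A, (p.1 ≤ q.1 ↔ p.2 ≤ q.2) ∧
    (p.1 ≤ q.1 → (q.1 + p.2 = q.2 + p.1 ∨ (p.1 + d ≤ q.1 ∧ p.2 + d ≤ q.2)))

theorem Dist.mono {d d' : ℕ} {A} (h : Dist d A) (hd : d' ≤ d) : Dist d' A := by
  intro p hp q hq
  have := h p hp q hq
  omega

theorem Dist.swap {d : ℕ} {A} (h : Dist d A) : Dist d (A.image Prod.swap) := by
  intro p hp q hq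
  simp only [Finset.mem_image] at hp hq
  obtain ⟨p, hp, rfl⟩ := hp
  obtain ⟨q, hq, rfl⟩ := hq
  have := h p hp q hq
  simp only [Prod.fst_swap, Prod.snd_swap]
  omega

theorem Dist.ext {d : ℕ} (hd : 1 ≤ d) {A} (h : Dist (2 * d) A) (h0 : (0, 0) ∈ A) (a : ℕ) :
    ∃ b, Dist d (insert (a, b) A) := by
  classical
  -- lower neighbour
  obtain ⟨l, hl, hlmax⟩ := (A.filter (fun p => p.1 ≤ a)).exists_max_image (fun p => p.1)
    ⟨(0, 0), by simp [h0]⟩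
  simp only [Finset.mem_filter] at hl hlmax
  have key : ∀ b, (∀ p ∈ A, (p.1 ≤ a ↔ p.2 ≤ b) ∧ (a ≤ p.1 ↔ b ≤ p.2) ∧
      (p.1 ≤ a → (a + p.2 = b + p.1 ∨ (p.1 + d ≤ a ∧ p.2 + d ≤ b))) ∧
      (a ≤ p.1 → (p.1 + b = p.2 + a ∨ (a + d ≤ p.1 ∧ b + d ≤ p.2)))) →
      Dist d (insert (a, b) A) := by
    intro b hb p hp q hq
    rw [Finset.mem_insert] at hp hq
    rcases hp with rfl | hp <;> rcases hq with rfl | hq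
    · simp only; omega
    · have := hb q hq; simp only; omega
    · have := hb p hp; simp only; omega
    · have := h p hp q hq; omega
  have hlo : ∀ p ∈ A, p.1 ≤ a → p.1 ≤ l.1 := fun p hp hpa => hlmax p ⟨hp, hpa⟩
  by_cases hup : ∃ p ∈ A, a ≤ p.1
  · obtain ⟨u, hu, humin⟩ := (A.filter (fun p => a ≤ p.1)).exists_min_image (fun p => p.1)
      (by obtain ⟨p, hp, h1⟩ := hup; exact ⟨p, by simp [hp, h1]⟩)
    simp only [Finset.mem_filter] at hu humin
    have hhi : ∀ p ∈ A, a ≤ p.1 → u.1 ≤ p.1 := fun p hp hpa => humin p ⟨hp, hpa⟩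
    have hlu := h l hl.1 u hu.1
    have hul := h u hu.1 l hl.1
    have hla := hl.2
    have hua := hu.2
    by_cases c1 : a < l.1 + d
    · refine ⟨l.2 + (a - l.1), key _ fun p hp => ?_⟩
      have h1 := h p hp l hl.1
      have h2 := h l hl.1 p hp
      have h3 := h p hp u hu.1
      have h4 := h u hu.1 p hp
      have h5 := hlo p hp
      have h6 := hhi p hp
      omega
    · by_cases c2 : u.1 < a + d
      · refine ⟨u.2 - (u.1 - a), key _ fun p hp => ?_⟩
        have h1 := h p hp l hl.1
        have h2 := h l hl.1 p hp
        have h3 := h p hp u hu.1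
        have h4 := h u hu.1 p hp
        have h5 := hlo p hp
        have h6 := hhi p hp
        omega
      · refine ⟨l.2 + d, key _ fun p hp => ?_⟩
        have h1 := h p hp l hl.1
        have h2 := h l hl.1 p hp
        have h3 := h p hp u hu.1
        have h4 := h u hu.1 p hp
        have h5 := hlo p hp
        have h6 := hhi p hp
        omega
  · push Not at hup
    have hla := hl.2
    refine ⟨l.2 + (a - l.1), key _ fun p hp => ?_⟩
    have h1 := h p hp l hl.1
    have h2 := h l hl.1 p hp
    have h5 := hlo p hp
    have h6 := hup p hp
    omega

/-- order compatibility -/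
def OC (A : Finset (ℕ × ℕ)) (i i' : ℕ) : Prop :=
  ∀ p ∈ A, (p.1 ≤ i ↔ p.2 ≤ i') ∧ (i ≤ p.1 ↔ i' ≤ p.2)

theorem Dist.oc {d A} (h : Dist d A) {i i'} (hi : (i, i') ∈ A) : OC A i i' := by
  intro p hp
  have h1 := h p hp _ hi
  have h2 := h _ hi p hp
  exact ⟨h1.1, h2.1⟩

def SetRel (A : Finset (ℕ × ℕ)) (S S' : Set Node) : Prop :=
  ∀ i i' j, OC A i i' → (node i j ∈ S ↔ node i' j ∈ S')

theorem SetRel.mono {A B : Finset (ℕ × ℕ)} {S S'} (h : SetRel A S S') (hAB : A ⊆ B) :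
    SetRel B S S' := fun i i' j hoc => h i i' j fun p hp => hoc p (hAB hp)

theorem mem_swap {A : Finset (ℕ × ℕ)} {a b} : (a, b) ∈ A.image Prod.swap ↔ (b, a) ∈ A := by
  simp

theorem SetRel.swap {A : Finset (ℕ × ℕ)} {S S'} (h : SetRel A S S') :
    SetRel (A.image Prod.swap) S' S := by
  intro i i' j hoc
  refine (h i' i j fun p hp => ?_).symm
  have := hoc (p.2, p.1) (mem_swap.2 hp)
  exact ⟨this.1.symm, this.2.symm⟩

structure G (c : Prop) (n n' d : ℕ) (A : Finset (ℕ × ℕ)) (V1 : ℕ → Node) (V2 : ℕ → Set Node)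
    (V1' : ℕ → Node) (V2' : ℕ → Set Node) : Prop where
  z : (0, 0) ∈ A
  nn : (n, n') ∈ A
  dist : Dist d A
  v1 : ∀ x, ∃ a b j, (a, b) ∈ A ∧ V1 x = node a j ∧ V1' x = node b j ∧ ok c n a j ∧ ok c n' b j
  v2 : ∀ X, SetRel A (V2 X) (V2' X)

theorem G.swap {c n n' d A V1 V2 V1' V2'} (h : G c n n' d A V1 V2 V1' V2') :
    G c n' n d (A.image Prod.swap) V1' V2' V1 V2 := by
  refine ⟨mem_swap.2 h.z, mem_swap.2 h.nn, h.dist.swap, ?_, fun X => (h.v2 X).swap⟩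
  intro x
  obtain ⟨a, b, j, h1, h2, h3, h4, h5⟩ := h.v1 x
  exact ⟨b, a, j, mem_swap.2 h1, h3, h2, h5, h4⟩

theorem G.mono {c n n' d d' A V1 V2 V1' V2'} (h : G c n n' d A V1 V2 V1' V2') (hd : d' ≤ d) :
    G c n n' d' A V1 V2 V1' V2' := ⟨h.z, h.nn, h.dist.mono hd, h.v1, h.v2⟩

theorem G.ext {c n n' d A V1 V2 V1' V2'} (hd : 1 ≤ d) (h : G c n n' (2 * d) A V1 V2 V1' V2')
    (a : ℕ) : ∃ b B, A ⊆ B ∧ (a, b) ∈ B ∧ G c n n' d B V1 V2 V1' V2' := by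
  obtain ⟨b, hb⟩ := h.dist.ext hd h.z a
  have hs : A ⊆ insert (a, b) A := Finset.subset_insert _ _
  refine ⟨b, insert (a, b) A, hs, Finset.mem_insert_self _ _, hs h.z, hs h.nn, hb, ?_,
    fun X => (h.v2 X).mono hs⟩
  intro x
  obtain ⟨a, b, j, h1, h2⟩ := h.v1 x
  exact ⟨a, b, j, hs h1, h2⟩

theorem ok_iff {c n n' d A} (h : Dist d A) (hn : (n, n') ∈ A) {a b j} (hab : (a, b) ∈ A) :
    ok c n a j ↔ ok c n' b j := by
  have h1 := h _ hn _ hab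
  have h2 := h _ hab _ hn
  simp only at h1 h2
  unfold ok
  have h3 : a = n ↔ b = n' := by omega
  rw [h3, h2.1]

theorem G.fo {c n n' d A V1 V2 V1' V2'} (hd : 1 ≤ d) (h : G c n n' (2 * d) A V1 V2 V1' V2')
    (x : ℕ) (τ : Node) (hτ : τ ∈ Tr c n) : ∃ τ' ∈ Tr c n', ∃ B,
      G c n n' d B (Function.update V1 x τ) V2 (Function.update V1' x τ') V2' := by
  obtain ⟨a, j, rfl, hok⟩ := hτ
  obtain ⟨b, B, hAB, hab, hG⟩ := h.ext hd a
  have hok' := (ok_iff hG.dist hG.nn hab).1 hok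
  refine ⟨node b j, mem_Tr.2 hok', B, hG.z, hG.nn, hG.dist, ?_, hG.v2⟩
  intro y
  by_cases hy : y = x
  · subst hy
    exact ⟨a, b, j, hab, by simp, by simp, hok, hok'⟩
  · simpa [hy] using hG.v1 y

/-- what is needed of the second-order domain -/
def SOForth (D : SODom) (c : Prop) : Prop :=
  ∀ n S, S ∈ D (Tr c n) → ∃ F a e t I U, S = shape F a e t I U ∧
    ∀ n' b e' t' A d, Dist d A → (n, n') ∈ A → (a, b) ∈ A → (e, e') ∈ A → (t, t') ∈ A →
      shape F b e' t' I U ∈ D (Tr c n')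

theorem G.so {D c} (hD : SOForth D c) {n n' d A V1 V2 V1' V2'} (hd : 1 ≤ d)
    (h : G c n n' (8 * d) A V1 V2 V1' V2')
    (X : ℕ) (S : Set Node) (hS : S ∈ D (Tr c n)) : ∃ S' ∈ D (Tr c n'), ∃ B,
      G c n n' d B V1 (Function.update V2 X S) V1' (Function.update V2' X S') := by
  obtain ⟨F, a, e, t, I, U, rfl, hD⟩ := hD n S hS
  have h : G c n n' (2 * (4 * d)) A V1 V2 V1' V2' := h.mono (by omega)
  obtain ⟨b, B, hAB, hab, h1⟩ := h.ext (by omega) a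
  have h1 : G c n n' (2 * (2 * d)) B V1 V2 V1' V2' := h1.mono (by omega)
  obtain ⟨e', B2, hB2, he, h2⟩ := h1.ext (by omega) e
  obtain ⟨t', B3, hB3, ht, h3⟩ := h2.ext (by omega) t
  refine ⟨_, hD n' b e' t' B3 d h3.dist h3.nn (hB3 (hB2 hab)) (hB3 he) ht, B3, h3.z, h3.nn, h3.dist,
    h3.v1, ?_⟩
  intro Y
  by_cases hy : Y = X
  · subst hy
    simp only [Function.update_self]
    intro i i' j hoc
    rw [mem_shape, mem_shape]
    have o1 := hoc _ (hB3 (hB2 hab))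
    have o2 := hoc _ (hB3 he)
    have o3 := hoc _ ht
    simp only at o1 o2 o3
    have o4 : i = t ↔ i' = t' := by omega
    rw [o1.1, o2.2, o4]
  · simpa [hy] using h3.v2 Y

def qr {AP : Type} : MSOL AP → ℕ
  | .atom _ _ => 0
  | .le _ _ => 0
  | .mem _ _ => 0
  | .not φ => qr φ
  | .and φ ψ => max (qr φ) (qr ψ)
  | .exFO _ φ => qr φ + 1
  | .exSO _ φ => qr φ + 1

theorem game {AP : Type} {D c} (hD : SOForth D c) (φ : MSOL AP) :
    ∀ n n' k A V1 V2 V1' V2', qr φ ≤ k → G c n n' (8 ^ k) A V1 V2 V1' V2' →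
      (Sat D (KT AP c n) V1 V2 φ ↔ Sat D (KT AP c n') V1' V2' φ) := by
  induction φ with
  | atom a x => intro n n' k A V1 V2 V1' V2' _ h; simp [Sat, KT]
  | le x y =>
    intro n n' k A V1 V2 V1' V2' _ h
    obtain ⟨a, b, j, h1, h2, h3, h4, h5⟩ := h.v1 x
    obtain ⟨a', b', j', h1', h2', h3', h4', h5'⟩ := h.v1 y
    simp only [Sat, KT, h2, h3, h2', h3', mem_Tr, h4, h5, h4', h5', node_prefix, true_and]
    have o1 := h.dist _ h1 _ h1'
    have o2 := h.dist _ h1' _ h1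
    simp only at o1 o2
    grind
  | mem x X =>
    intro n n' k A V1 V2 V1' V2' _ h
    obtain ⟨a, b, j, h1, h2, h3, h4, h5⟩ := h.v1 x
    simp only [Sat, h2, h3]
    exact h.v2 X a b j (h.dist.oc h1)
  | not φ ih =>
    intro n n' k A V1 V2 V1' V2' hk h
    simp only [Sat, ih n n' k A V1 V2 V1' V2' hk h]
  | and φ ψ ih ih2 =>
    intro n n' k A V1 V2 V1' V2' hk h
    simp only [qr, max_le_iff] at hk
    simp only [Sat, ih n n' k A V1 V2 V1' V2' hk.1 h, ih2 n n' k A V1 V2 V1' V2' hk.2 h]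
  | exFO x φ ih =>
    have half : ∀ n n' k A V1 V2 V1' V2', qr (.exFO x φ) ≤ k → G c n n' (8 ^ k) A V1 V2 V1' V2' →
      (Sat D (KT AP c n) V1 V2 (.exFO x φ) → Sat D (KT AP c n') V1' V2' (.exFO x φ)) := by
      intro n n' k A V1 V2 V1' V2' hk h
      obtain ⟨k, rfl⟩ : ∃ m, k = m + 1 := ⟨k - 1, by simp [qr] at hk; omega⟩
      rintro ⟨τ, hτ, hs⟩
      have hpos : 1 ≤ 8 ^ k := Nat.one_le_pow _ _ (by norm_num)
      obtain ⟨τ', hτ', B, hG⟩ := G.fo hpos (h.mono (by rw [pow_succ]; omega)) x τ hτ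
      exact ⟨τ', hτ', (ih n n' k B _ _ _ _ (by simp [qr] at hk; omega) hG).1 hs⟩
    intro n n' k A V1 V2 V1' V2' hk h
    exact ⟨half _ _ _ _ _ _ _ _ hk h, half _ _ _ _ _ _ _ _ hk h.swap⟩
  | exSO x φ ih =>
    have half : ∀ n n' k A V1 V2 V1' V2', qr (.exSO x φ) ≤ k → G c n n' (8 ^ k) A V1 V2 V1' V2' →
      (Sat D (KT AP c n) V1 V2 (.exSO x φ) → Sat D (KT AP c n') V1' V2' (.exSO x φ)) := by
      intro n n' k A V1 V2 V1' V2' hk h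
      obtain ⟨k, rfl⟩ : ∃ m, k = m + 1 := ⟨k - 1, by simp [qr] at hk; omega⟩
      rintro ⟨τ, hτ, hs⟩
      have hpos : 1 ≤ 8 ^ k := Nat.one_le_pow _ _ (by norm_num)
      obtain ⟨τ', hτ', B, hG⟩ := G.so hD hpos (h.mono (by rw [pow_succ]; omega)) x τ hτ
      exact ⟨τ', hτ', (ih n n' k B _ _ _ _ (by simp [qr] at hk; omega) hG).1 hs⟩
    intro n n' k A V1 V2 V1' V2' hk h
    exact ⟨half _ _ _ _ _ _ _ _ hk h, half _ _ _ _ _ _ _ _ hk h.swap⟩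

theorem game_sentence {AP : Type} {D c} (hD : SOForth D c) (φ : MSOL AP) (hφ : φ.IsSentence) :
    ∃ m, (MLogic.KSat ⟨fun _ => True, D⟩ (KT AP c (2 * m)) φ ↔
      MLogic.KSat ⟨fun _ => True, D⟩ (KT AP c (2 * m + 1)) φ) := by
  refine ⟨8 ^ qr φ, ?_⟩
  have hpos : 1 ≤ 8 ^ qr φ := Nat.one_le_pow _ _ (by norm_num)
  set m := 8 ^ qr φ with hm
  have hred : ∀ n, MLogic.KSat ⟨fun _ => True, D⟩ (KT AP c n) φ ↔
      Sat D (KT AP c n) (fun _ => node 0 0) (fun _ => ∅) φ := by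
    intro n
    constructor
    · rintro ⟨V1, V2, h⟩
      exact (sat_congr D _ φ V1 V2 _ _ (by simp [hφ.1]) (by simp [hφ.2])).1 h
    · intro h; exact ⟨_, _, h⟩
  rw [hred, hred]
  refine game hD φ (2 * m) (2 * m + 1) (qr φ) {(0, 0), (2 * m, 2 * m + 1)} _ _ _ _ le_rfl ?_
  refine ⟨by simp, by simp, ?_, ?_, ?_⟩
  · rw [← hm]
    intro p hp q hq
    simp only [Finset.mem_insert, Finset.mem_singleton] at hp hq
    rcases hp with rfl | rfl <;> rcases hq with rfl | rfl <;> simp only <;> grind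
  · intro x; exact ⟨0, 0, 0, by simp, rfl, rfl, Or.inl rfl, Or.inl rfl⟩
  · intro X i i' j _; simp

theorem shape_subset {F a e t I U c n n' d A b e' t'} (h : shape F a e t I U ⊆ Tr c n)
    (hA : Dist d A) (hn : (n, n') ∈ A) (ht : (t, t') ∈ A) :
    shape F b e' t' I U ⊆ Tr c n' := by
  rintro _ ⟨i, j, rfl, ⟨_, rfl, _⟩ | ⟨rfl, hj⟩⟩
  · exact mem_Tr.2 (Or.inl rfl)
  · rw [mem_Tr, ← ok_iff hA hn ht, ← mem_Tr]
    exact h (mem_shape.2 (Or.inr ⟨rfl, hj⟩))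

theorem Good.transfer {F a e t I U d A b e' t'} (h : Good F a e t I U)
    (hA : Dist d A) (ha : (a, b) ∈ A) (he : (e, e') ∈ A) (ht : (t, t') ∈ A) :
    Good F b e' t' I U := by
  have h1 := (hA _ ha _ he).1
  have h2 := (hA _ ha _ ht).1
  have h3 := (hA _ ht _ he).1
  simp only at h1 h2 h3
  refine ⟨?_, ?_, h.ini, h.conv, h.zero, h.inf⟩
  · rw [← h1]; exact h.ne
  · rw [← h2, ← h3]; exact h.att

theorem forth_MTL : SOForth (coweakDom MTLdom) False := by
  rintro n S ⟨⟨hS, htree⟩, hinf⟩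
  obtain ⟨F, a, e, I, U, rfl, hg⟩ := classify S n htree hinf (by
    intro τ hτ
    obtain ⟨i, j, rfl, h⟩ := hS hτ
    exact ⟨i, j, rfl, by simpa [ok] using h⟩)
  refine ⟨F, a, e, n, I, U, rfl, ?_⟩
  intro n' b e' t' A d hA hn ha he ht
  have hg' := hg.transfer hA ha he ht
  exact ⟨⟨shape_subset hS hA hn ht, hg'.tree⟩, hg'.infinite⟩

theorem shape_chain {F a e t I U} (hg : Good F a e t I U) :
    (∀ x ∈ shape F a e t I U, ∀ y ∈ shape F a e t I U, x <+: y ∨ y <+: x) ↔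
      (F → U.Nonempty → ¬ I ∧ e ≤ t) := by
  constructor
  · rintro h hF ⟨j, hj⟩
    have hj0 : j ≠ 0 := fun h0 => hg.zero (h0 ▸ hj)
    have h1 : 1 ∈ U := hg.ini hF j hj 1 le_rfl (by omega)
    by_contra hcon
    have hat := hg.att hF ⟨j, hj⟩
    have h2 : node (t + 1) 0 ∈ shape F a e t I U := by
      rw [mem_shape]; left
      refine ⟨hF, rfl, by omega, ?_⟩
      by_cases hI : I
      · exact Or.inr hI
      · left
        by_contra hlt
        exact hcon ⟨hI, by omega⟩
    have := h _ (mem_shape.2 (Or.inr ⟨rfl, h1⟩)) _ h2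
    rw [node_prefix, node_prefix] at this
    omega
  · intro h
    rintro _ ⟨i, j, rfl, h1⟩ _ ⟨i', j', rfl, h2⟩
    rw [node_prefix, node_prefix]
    rcases h1 with ⟨hF, rfl, h3, h4⟩ | ⟨rfl, h3⟩ <;> rcases h2 with ⟨hF', rfl, h3', h4'⟩ | ⟨h5, h3'⟩
    · omega
    · have := h hF ⟨_, h3'⟩
      have h6 : i ≤ e := h4.resolve_right this.1
      have := hg.att hF ⟨_, h3'⟩
      omega
    · have := h hF' ⟨_, h3⟩
      have h6 : i' ≤ e := h4'.resolve_right this.1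
      have := hg.att hF' ⟨_, h3⟩
      omega
    · omega

theorem forth_MPL : SOForth (coweakDom MPLdom) True := by
  rintro n S ⟨⟨⟨hS, htree⟩, hpath⟩, hinf⟩
  rw [path_iff_chain S htree] at hpath
  obtain ⟨t, ht⟩ : ∃ t, ∀ i j, node i j ∈ S → j = 0 ∨ i = t := by
    by_cases h : ∃ t j, j ≠ 0 ∧ node t j ∈ S
    · obtain ⟨t, j, hj, hm⟩ := h
      refine ⟨t, fun i j' hi => ?_⟩
      have := hpath _ hm _ hi
      rw [node_prefix, node_prefix] at this
      omega
    · push Not at h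
      refine ⟨0, fun i j hi => Or.inl ?_⟩
      by_contra hj
      exact h i j hj hi
  obtain ⟨F, a, e, I, U, rfl, hg⟩ := classify S t htree hinf (by
    intro τ hτ
    obtain ⟨i, j, rfl, h⟩ := hS hτ
    exact ⟨i, j, rfl, ht i j hτ⟩)
  refine ⟨F, a, e, t, I, U, rfl, ?_⟩
  intro n' b e' t' A d hA hn ha he ht
  have hg' := hg.transfer hA ha he ht
  refine ⟨⟨⟨shape_subset hS hA hn ht, hg'.tree⟩, ?_⟩, hg'.infinite⟩
  rw [path_iff_chain _ hg'.tree, shape_chain hg']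
  rw [shape_chain hg] at hpath
  have := (hA _ he _ ht).1
  simp only at this
  rw [← this]
  exact hpath

/-! ### The separating sentence -/

def Brs (T : Set Node) (v : Node) : Prop := ∃ y ∈ T, ∃ z ∈ T, v <+: y ∧ v <+: z ∧ ¬ y <+: z ∧ ¬ z <+: y
def Chs (T : Set Node) (v u : Node) : Prop :=
  v <+: u ∧ ¬ u <+: v ∧ ∀ w ∈ T, v <+: w → w <+: u → ¬ w <+: v → u <+: w
def Ps (T S : Set Node) (v : Node) : Prop := ∀ u ∈ T, Chs T v u → u ∈ S

section
variable {AP : Type}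

def fBr (x : ℕ) : MSOL AP := .exFO 10 (.exFO 11 (.and (.le x 10) (.and (.le x 11)
  (.and (.not (.le 10 11)) (.not (.le 11 10))))))
def fCh (x y : ℕ) : MSOL AP := .and (.le x y) (.and (.not (.le y x))
  (all 12 (imp (.le x 12) (imp (.le 12 y) (imp (.not (.le 12 x)) (.le y 12))))))
def fP (x : ℕ) : MSOL AP := all 13 (imp (fCh x 13) (.mem 13 0))

theorem sat_Br (D) (K : KripkeTree AP) (V1 V2) (x : ℕ) (hx : x < 5) (hv : V1 x ∈ K.T) :
    Sat D K V1 V2 (fBr x) ↔ Brs K.T (V1 x) := by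
  have h1 : x ≠ 10 := by omega
  have h2 : x ≠ 11 := by omega
  simp [Sat, fBr, Brs, Function.update, h1, h2, hv]
  grind

theorem sat_Ch (D) (K : KripkeTree AP) (V1 V2) (x y : ℕ) (hx : x ≠ 12) (hy : y ≠ 12)
    (hv : V1 x ∈ K.T) (hv' : V1 y ∈ K.T) :
    Sat D K V1 V2 (fCh x y) ↔ Chs K.T (V1 x) (V1 y) := by
  simp [Sat, fCh, Chs, Function.update, hx, hy, hv, hv']
  grind

theorem sat_P (D) (K : KripkeTree AP) (V1 V2) (x : ℕ) (hx : x < 5) (hv : V1 x ∈ K.T) :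
    Sat D K V1 V2 (fP x) ↔ Ps K.T (V2 0) (V1 x) := by
  have h1 : x ≠ 13 := by omega
  simp only [fP, sat_all, sat_imp, Ps]
  refine forall₂_congr fun u hu => ?_
  rw [sat_Ch _ _ _ _ _ _ (by omega) (by omega) (by simpa [h1] using hv) (by simpa using hu)]
  simp [h1, Sat]

def fMain : MSOL AP := .exSO 0 (.and (all 0 (imp (all 1 (.le 0 1)) (fP 0)))
  (.and (all 0 (all 1 (imp (fCh 0 1) (imp (fBr 1)
      (.and (imp (fP 0) (.not (fP 1))) (imp (.not (fP 1)) (fP 0)))))))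
    (all 0 (imp (fBr 0) (imp (all 1 (imp (fCh 0 1) (.not (fBr 1)))) (fP 0))))))

theorem fMain_sentence : (fMain : MSOL AP).IsSentence := by
  constructor
  · ext x; simp [fMain, fP, fBr, fCh, MSOL.freeFO]; grind
  · ext x; simp [fMain, fP, fBr, fCh, MSOL.freeSO]

def Alt (T S : Set Node) : Prop :=
  (∀ v ∈ T, (∀ w ∈ T, v <+: w) → Ps T S v) ∧
  (∀ v ∈ T, ∀ u ∈ T, Chs T v u → Brs T u → (Ps T S v ↔ ¬ Ps T S u)) ∧
  (∀ v ∈ T, Brs T v → (∀ u ∈ T, Chs T v u → ¬ Brs T u) → Ps T S v)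

theorem sat_main (D) (K : KripkeTree AP) (V1 V2) :
    Sat D K V1 V2 fMain ↔ ∃ S ∈ D K.T, Alt K.T S := by
  simp only [fMain, Alt, Sat, sat_all, sat_imp]
  refine exists_congr fun S => and_congr_right fun _ => and_congr ?_ (and_congr ?_ ?_)
  · refine forall₂_congr fun v hv => ?_
    rw [sat_P _ _ _ _ _ (by omega) (by simpa using hv)]
    simp +contextual [Function.update, hv]
  · refine forall₂_congr fun v hv => forall₂_congr fun u hu => ?_
    rw [sat_P _ _ _ _ 0 (by omega) (by simpa [Function.update] using hv),
      sat_P _ _ _ _ 1 (by omega) (by simpa [Function.update] using hu),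
      sat_Br _ _ _ _ 1 (by omega) (by simpa [Function.update] using hu),
      sat_Ch _ _ _ _ 0 1 (by omega) (by omega) (by simpa [Function.update] using hv)
        (by simpa [Function.update] using hu)]
    simp [Function.update]
    tauto
  · refine forall₂_congr fun v hv => ?_
    rw [sat_P _ _ _ _ 0 (by omega) (by simpa [Function.update] using hv),
      sat_Br _ _ _ _ 0 (by omega) (by simpa [Function.update] using hv)]
    refine imp_congr (by simp) (imp_congr ?_ (by simp))
    refine forall₂_congr fun u hu => ?_
    rw [sat_Br _ _ _ _ 1 (by omega) (by simpa [Function.update] using hu),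
      sat_Ch _ _ _ _ 0 1 (by omega) (by omega) (by simpa [Function.update] using hv)
        (by simpa [Function.update] using hu)]
    simp [Function.update]
end

theorem br_iff {c n i j} (h : ok c n i j) : Brs (Tr c n) (node i j) ↔ j = 0 ∧ i ≤ n := by
  constructor
  · rintro ⟨_, ⟨p, q, rfl, h1⟩, _, ⟨p', q', rfl, h1'⟩, h2, h3, h4, h5⟩
    rw [node_prefix] at *
    unfold ok at *
    grind
  · rintro ⟨rfl, hi⟩
    refine ⟨node n 1, mem_Tr.2 (Or.inr (Or.inl rfl)), node (n + 1) 0, mem_Tr.2 (Or.inl rfl), ?_⟩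
    simp only [node_prefix]
    grind

theorem ch_iff {c n i p q} (hn : ok c n p q) : Chs (Tr c n) (node i 0) (node p q) ↔
    (p = i + 1 ∧ q = 0) ∨ (p = i ∧ q = 1) := by
  constructor
  · rintro ⟨h1, h2, h3⟩
    rw [node_prefix] at h1 h2
    by_cases hpi : p = i
    · subst hpi
      have := h3 (node p 1) (mem_Tr.2 (by unfold ok at *; grind))
      simp only [node_prefix] at this
      grind
    · have := h3 (node (i + 1) 0) (mem_Tr.2 (Or.inl rfl))
      simp only [node_prefix] at this
      grind
  · intro h
    refine ⟨?_, ?_, ?_⟩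
    · rw [node_prefix]; omega
    · rw [node_prefix]; omega
    · rintro _ ⟨a, b, rfl, _⟩ h1 h2 h3
      rw [node_prefix] at *
      omega

theorem alt_even {c n S} (h : Alt (Tr c n) S) : Even n := by
  obtain ⟨h1, h2, h3⟩ := h
  have hm : ∀ i, node i 0 ∈ Tr c n := fun i => mem_Tr.2 (Or.inl rfl)
  have key : ∀ i, i ≤ n → (Ps (Tr c n) S (node i 0) ↔ Even i) := by
    intro i
    induction i with
    | zero =>
      intro _
      have := h1 (node 0 0) (hm 0) (fun w _ => List.nil_prefix)
      simp [this]
    | succ i ih =>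
      intro hi
      have := h2 _ (hm i) _ (hm (i + 1)) ((ch_iff (Or.inl rfl)).2 (by simp))
        ((br_iff (Or.inl rfl)).2 ⟨rfl, hi⟩)
      rw [ih (by omega)] at this
      rw [Nat.even_add_one]
      tauto
  refine (key n le_rfl).1 (h3 _ (hm n) ((br_iff (Or.inl rfl)).2 ⟨rfl, le_rfl⟩) ?_)
  rintro _ ⟨p, q, rfl, hok⟩ hch hbr
  rw [ch_iff hok] at hch
  rw [br_iff hok] at hbr
  omega

theorem alt_of {c n S} (hn : Even n)
    (h : ∀ i, i ≤ n → (Ps (Tr c n) S (node i 0) ↔ Even i)) : Alt (Tr c n) S := by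
  refine ⟨?_, ?_, ?_⟩
  · intro v _ hv
    have := hv (node 0 0) (mem_Tr.2 (Or.inl rfl))
    have hv0 : v = node 0 0 := List.prefix_nil.1 this
    subst hv0
    exact (h 0 (by omega)).2 (by simp)
  · rintro _ ⟨p, q, rfl, hok⟩ _ ⟨p', q', rfl, hok'⟩ hch hbr
    rw [br_iff hok'] at hbr
    obtain ⟨rfl, hp'⟩ := hbr
    have hq : q = 0 := by
      have h1 := hch.1
      have h2 := hch.2.1
      rw [node_prefix] at h1 h2
      omega
    subst hq
    rw [ch_iff hok'] at hch
    have : p' = p + 1 := by omega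
    subst this
    rw [h p (by omega), h (p + 1) hp', Nat.even_add_one]
    tauto
  · rintro _ ⟨p, q, rfl, hok⟩ hbr hno
    rw [br_iff hok] at hbr
    obtain ⟨rfl, hp⟩ := hbr
    have : p = n := by
      by_contra hne
      exact hno (node (p + 1) 0) (mem_Tr.2 (Or.inl rfl)) ((ch_iff (Or.inl rfl)).2 (by simp))
        ((br_iff (Or.inl rfl)).2 ⟨rfl, by omega⟩)
    subst this
    exact (h p hp).2 hn

def selSet (c : Prop) (n : ℕ) (Q : ℕ → ℕ → Prop) : Set Node :=
  {τ | ∃ i j, τ = node i j ∧ ok c n i j ∧ Q i j}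

theorem mem_sel {c n Q i j} : node i j ∈ selSet c n Q ↔ ok c n i j ∧ Q i j := by
  constructor
  · rintro ⟨i', j', h, h'⟩
    obtain ⟨rfl, rfl⟩ := node_inj.1 h
    exact h'
  · intro h; exact ⟨i, j, rfl, h⟩

theorem sel_P {c n Q i} : Ps (Tr c n) (selSet c n Q) (node i 0) ↔
    Q (i + 1) 0 ∧ (ok c n i 1 → Q i 1) := by
  constructor
  · intro h
    refine ⟨?_, fun hok => ?_⟩
    · exact (mem_sel.1 (h _ (mem_Tr.2 (Or.inl rfl)) ((ch_iff (Or.inl rfl)).2 (by simp)))).2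
    · exact (mem_sel.1 (h _ (mem_Tr.2 hok) ((ch_iff hok).2 (by simp)))).2
  · rintro ⟨h1, h2⟩ _ ⟨p, q, rfl, hok⟩ hch
    rw [ch_iff hok] at hch
    rw [mem_sel]
    refine ⟨hok, ?_⟩
    rcases hch with ⟨rfl, rfl⟩ | ⟨rfl, rfl⟩
    · exact h1
    · exact h2 hok

theorem exMTL (n : ℕ) (hn : Even n) : ∃ S ∈ coweakDom MTLdom (Tr True n), Alt (Tr True n) S := by
  refine ⟨selSet True n (fun i j => j = 0 ∨ Even i), ⟨⟨?_, ?_⟩, ?_⟩, alt_of hn ?_⟩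
  · rintro _ ⟨i, j, rfl, h, _⟩; exact mem_Tr.2 h
  · rw [tree_iff _ (by rintro _ ⟨i, j, rfl, _⟩; exact ⟨i, j, rfl⟩)]
    refine ⟨0, 0, mem_sel.2 ⟨Or.inl rfl, Or.inl rfl⟩, ?_⟩
    intro i j hij
    refine ⟨Or.inr ⟨rfl, by omega⟩, ?_⟩
    intro p q _ h
    rw [mem_sel] at *
    unfold ok at *
    grind
  · refine Set.infinite_of_injective_forall_mem (f := fun m : ℕ => node m 0) ?_ ?_
    · intro x y hxy; simpa [node_inj] using hxy
    · intro m; exact mem_sel.2 ⟨Or.inl rfl, Or.inl rfl⟩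
  · intro i hi
    rw [sel_P]
    simp [ok, hi]

theorem exMSO (n : ℕ) (hn : Even n) :
    ∃ S ∈ coweakDom MSOdom (Tr False n), Alt (Tr False n) S := by
  refine ⟨selSet False n (fun i j => 1 ≤ j ∨ n < i ∨ ¬ Even i), ⟨?_, ?_⟩, alt_of hn ?_⟩
  · rintro _ ⟨i, j, rfl, h, _⟩; exact mem_Tr.2 h
  · refine Set.infinite_of_injective_forall_mem (f := fun m : ℕ => node n (m + 1)) ?_ ?_
    · intro x y hxy; simpa [node_inj] using hxy
    · intro m; exact mem_sel.2 ⟨Or.inr (Or.inl rfl), Or.inl (by omega)⟩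
  · intro i hi
    rw [sel_P, Nat.even_add_one]
    by_cases h : n = i
    · subst h; simp [hn]
    · have : ¬ n < i + 1 := by omega
      simp [this]

theorem not_leq {AP : Type} (D D' : SODom) (c : Prop) (hD : SOForth D c)
    (hD' : ∀ n, Even n → ∃ S ∈ D' (Tr c n), Alt (Tr c n) S) :
    ¬ MLogic.Leq (finBrKT AP) ⟨fun _ => True, D'⟩ ⟨fun _ => True, D⟩ := by
  intro h
  obtain ⟨φ, hφ, _, heq⟩ := h fMain fMain_sentence trivial
  obtain ⟨m, hm⟩ := game_sentence hD φ hφ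
  rw [← heq _ (Tr_fin c _), ← heq _ (Tr_fin c _)] at hm
  have h1 : MLogic.KSat ⟨fun _ => True, D'⟩ (KT AP c (2 * m)) fMain :=
    ⟨fun _ => [], fun _ => ∅, (sat_main _ _ _ _).2 (hD' (2 * m) (by simp))⟩
  obtain ⟨V1, V2, h2⟩ := hm.1 h1
  obtain ⟨S, _, hS⟩ := (sat_main _ _ _ _).1 h2
  have := alt_even hS
  rw [Nat.even_add_one] at this
  simp at this

end CW

/-- over finitely-branching Kripke trees,
CoWMPL < CoWMTL < CoWMSO. -/
theorem stmt9 (AP : Type) [Fintype AP] :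
    MLogic.Lt (finBrKT AP) (CoWMPL AP) (CoWMTL AP) ∧
    MLogic.Lt (finBrKT AP) (CoWMTL AP) (CoWMSO AP) := by
  exact ⟨⟨CW.leq1 _, CW.not_leq _ _ True CW.forth_MPL CW.exMTL⟩,
    CW.leq2 _, CW.not_leq _ _ False CW.forth_MTL CW.exMSO⟩
end

section
/- Over the class of all Kripke trees, MSO and WMSO are expressively incomparable, MTL and WMTL are expressively incomparable, MSO and WMTL are expressively incomparable, and MTL and WMSO are expressively incomparable. Over the class of finitely-branching Kripke trees, WMSO < MSO, WMTL < MTL, and MTL and WMSO are expressively incomparable. -/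
/-! ## General facts -/

namespace MSOL
variable {AP : Type}

def all1 (x : ℕ) (φ : MSOL AP) : MSOL AP := .not (.exFO x (.not φ))
def imp (φ ψ : MSOL AP) : MSOL AP := .not (.and φ (.not ψ))
def lt (x y : ℕ) : MSOL AP := .and (.le x y) (.not (.le y x))

end MSOL

section general
variable {AP : Type}

theorem sat_not (D : SODom) (K : KripkeTree AP) (V1 V2) (φ : MSOL AP) :
    Sat D K V1 V2 (.not φ) ↔ ¬ Sat D K V1 V2 φ := by rw [Sat]

theorem sat_and (D : SODom) (K : KripkeTree AP) (V1 V2) (φ ψ : MSOL AP) :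
    Sat D K V1 V2 (.and φ ψ) ↔ Sat D K V1 V2 φ ∧ Sat D K V1 V2 ψ := by rw [Sat]

theorem sat_exFO (D : SODom) (K : KripkeTree AP) (V1 V2) (x) (φ : MSOL AP) :
    Sat D K V1 V2 (.exFO x φ) ↔ ∃ τ ∈ K.T, Sat D K (Function.update V1 x τ) V2 φ := by rw [Sat]

theorem sat_exSO (D : SODom) (K : KripkeTree AP) (V1 V2) (x) (φ : MSOL AP) :
    Sat D K V1 V2 (.exSO x φ) ↔ ∃ S ∈ D K.T, Sat D K V1 (Function.update V2 x S) φ := by rw [Sat]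

theorem sat_le (D : SODom) (K : KripkeTree AP) (V1 V2) (x y) :
    Sat D K V1 V2 (.le x y) ↔ V1 x ∈ K.T ∧ V1 y ∈ K.T ∧ V1 x <+: V1 y := by rw [Sat]

theorem sat_mem (D : SODom) (K : KripkeTree AP) (V1 V2) (x y) :
    Sat D K V1 V2 (.mem x y) ↔ V1 x ∈ V2 y := by rw [Sat]

theorem sat_all1 (D : SODom) (K : KripkeTree AP) (V1 V2) (x) (φ : MSOL AP) :
    Sat D K V1 V2 (.all1 x φ) ↔ ∀ τ ∈ K.T, Sat D K (Function.update V1 x τ) V2 φ := by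
  simp [MSOL.all1, sat_not, sat_exFO]

theorem sat_imp (D : SODom) (K : KripkeTree AP) (V1 V2) (φ ψ : MSOL AP) :
    Sat D K V1 V2 (.imp φ ψ) ↔ (Sat D K V1 V2 φ → Sat D K V1 V2 ψ) := by
  simp [MSOL.imp, sat_not, sat_and]

theorem sat_lt (D : SODom) (K : KripkeTree AP) (V1 V2) (x y) :
    Sat D K V1 V2 (.lt x y) ↔
      V1 x ∈ K.T ∧ V1 y ∈ K.T ∧ V1 x <+: V1 y ∧ V1 x ≠ V1 y := by
  simp only [MSOL.lt, sat_and, sat_not, sat_le]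
  constructor
  · rintro ⟨⟨h1, h2, h3⟩, h4⟩
    exact ⟨h1, h2, h3, fun h => h4 ⟨h2, h1, h ▸ List.prefix_rfl⟩⟩
  · rintro ⟨h1, h2, h3, h4⟩
    exact ⟨⟨h1, h2, h3⟩, fun h => h4 (h3.eq_of_length_le h.2.2.length_le)⟩

theorem sat_congr (D : SODom) (K : KripkeTree AP) (φ : MSOL AP) :
    ∀ (V1 V1' : ℕ → Node) (V2 V2' : ℕ → Set Node),
      (∀ x ∈ φ.freeFO, V1 x = V1' x) → (∀ X ∈ φ.freeSO, V2 X = V2' X) →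
      (Sat D K V1 V2 φ ↔ Sat D K V1' V2' φ) := by
  induction φ with
  | atom a x => intro V1 V1' V2 V2' h1 h2; simp only [Sat]; rw [h1 x (by simp [MSOL.freeFO])]
  | le x y =>
    intro V1 V1' V2 V2' h1 h2
    rw [sat_le, sat_le, h1 x (by simp [MSOL.freeFO]), h1 y (by simp [MSOL.freeFO])]
  | mem x X =>
    intro V1 V1' V2 V2' h1 h2
    rw [sat_mem, sat_mem, h1 x (by simp [MSOL.freeFO]), h2 X (by simp [MSOL.freeSO])]
  | not φ ih =>
    intro V1 V1' V2 V2' h1 h2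
    rw [sat_not, sat_not, ih V1 V1' V2 V2' h1 h2]
  | and φ ψ ih1 ih2 =>
    intro V1 V1' V2 V2' h1 h2
    rw [sat_and, sat_and, ih1 V1 V1' V2 V2' (fun x hx => h1 x (Or.inl hx)) (fun x hx => h2 x (Or.inl hx)),
      ih2 V1 V1' V2 V2' (fun x hx => h1 x (Or.inr hx)) (fun x hx => h2 x (Or.inr hx))]
  | exFO x φ ih =>
    intro V1 V1' V2 V2' h1 h2
    rw [sat_exFO, sat_exFO]
    refine exists_congr fun τ => and_congr_right fun _ => ih _ _ _ _ (fun y hy => ?_) h2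
    by_cases h : y = x
    · subst h; simp
    · simp only [Function.update_of_ne h]; exact h1 y ⟨hy, h⟩
  | exSO X φ ih =>
    intro V1 V1' V2 V2' h1 h2
    rw [sat_exSO, sat_exSO]
    refine exists_congr fun τ => and_congr_right fun _ => ih _ _ _ _ h1 (fun y hy => ?_)
    by_cases h : y = X
    · subst h; simp
    · simp only [Function.update_of_ne h]; exact h2 y ⟨hy, h⟩

theorem ksat_iff (L : MLogic AP) (K : KripkeTree AP) (φ : MSOL AP) (h : φ.IsSentence) (V1 V2) :
    L.KSat K φ ↔ Sat L.dom K V1 V2 φ := by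
  constructor
  · rintro ⟨W1, W2, hW⟩
    exact (sat_congr _ _ _ _ _ _ _ (by simp [h.1]) (by simp [h.2])).1 hW
  · intro h; exact ⟨_, _, h⟩

theorem leq_mono {M M' : Set (KripkeTree AP)} (hM : M ⊆ M') {L L' : MLogic AP}
    (h : MLogic.Leq M' L L') : MLogic.Leq M L L' := by
  intro φ h1 h2
  obtain ⟨φ', h3, h4, h5⟩ := h φ h1 h2
  exact ⟨φ', h3, h4, fun K hK => h5 K (hM hK)⟩

theorem leq_trans {M : Set (KripkeTree AP)} {L L' L'' : MLogic AP}
    (h : MLogic.Leq M L L') (h' : MLogic.Leq M L' L'') : MLogic.Leq M L L'' := by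
  intro φ h1 h2
  obtain ⟨φ', h3, h4, h5⟩ := h φ h1 h2
  obtain ⟨φ'', h6, h7, h8⟩ := h' φ' h3 h4
  exact ⟨φ'', h6, h7, fun K hK => (h5 K hK).trans (h8 K hK)⟩

/-- relativization of second-order quantifiers -/
def relat (θ : ℕ → MSOL AP) : MSOL AP → MSOL AP
  | .atom a x => .atom a x
  | .le x y => .le x y
  | .mem x X => .mem x X
  | .not φ => .not (relat θ φ)
  | .and φ ψ => .and (relat θ φ) (relat θ ψ)
  | .exFO x φ => .exFO x (relat θ φ)
  | .exSO X φ => .exSO X (.and (θ X) (relat θ φ))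

theorem relat_freeFO (θ : ℕ → MSOL AP) (h : ∀ X, (θ X).freeFO = ∅) (φ : MSOL AP) :
    (relat θ φ).freeFO = φ.freeFO := by
  induction φ <;> simp_all [relat, MSOL.freeFO]

theorem relat_freeSO (θ : ℕ → MSOL AP) (h : ∀ X, (θ X).freeSO = {X}) (φ : MSOL AP) :
    (relat θ φ).freeSO = φ.freeSO := by
  induction φ <;> simp_all [relat, MSOL.freeSO]

theorem relat_leq (M : Set (KripkeTree AP)) (D D' : SODom) (θ : ℕ → MSOL AP)
    (h1 : ∀ X, (θ X).freeFO = ∅) (h2 : ∀ X, (θ X).freeSO = {X})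
    (h3 : ∀ K ∈ M, ∀ V1 V2 X S,
      (S ∈ D' K.T ∧ Sat D' K V1 (Function.update V2 X S) (θ X)) ↔ S ∈ D K.T) :
    MLogic.Leq M ⟨fun _ => True, D⟩ ⟨fun _ => True, D'⟩ := by
  intro φ hφ hT
  refine ⟨relat θ φ, ⟨?_, ?_⟩, trivial, fun K hK => ?_⟩
  · rw [relat_freeFO θ h1]; exact hφ.1
  · rw [relat_freeSO θ h2]; exact hφ.2
  · unfold MLogic.KSat
    refine exists_congr fun V1 => exists_congr fun V2 => ?_
    clear hφ hT
    induction φ generalizing V1 V2 with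
    | atom a x => simp [relat, Sat]
    | le x y => simp [relat, Sat]
    | mem x y => simp [relat, Sat]
    | not φ ih => simp only [relat, sat_not]; exact not_congr (ih _ _)
    | and φ ψ ih ih' => simp only [relat, sat_and]; exact and_congr (ih _ _) (ih' _ _)
    | exFO x φ ih =>
      simp only [relat, sat_exFO]
      exact exists_congr fun τ => and_congr_right fun _ => ih _ _
    | exSO X φ ih =>
      simp only [relat, sat_exSO, sat_and]
      refine exists_congr fun S => ?_
      rw [← and_assoc, h3 K hK]
      exact and_congr_right fun _ => ih _ _

theorem isTreeRooted_iff (T : Set Node) (r : Node) :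
    IsTreeRooted T r ↔ r ∈ T ∧ (∀ τ ∈ T, r <+: τ) ∧
      ∀ τ ∈ T, ∀ σ, r <+: σ → σ <+: τ → σ ∈ T := by
  unfold IsTreeRooted
  refine and_congr_right fun _ => and_congr_right fun h => ⟨fun h' => ?_, fun h' => ?_⟩
  · rintro τ hτ σ ⟨s, rfl⟩ hs
    obtain ⟨t, rfl⟩ := h τ hτ
    exact h' t s hτ ((List.prefix_append_right_inj r).1 hs)
  · intro σ σ' hs hp
    exact h' _ hs _ (List.prefix_append _ _) ((List.prefix_append_right_inj r).2 hp)

/-- formula: `X` is a tree -/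
def treeF (X : ℕ) : MSOL AP :=
  .exFO 0 (.and (.mem 0 X) (.all1 1 (.imp (.mem 1 X) (.and (.le 0 1)
    (.all1 2 (.imp (.and (.le 0 2) (.le 2 1)) (.mem 2 X)))))))

theorem mtl_leq_mso (M : Set (KripkeTree AP)) : MLogic.Leq M (MTL AP) (MSO AP) := by
  refine relat_leq M _ _ treeF ?_ ?_ ?_
  · intro X; ext z; simp [treeF, MSOL.freeFO, MSOL.all1, MSOL.imp]; omega
  · intro X; ext z; simp [treeF, MSOL.freeSO, MSOL.all1, MSOL.imp]
  · intro K _ V1 V2 X S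
    simp only [MSOdom, MTLdom, Set.mem_ofPred_eq]
    refine and_congr_right fun hS => ?_
    simp only [treeF, sat_exFO, sat_and, sat_all1, sat_imp, sat_mem, sat_le, IsTree]
    simp [isTreeRooted_iff]
    constructor
    · rintro ⟨r, h1, h2, h3⟩
      exact ⟨r, h2, fun τ hτ => (h3 τ (hS hτ) hτ).1.2.2, fun τ hτ σ h4 h5 => by
        obtain ⟨ρ, hρ⟩ := K.rooted |> (isTreeRooted_iff _ _).1
        have : σ ∈ K.T := hρ.2 τ (hS hτ) σ ((hρ.1 r h1).trans h4) h5
        exact (h3 τ (hS hτ) hτ).2 σ this h1 this h4 this (hS hτ) h5⟩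
    · rintro ⟨r, h1, h2, h3⟩
      exact ⟨r, hS h1, h1, fun τ hτ hτ' => ⟨⟨hS h1, hτ, h2 τ hτ'⟩,
        fun σ _ _ _ h4 _ _ h5 => h3 τ hτ' σ h4 h5⟩⟩

end general

section child
variable {AP : Type}

/-- formula: `y` is a child of `x` (with auxiliary variable `w`) -/
def chF (x y w : ℕ) : MSOL AP :=
  .and (.lt x y) (.not (.exFO w (.and (.lt x w) (.lt w y))))

theorem sat_chF (D : SODom) (K : KripkeTree AP) (V1 V2) (x y w : ℕ) (hx : x ≠ w) (hy : y ≠ w) :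
    Sat D K V1 V2 (chF x y w) ↔ V1 x ∈ K.T ∧ V1 y ∈ K.T ∧ ∃ n, V1 y = V1 x ++ [n] := by
  have hr := (isTreeRooted_iff _ _).1 K.rooted
  simp only [chF, sat_and, sat_not, sat_exFO, sat_lt]
  simp only [Function.update_self, Function.update_of_ne hx, Function.update_of_ne hy]
  constructor
  · rintro ⟨⟨h1, h2, ⟨t, ht⟩, h4⟩, h5⟩
    refine ⟨h1, h2, ?_⟩
    cases t with
    | nil => simp at ht; exact absurd ht h4
    | cons n t =>
      refine ⟨n, ?_⟩
      by_contra hne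
      have hp : V1 x ++ [n] <+: V1 y := ⟨t, by simp [← ht]⟩
      have hT := hr.2.2 _ h2 _ ((hr.2.1 _ h1).trans (List.prefix_append _ [n])) hp
      exact h5 ⟨V1 x ++ [n], hT, ⟨h1, hT, List.prefix_append _ _, by simp⟩, hT, h2, hp, fun h => hne h.symm⟩
  · rintro ⟨h1, h2, n, hn⟩
    rw [hn] at h2 ⊢
    refine ⟨⟨h1, h2, List.prefix_append _ _, by simp⟩, ?_⟩
    rintro ⟨v, hv, ⟨_, _, h3, h4⟩, _, _, h5, h6⟩
    have a1 := h3.length_le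
    have a2 := h5.length_le
    simp at a2
    have a3 : (V1 x).length ≠ v.length := fun h => h4 (h3.eq_of_length h)
    have a4 : v.length ≠ (V1 x ++ [n]).length := fun h => h6 (h5.eq_of_length h)
    simp at a4
    omega

end child
/-! ## Finiteness is definable over finitely branching trees -/

section partC
variable {AP : Type}

def finF (X : ℕ) : MSOL AP :=
  .not (.exSO (X+1) (.and (.exFO 0 (.mem 0 (X+1))) (.all1 0 (.imp (.mem 0 (X+1))
    (.and (.exFO 1 (.and (.mem 1 (X+1)) (.lt 0 1))) (.exFO 1 (.and (.mem 1 X) (.le 0 1))))))))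

/-- nodes with infinitely many descendants in `S` -/
def infDesc (T S : Set Node) : Set Node := {x | x ∈ T ∧ {z | z ∈ S ∧ x <+: z}.Infinite}

theorem infDesc_tree (K : KripkeTree AP) (S : Set Node) (hS : S ⊆ K.T) (hinf : S.Infinite) :
    IsTreeRooted (infDesc K.T S) K.root := by
  have hr := (isTreeRooted_iff _ _).1 K.rooted
  rw [isTreeRooted_iff]
  refine ⟨⟨hr.1, ?_⟩, fun τ hτ => hr.2.1 τ hτ.1, fun τ hτ σ h1 h2 => ⟨hr.2.2 τ hτ.1 σ h1 h2, ?_⟩⟩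
  · refine hinf.mono fun z hz => ⟨hz, hr.2.1 z (hS hz)⟩
  · exact hτ.2.mono fun z hz => ⟨hz.1, h2.trans hz.2⟩

theorem infDesc_child (K : KripkeTree AP) (hK : FinBranching K.T) (S : Set Node) (hS : S ⊆ K.T)
    (x : Node) (hx : x ∈ infDesc K.T S) : ∃ y ∈ infDesc K.T S, x <+: y ∧ x ≠ y := by
  have hr := (isTreeRooted_iff _ _).1 K.rooted
  by_contra hcon
  push Not at hcon
  have hfin := hK x hx.1
  apply hx.2
  have hsub : {z | z ∈ S ∧ x <+: z} ⊆ {x} ∪ ⋃ y ∈ {τ' : Node | childIn K.T x τ'},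
      {z | z ∈ S ∧ y <+: z} := by
    rintro z ⟨hz, t, rfl⟩
    cases t with
    | nil => left; simp
    | cons n t =>
      right
      have hp : x ++ [n] <+: x ++ n :: t := ⟨t, by simp⟩
      simp only [Set.mem_iUnion]
      refine ⟨x ++ [n], ⟨hr.2.2 _ (hS hz) _ ((hr.2.1 x hx.1).trans (List.prefix_append _ _)) hp, n, rfl⟩, hz, hp⟩
  refine Set.Finite.subset ((Set.finite_singleton x).union (hfin.biUnion fun y hy => ?_)) hsub
  by_contra hy'
  obtain ⟨hyT, n, rfl⟩ := hy
  have := hcon (x ++ [n]) ⟨hyT, hy'⟩ (List.prefix_append _ _)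
  simp at this

theorem sat_finF (D : SODom) (K : KripkeTree AP) (hK : FinBranching K.T)
    (hD : ∀ S ∈ D K.T, S ⊆ K.T) (hD' : ∀ S, S ⊆ K.T → IsTree S → S ∈ D K.T)
    (V1 V2 X) (S : Set Node) (hS : S ⊆ K.T) :
    Sat D K V1 (Function.update V2 X S) (finF X) ↔ S.Finite := by
  simp only [finF, sat_exFO, sat_exSO, sat_not, sat_and, sat_all1, sat_imp, sat_mem, sat_le, sat_lt]
  simp
  constructor
  · intro h
    by_contra hinf
    have ht := infDesc_tree K S hS hinf
    obtain ⟨x, hxT, hx, h1⟩ := h (infDesc K.T S) (hD' _ (fun x hx => hx.1) ⟨_, ht⟩) K.root K.rooted.1 ht.1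
    obtain ⟨y, hy, hxy, hne⟩ := infDesc_child K hK S hS x hx
    obtain ⟨z, hz⟩ := hx.2.nonempty
    exact h1 y hy.1 hy hxT hy.1 hxy hne z (hS hz.1) hz.1 hxT (hS hz.1) hz.2
  · intro hfin Y hY x0 _ hx0
    by_contra hcon
    push Not at hcon
    have hb : ∀ n : ℕ, ∃ x ∈ Y, n ≤ x.length := by
      intro n
      induction n with
      | zero => exact ⟨x0, hx0, Nat.zero_le _⟩
      | succ n ih =>
        obtain ⟨x, hx, hn⟩ := ih
        obtain ⟨y, _, hy, _, _, h1, h2, _⟩ := hcon x (hD _ hY hx) hx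
        refine ⟨y, hy, ?_⟩
        by_contra h3
        exact h2 (h1.eq_of_length_le (by omega))
    obtain ⟨n, hn⟩ := (hfin.image List.length).bddAbove
    obtain ⟨x, hx, hxn⟩ := hb (n+1)
    obtain ⟨y, _, hy, _, _, h1, h2, z, _, hz, _, _, hxz⟩ := hcon x (hD _ hY hx) hx
    have := hn ⟨z, hz, rfl⟩
    have := hxz.length_le
    omega

theorem wmso_leq_mso : MLogic.Leq (finBrKT AP) (WMSO AP) (MSO AP) := by
  refine relat_leq _ _ _ finF ?_ ?_ ?_
  · intro X; ext z; simp [finF, MSOL.freeFO, MSOL.all1, MSOL.imp, MSOL.lt]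
  · intro X; ext z; simp [finF, MSOL.freeSO, MSOL.all1, MSOL.imp, MSOL.lt]
  · intro K hK V1 V2 X S
    refine and_congr_right fun hS => ?_
    exact sat_finF _ K hK (fun S hS => hS) (fun S hS _ => hS) V1 V2 X S hS

theorem wmtl_leq_mtl : MLogic.Leq (finBrKT AP) (WMTL AP) (MTL AP) := by
  refine relat_leq _ _ _ finF ?_ ?_ ?_
  · intro X; ext z; simp [finF, MSOL.freeFO, MSOL.all1, MSOL.imp, MSOL.lt]
  · intro X; ext z; simp [finF, MSOL.freeSO, MSOL.all1, MSOL.imp, MSOL.lt]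
  · intro K hK V1 V2 X S
    refine and_congr_right fun hS => ?_
    exact sat_finF MTLdom K hK (fun S hS => hS.1) (fun S hS h => ⟨hS, h⟩) V1 V2 X S hS.1

end partC
/-! ## A non Borel set -/

section partA

def preL {α : Type} (c : ℕ → α) (n : ℕ) : List α := (List.range n).map c

@[simp] theorem preL_length {α : Type} (c : ℕ → α) (n : ℕ) : (preL c n).length = n := by
  simp [preL]

theorem preL_eq_of {α : Type} {c c' : ℕ → α} {n i : ℕ} (h : preL c n = preL c' n) (hi : i < n) :
    c i = c' i := by
  have := congrArg (fun l => l[i]?) h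
  simpa [preL, hi] using this

theorem preL_prefix {α : Type} {c : ℕ → α} {n : ℕ} {p : List α} (h : p <+: preL c n) :
    p = preL c p.length := by
  have h1 := h.length_le
  rw [preL_length] at h1
  rw [List.prefix_iff_eq_take] at h
  rw [preL, ← List.map_take, List.take_range, min_eq_left h1] at h
  exact h

theorem preL_mono {α : Type} (c : ℕ → α) (n : ℕ) : preL c n ++ [c n] = preL c (n+1) := by
  simp [preL, List.range_succ]

abbrev codeA (c : ℕ → Bool) (p : List ℕ) : Prop :=
  c (Encodable.encode (preL c p.length, p)) = true

def diagA : Set (ℕ → Bool) := {c | ∃ y : ℕ → ℕ, ∀ n, codeA c (preL y n)}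

theorem diagA_not_meas : ¬ MeasurableSet diagA := by
  intro hm
  have : PolishSpace Bool :=
    (Topology.IsClosedEmbedding.of_continuous_injective_isClosedMap
      (f := fun b : Bool => (Bool.toNat b)) continuous_of_discreteTopology
      (by intro a b; cases a <;> cases b <;> simp) (fun s _ => isClosed_discrete _)).polishSpace
  have ha := hm.compl.analyticSet
  rw [MeasureTheory.AnalyticSet] at ha
  rcases ha with h | ⟨f, hf, hr⟩
  · have : (fun _ => false) ∈ diagA := by
      by_contra h'
      have : (fun _ => false) ∈ diagAᶜ := h'
      rw [h] at this
      exact this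
    obtain ⟨y, hy⟩ := this
    simpa using hy 0
  · classical
    let c : ℕ → Bool := fun i => decide (∃ z n, i = Encodable.encode (preL (f z) n, preL z n))
    have key : ∀ x, x ∈ Set.range f ↔ ∃ y : ℕ → ℕ, ∀ n, c (Encodable.encode (preL x n, preL y n)) = true := by
      intro x
      constructor
      · rintro ⟨y, rfl⟩
        exact ⟨y, fun n => by simp only [c, decide_eq_true_eq]; exact ⟨y, n, rfl⟩⟩
      · rintro ⟨y, hy⟩
        have : ∀ n, ∃ z, preL x n = preL (f z) n ∧ preL y n = preL z n := by
          intro n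
          have := hy n
          simp only [c, decide_eq_true_eq] at this
          obtain ⟨z, m, hz⟩ := this
          have hz := Encodable.encode_injective hz
          simp only [Prod.mk.injEq] at hz
          have hnm : n = m := by simpa using congrArg List.length hz.1
          subst hnm
          exact ⟨z, hz⟩
        choose z hz1 hz2 using this
        refine ⟨y, ?_⟩
        have t1 : Filter.Tendsto z Filter.atTop (nhds y) := by
          rw [tendsto_pi_nhds]
          intro i
          refine tendsto_const_nhds.congr' ?_
          filter_upwards [Filter.eventually_gt_atTop i] with n hn
          exact preL_eq_of (hz2 n) hn
        have t2 : Filter.Tendsto (fun n => f (z n)) Filter.atTop (nhds x) := by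
          rw [tendsto_pi_nhds]
          intro i
          refine tendsto_const_nhds.congr' ?_
          filter_upwards [Filter.eventually_gt_atTop i] with n hn
          exact preL_eq_of (hz1 n) hn
        exact tendsto_nhds_unique ((hf.tendsto y).comp t1) t2
    have k := key c
    rw [hr] at k
    have : c ∈ diagA ↔ ∃ y : ℕ → ℕ, ∀ n, c (Encodable.encode (preL c n, preL y n)) = true := by
      simp [diagA, codeA]
    rw [← this] at k
    by_cases h : c ∈ diagA
    · exact k.2 h h
    · exact h (k.1 h)

def treeSA (c : ℕ → Bool) : Set (List ℕ) := {t | ∀ p, p <+: t → codeA c p}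

theorem treeSA_meas (t : List ℕ) : MeasurableSet {c | t ∈ treeSA c} := by
  have h0 : ∀ n (l : List Bool), MeasurableSet {c : ℕ → Bool | preL c n = l} := by
    intro n l
    have : {c : ℕ → Bool | preL c n = l} = ⋂ i : ℕ, {c : ℕ → Bool | (preL c n)[i]? = l[i]?} := by
      ext c; simp [List.ext_getElem?_iff]
    rw [this]
    refine MeasurableSet.iInter fun i => ?_
    by_cases hi : i < n
    · have : {c : ℕ → Bool | (preL c n)[i]? = l[i]?} = (fun c => c i) ⁻¹' {b | some b = l[i]?} := by
        ext c; simp [preL, hi]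
      rw [this]
      exact measurable_pi_apply i (MeasurableSet.of_discrete)
    · have : {c : ℕ → Bool | (preL c n)[i]? = l[i]?} = {c | none = l[i]?} := by
        ext c
        rw [Set.mem_ofPred_eq, Set.mem_ofPred_eq, List.getElem?_eq_none (by simpa using hi)]
      rw [this]
      exact MeasurableSet.const _
  have : {c | t ∈ treeSA c} = ⋂ p : List ℕ, ⋂ _ : p <+: t, ⋃ l : List Bool,
      ({c : ℕ → Bool | preL c p.length = l} ∩ {c | c (Encodable.encode (l, p)) = true}) := by
    ext c; simp [treeSA, codeA]
  rw [this]
  refine MeasurableSet.iInter fun p => MeasurableSet.iInter fun _ => MeasurableSet.iUnion fun l =>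
    (h0 _ _).inter ?_
  have hmm : Measurable (fun c : ℕ → Bool => c (Encodable.encode (l, p))) := measurable_pi_apply _
  exact hmm (MeasurableSet.of_discrete (s := {true}))

/-! ### Weak logics define Borel sets -/

theorem weak_meas {AP : Type} (D : SODom) (Q : Set Node → Prop)
    (hD : ∀ T S, S ∈ D T ↔ S ⊆ T ∧ Q S) (K : (ℕ → Bool) → KripkeTree AP)
    (hL : ∀ c v, (K c).Lab v = ∅) (hK : ∀ w, MeasurableSet {c | w ∈ (K c).T}) (φ : MSOL AP) :
    ∀ V1 V2, MeasurableSet {c | Sat (weakDom D) (K c) V1 V2 φ} := by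
  induction φ with
  | atom a x => intro V1 V2; simp [Sat, hL]
  | le x y =>
    intro V1 V2
    simp only [Sat]
    exact (hK _).inter ((hK _).inter (MeasurableSet.const _))
  | mem x X => intro V1 V2; simp only [Sat]; exact MeasurableSet.const _
  | not φ ih => intro V1 V2; simp only [Sat]; exact (ih V1 V2).compl
  | and φ ψ ih1 ih2 => intro V1 V2; simp only [Sat]; exact (ih1 V1 V2).inter (ih2 V1 V2)
  | exFO x φ ih =>
    intro V1 V2
    have : {c | Sat (weakDom D) (K c) V1 V2 (.exFO x φ)} =
        ⋃ τ : Node, ({c | τ ∈ (K c).T} ∩ {c | Sat (weakDom D) (K c) (Function.update V1 x τ) V2 φ}) := by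
      ext c; simp [sat_exFO]
    rw [this]
    exact MeasurableSet.iUnion fun τ => (hK τ).inter (ih _ _)
  | exSO X φ ih =>
    intro V1 V2
    have : {c | Sat (weakDom D) (K c) V1 V2 (.exSO X φ)} =
        ⋃ F : Finset Node, ((⋂ τ ∈ F, {c | τ ∈ (K c).T}) ∩ {_c | Q ↑F} ∩
          {c | Sat (weakDom D) (K c) V1 (Function.update V2 X ↑F) φ}) := by
      ext c
      simp only [sat_exSO, Set.mem_iUnion, Set.mem_inter_iff, Set.mem_iInter, Set.mem_ofPred_eq]
      constructor
      · rintro ⟨S, ⟨hS, hfin⟩, h⟩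
        rw [hD] at hS
        refine ⟨hfin.toFinset, ⟨?_, ?_⟩, ?_⟩
        · intro τ hτ; exact hS.1 (by simpa using hτ)
        · simpa using hS.2
        · simpa using h
      · rintro ⟨F, ⟨h1, h2⟩, h3⟩
        exact ⟨↑F, ⟨(hD _ _).2 ⟨fun τ hτ => h1 τ hτ, h2⟩, F.finite_toSet⟩, h3⟩
    rw [this]
    refine MeasurableSet.iUnion fun F => MeasurableSet.inter (MeasurableSet.inter ?_ (MeasurableSet.const _)) (ih _ _)
    exact Finset.measurableSet_biInter _ fun τ _ => hK τ

/-! ### The coding -/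

def encA : List ℕ → List ℕ
  | [] => []
  | n :: t => List.replicate n 0 ++ 1 :: encA t

theorem encA_append (s t : List ℕ) : encA (s ++ t) = encA s ++ encA t := by
  induction s with
  | nil => rfl
  | cons n s ih => simp [encA, ih]

theorem encA_lt (s : List ℕ) : ∀ a ∈ encA s, a < 2 := by
  induction s with
  | nil => simp [encA]
  | cons n s ih =>
    intro a ha
    simp only [encA, List.mem_append, List.mem_cons, List.mem_replicate] at ha
    rcases ha with h | h | h
    · omega
    · omega
    · exact ih a h

theorem repl_prefix (n m : ℕ) (a b : List ℕ)
    (h : List.replicate n 0 ++ 1 :: a <+: List.replicate m 0 ++ 1 :: b) : n = m ∧ a <+: b := by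
  induction n generalizing m with
  | zero =>
    cases m with
    | zero => simpa using h
    | succ m => simp [List.replicate_succ] at h
  | succ n ih =>
    cases m with
    | zero => simp [List.replicate_succ] at h
    | succ m =>
      simp only [List.replicate_succ, List.cons_append, List.cons_prefix_cons, true_and] at h
      obtain ⟨h1, h2⟩ := ih m h
      exact ⟨by omega, h2⟩

theorem encA_prefix (s t : List ℕ) (h : encA s <+: encA t) : s <+: t := by
  induction s generalizing t with
  | nil => simp
  | cons n s ih =>
    cases t with
    | nil => simp [encA] at h
    | cons m t =>
      obtain ⟨rfl, h2⟩ := repl_prefix _ _ _ _ h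
      exact List.cons_prefix_cons.2 ⟨rfl, ih t h2⟩

def TA (S : Set (List ℕ)) : Set Node :=
  {w | ∀ a ∈ w, a < 2} ∪ {w | ∃ t ∈ S, ∃ k, w = encA t ++ 2 :: List.replicate k 0}

theorem TA_rooted (S : Set (List ℕ)) : IsTreeRooted (TA S) [] := by
  rw [isTreeRooted_iff]
  refine ⟨Or.inl (by simp), fun _ _ => List.nil_prefix, ?_⟩
  rintro τ (h | ⟨t, ht, k, rfl⟩) σ - h2
  · exact Or.inl fun a ha => h a (h2.subset ha)
  · rcases List.prefix_or_prefix_of_prefix h2 (List.prefix_append _ _) with h | ⟨s, rfl⟩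
    · exact Or.inl fun a ha => encA_lt t a (h.subset ha)
    · rw [List.prefix_append_right_inj, List.prefix_cons_iff] at h2
      rcases h2 with rfl | ⟨s', rfl, h3⟩
      · left; simpa using encA_lt t
      · right
        rw [List.prefix_replicate_iff] at h3
        exact ⟨t, ht, s'.length, by rw [← h3.2]⟩

theorem TA_child0 (S : Set (List ℕ)) (τ : Node) (h : τ ∈ TA S) : τ ++ [0] ∈ TA S := by
  rcases h with h | ⟨t, ht, k, rfl⟩
  · left; intro a ha
    simp only [List.mem_append, List.mem_singleton] at ha
    rcases ha with h' | h'
    · exact h a h'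
    · omega
  · right; exact ⟨t, ht, k+1, by simp [List.replicate_succ']⟩

theorem TA_child (S : Set (List ℕ)) (τ : Node) (n : ℕ) (hn : 2 ≤ n) (h : τ ++ [n] ∈ TA S) :
    n = 2 ∧ ∃ t ∈ S, τ = encA t := by
  rcases h with h | ⟨t, ht, k, hk⟩
  · have := h n (by simp); omega
  · cases k with
    | zero =>
      simp only [List.replicate_zero] at hk
      have := List.append_inj' hk rfl
      simp at this
      exact ⟨this.2, t, ht, this.1⟩
    | succ k =>
      rw [List.replicate_succ', ← List.cons_append, ← List.append_assoc] at hk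
      have := List.append_inj' hk rfl
      simp at this; omega

def KA (AP : Type) (S : Set (List ℕ)) : KripkeTree AP where
  T := TA S
  root := []
  rooted := TA_rooted S
  nonblocking := fun τ h => ⟨0, TA_child0 S τ h⟩
  Lab := fun _ => ∅

theorem KA_fin (AP : Type) (S : Set (List ℕ)) : KA AP S ∈ finBrKT AP := by
  intro τ hτ
  refine Set.Finite.subset ((Set.finite_Iio 3).image (fun n => τ ++ [n])) ?_
  rintro _ ⟨h, n, rfl⟩
  refine ⟨n, ?_, rfl⟩
  by_cases hn : 2 ≤ n
  · have := (TA_child S τ n hn h).1; simp; omega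
  · simp; omega

theorem KA_meas (AP : Type) (w : Node) : MeasurableSet {c | w ∈ (KA AP (treeSA c)).T} := by
  have : {c | w ∈ (KA AP (treeSA c)).T} = {_c | ∀ a ∈ w, a < 2} ∪
      ⋃ t, ({c | t ∈ treeSA c} ∩ {_c | ∃ k, w = encA t ++ 2 :: List.replicate k 0}) := by
    ext c; simp [KA, TA]
  rw [this]
  exact (MeasurableSet.const _).union (MeasurableSet.iUnion fun t =>
    (treeSA_meas t).inter (MeasurableSet.const _))

/-- the separating sentence -/
def psiA (AP : Type) : MSOL AP :=
  .exSO 0 (.and (.exFO 0 (.mem 0 0)) (.all1 0 (.imp (.mem 0 0) (.exFO 1 (.and (.mem 1 0) (.and (.lt 0 1)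
    (.exFO 2 (.exFO 3 (.exFO 4 (.and (chF 1 2 5) (.and (chF 1 3 5) (.and (chF 1 4 5)
      (.and (.not (.le 2 3)) (.and (.not (.le 2 4)) (.not (.le 3 4)))))))))))))))) 

theorem psiA_sentence (AP : Type) : (psiA AP).IsSentence := by
  constructor
  · ext z; simp [psiA, MSOL.freeFO, MSOL.all1, MSOL.imp, MSOL.lt, chF]; omega
  · ext z; simp [psiA, MSOL.freeSO, MSOL.all1, MSOL.imp, MSOL.lt, chF]

theorem sat_psiA (AP : Type) (D : SODom) (K : KripkeTree AP) (hD : ∀ S ∈ D K.T, S ⊆ K.T) (V1 V2) :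
    Sat D K V1 V2 (psiA AP) ↔ ∃ X ∈ D K.T, X.Nonempty ∧ ∀ x ∈ X, ∃ y ∈ X, x <+: y ∧ x ≠ y ∧
      ∃ a b c, y ++ [a] ∈ K.T ∧ y ++ [b] ∈ K.T ∧ y ++ [c] ∈ K.T ∧ a ≠ b ∧ a ≠ c ∧ b ≠ c := by
  simp only [psiA, sat_exFO, sat_exSO, sat_and, sat_not, sat_all1, sat_imp, sat_mem, sat_le, sat_lt]
  refine exists_congr fun X => and_congr_right fun hX => ?_
  have hX := hD X hX
  refine and_congr ?_ ?_
  · simp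
    exact ⟨fun ⟨x, _, h⟩ => ⟨x, h⟩, fun ⟨x, h⟩ => ⟨x, hX h, h⟩⟩
  · constructor
    · intro h x hx
      obtain ⟨y, hyT, hy, hxy, z1, h1, z2, h2, z3, h3, h4, h5, h6, h7, h8, h9⟩ := h x (hX hx) (by simpa using hx)
      rw [sat_chF _ _ _ _ _ _ _ (by decide) (by decide)] at h4 h5 h6
      simp at hy hxy h4 h5 h6 h7 h8 h9
      obtain ⟨_, _, a, rfl⟩ := h4
      obtain ⟨_, _, b, rfl⟩ := h5
      obtain ⟨_, _, c, rfl⟩ := h6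
      refine ⟨y, hy, hxy.2.2.1, hxy.2.2.2, a, b, c, h1, h2, h3, ?_, ?_, ?_⟩
      · rintro rfl; exact h7 h1 h2 List.prefix_rfl
      · rintro rfl; exact h8 h1 h3 List.prefix_rfl
      · rintro rfl; exact h9 h2 h3 List.prefix_rfl
    · intro h x hxT hx
      have hx : x ∈ X := by simpa using hx
      obtain ⟨y, hy, hxy, hne, a, b, c, h1, h2, h3, h4, h5, h6⟩ := h x hx
      refine ⟨y, hX hy, by simpa using hy, by simp [hX hy, hxT, hxy, hne],
        _, h1, _, h2, _, h3, ?_, ?_, ?_, ?_⟩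
      · rw [sat_chF _ _ _ _ _ _ _ (by decide) (by decide)]; simp [h1, hX hy]
      · rw [sat_chF _ _ _ _ _ _ _ (by decide) (by decide)]; simp [h2, hX hy]
      · rw [sat_chF _ _ _ _ _ _ _ (by decide) (by decide)]; simp [h3, hX hy]
      · simp [h4, h5, h6]

theorem psiA_diag (AP : Type) (D : SODom) (hD : ∀ T, ∀ S ∈ D T, S ⊆ T)
    (hD' : ∀ T S, S ⊆ T → IsTree S → S ∈ D T) (c : ℕ → Bool) (V1 V2) :
    Sat D (KA AP (treeSA c)) V1 V2 (psiA AP) ↔ c ∈ diagA := by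
  rw [sat_psiA _ _ _ (hD _)]
  constructor
  · rintro ⟨X, -, ⟨x0, hx0⟩, h⟩
    have h' : ∀ x : X, ∃ y : X, x.1 <+: y.1 ∧ x.1 ≠ y.1 ∧ ∃ t ∈ treeSA c, y.1 = encA t := by
      rintro ⟨x, hx⟩
      obtain ⟨y, hy, hxy, hne, a, b, d, h1, h2, h3, h4, h5, h6⟩ := h x hx
      refine ⟨⟨y, hy⟩, hxy, hne, ?_⟩
      by_cases ha : 2 ≤ a
      · exact (TA_child _ _ _ ha h1).2
      by_cases hb : 2 ≤ b
      · exact (TA_child _ _ _ hb h2).2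
      exact (TA_child _ _ d (by omega) h3).2
    choose nx hn1 hn2 u hu1 hu2 using h'
    let xs : ℕ → X := fun n => nx^[n] ⟨x0, hx0⟩
    have hxs : ∀ n, xs (n+1) = nx (xs n) := fun n => Function.iterate_succ_apply' _ _ _
    let t : ℕ → List ℕ := fun n => u (xs n)
    have e : ∀ n, (xs (n+1)).1 = encA (t n) := fun n => by rw [hxs]; exact hu2 _
    have hst : ∀ n, t n <+: t (n+1) ∧ t n ≠ t (n+1) := by
      intro n
      refine ⟨encA_prefix _ _ ?_, fun hh => ?_⟩
      · rw [← e, ← e, hxs (n+1)]; exact hn1 _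
      · have := hn2 (xs (n+1))
        rw [← hxs, e, e, hh] at this
        exact this rfl
    have hle : ∀ n m, n ≤ m → t n <+: t m := by
      intro n m hnm
      induction m, hnm using Nat.le_induction with
      | base => exact List.prefix_rfl
      | succ m _ ih => exact ih.trans (hst m).1
    have hlen : ∀ n, n ≤ (t n).length := by
      intro n
      induction n with
      | zero => omega
      | succ n ih =>
        by_contra hcon
        exact (hst n).2 ((hst n).1.eq_of_length_le (by omega))
    refine ⟨fun i => (t (i+1)).getD i 0, fun n => ?_⟩
    refine hu1 (xs n) _ ?_
    change _ <+: t n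
    rw [List.prefix_iff_getElem?]
    intro i hi
    rw [preL_length] at hi
    have h1 : i < (t (i+1)).length := hlen (i+1)
    have h2 := (hle (i+1) n hi).getElem h1
    rw [List.getElem?_eq_getElem (lt_of_lt_of_le hi (hlen n)), ← h2]
    simp [preL, h1]
  · rintro ⟨y, hy⟩
    have hS : ∀ n, preL y n ∈ treeSA c := fun n p hp => by rw [preL_prefix hp]; exact hy _
    have hsub : {w | ∃ n, w <+: encA (preL y n)} ⊆ (KA AP (treeSA c)).T := by
      rintro w ⟨n, hw⟩
      exact Or.inl fun a ha => encA_lt _ a (hw.subset ha)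
    refine ⟨{w | ∃ n, w <+: encA (preL y n)}, hD' _ _ hsub ⟨[], ?_⟩, ⟨[], 0, List.nil_prefix⟩, ?_⟩
    · rw [isTreeRooted_iff]
      refine ⟨⟨0, List.nil_prefix⟩, fun _ _ => List.nil_prefix, ?_⟩
      rintro τ ⟨n, hn⟩ σ - h2
      exact ⟨n, h2.trans hn⟩
    · rintro x ⟨n, hn⟩
      have e : encA (preL y (n+1)) = encA (preL y n) ++ encA [y n] := by
        rw [← preL_mono, encA_append]
      have hp : encA (preL y n) <+: encA (preL y (n+1)) := by rw [e]; exact List.prefix_append _ _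
      refine ⟨encA (preL y (n+1)), ⟨n+1, List.prefix_rfl⟩, hn.trans hp, ?_, 0, 1, 2, ?_, ?_, ?_,
        by decide, by decide, by decide⟩
      · intro hh
        have h1 := hn.length_le
        rw [hh, e] at h1
        simp [encA] at h1
      · exact TA_child0 _ _ (hsub ⟨n+1, List.prefix_rfl⟩)
      · left; intro a ha
        simp only [List.mem_append, List.mem_singleton] at ha
        rcases ha with h' | h'
        · exact encA_lt _ a h'
        · omega
      · right; exact ⟨_, hS (n+1), 0, by simp⟩

theorem partA_main (AP : Type) (D E : SODom) (Q : Set Node → Prop)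
    (hD : ∀ T, ∀ S ∈ D T, S ⊆ T) (hD' : ∀ T S, S ⊆ T → IsTree S → S ∈ D T)
    (hE : ∀ T S, S ∈ E T ↔ S ⊆ T ∧ Q S) :
    ¬ MLogic.Leq (finBrKT AP) ⟨fun _ => True, D⟩ ⟨fun _ => True, weakDom E⟩ := by
  intro h
  obtain ⟨φ, h1, -, h2⟩ := h (psiA AP) (psiA_sentence AP) trivial
  apply diagA_not_meas
  have := weak_meas E Q hE (fun c => KA AP (treeSA c)) (fun _ _ => rfl) (KA_meas AP) φ
    (fun _ => []) (fun _ => ∅)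
  convert this using 1
  ext c
  rw [← psiA_diag AP D hD hD' c (fun _ => []) (fun _ => ∅)]
  have h3 := h2 _ (KA_fin AP (treeSA c))
  rw [ksat_iff _ _ _ (psiA_sentence AP) (fun _ => []) (fun _ => ∅),
    ksat_iff _ _ _ h1 (fun _ => []) (fun _ => ∅)] at h3
  exact h3

end partA
/-! ## MTL does not count along chains -/

section partD

def zD (n : ℕ) : Node := List.replicate n 0

theorem zD_prefix {a b : ℕ} : zD a <+: zD b ↔ a ≤ b := by
  constructor
  · intro h; simpa [zD] using h.length_le
  · intro h; obtain ⟨c, rfl⟩ := Nat.exists_eq_add_of_le h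
    exact ⟨zD c, by simp [zD]⟩

theorem zD_inj {a b : ℕ} : zD a = zD b ↔ a = b :=
  ⟨fun h => by simpa [zD] using congrArg List.length h, fun h => by rw [h]⟩

theorem prefix_zD {τ : Node} {b : ℕ} (h : τ <+: zD b) : ∃ i ≤ b, τ = zD i := by
  rw [zD, List.prefix_replicate_iff] at h
  exact ⟨_, h⟩

def UD (m : ℕ) : Set Node := {τ | zD m <+: τ ∧ τ ≠ zD m ∧ ∀ a ∈ τ, a < 2}

theorem zD_not_UD {m j : ℕ} (h : j ≤ m) : zD j ∉ UD m := by
  rintro ⟨h1, h2, _⟩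
  rw [zD_prefix] at h1
  exact h2 (by rw [le_antisymm h h1])

theorem UD_up {m : ℕ} {τ σ : Node} (h : τ ∈ UD m) (h1 : zD m <+: σ) (h2 : σ <+: τ) :
    σ = zD m ∨ σ ∈ UD m := by
  by_cases h3 : σ = zD m
  · exact Or.inl h3
  · exact Or.inr ⟨h1, h3, fun a ha => h.2.2 a (h2.subset ha)⟩

def TD (m r : ℕ) : Set Node := {τ | (∃ j, r ≤ j ∧ j ≤ m ∧ τ = zD j) ∨ τ ∈ UD m}

theorem TD_lt {m r : ℕ} {τ : Node} (h : τ ∈ TD m r) : ∀ a ∈ τ, a < 2 := by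
  rcases h with ⟨j, _, _, rfl⟩ | h
  · intro a ha; simp [zD] at ha; omega
  · exact h.2.2

theorem TD_child (m r : ℕ) (τ : Node) (h : zD m <+: τ) (h' : τ ∈ TD m r) (n : ℕ) (hn : n < 2) :
    τ ++ [n] ∈ UD m := by
  refine ⟨h.trans (List.prefix_append _ _), ?_, ?_⟩
  · intro h2
    have := h.length_le
    have := congrArg List.length h2
    simp at this; omega
  · intro a ha
    simp only [List.mem_append, List.mem_singleton] at ha
    rcases ha with h' | h'
    · exact TD_lt ‹_› a h'
    · omega

def KD (AP : Type) (m r : ℕ) (hr : r ≤ m) : KripkeTree AP where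
  T := TD m r
  root := zD r
  rooted := by
    rw [isTreeRooted_iff]
    refine ⟨Or.inl ⟨r, le_rfl, hr, rfl⟩, ?_, ?_⟩
    · rintro τ (⟨j, h1, h2, rfl⟩ | h)
      · exact zD_prefix.2 h1
      · exact (zD_prefix.2 hr).trans h.1
    · rintro τ (⟨j, h1, h2, rfl⟩ | h) σ h3 h4
      · obtain ⟨i, hi, rfl⟩ := prefix_zD h4
        exact Or.inl ⟨i, zD_prefix.1 h3, hi.trans h2, rfl⟩
      · rcases List.prefix_or_prefix_of_prefix h4 h.1 with h5 | h5
        · obtain ⟨i, hi, rfl⟩ := prefix_zD h5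
          exact Or.inl ⟨i, zD_prefix.1 h3, hi, rfl⟩
        · rcases UD_up h h5 h4 with rfl | h6
          · exact Or.inl ⟨m, hr, le_rfl, rfl⟩
          · exact Or.inr h6
  nonblocking := by
    rintro τ h
    refine ⟨0, ?_⟩
    by_cases hm : zD m <+: τ
    · exact Or.inr (TD_child m r τ hm h 0 (by omega))
    · rcases h with ⟨j, h1, h2, rfl⟩ | h
      · rw [zD_prefix] at hm
        exact Or.inl ⟨j+1, by omega, by omega, by simp [zD, List.replicate_succ']⟩
      · exact absurd h.1 hm
  Lab := fun _ => ∅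

theorem KD_fin (AP : Type) (m r : ℕ) (hr : r ≤ m) : KD AP m r hr ∈ finBrKT AP := by
  intro τ hτ
  refine Set.Finite.subset ((Set.finite_Iio 2).image (fun n => τ ++ [n])) ?_
  rintro _ ⟨h, n, rfl⟩
  exact ⟨n, TD_lt h n (by simp), rfl⟩

def closeD (k : ℕ) (P : Set (ℕ × ℕ)) : Prop :=
  ∀ p ∈ P, ∀ q ∈ P, min (q.1 - p.1) (2^k) = min (q.2 - p.2) (2^k)

theorem closeD_swap {k : ℕ} {P : Set (ℕ × ℕ)} (h : closeD k P) : closeD k (Prod.swap ⁻¹' P) :=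
  fun _ hp _ hq => (h _ hp _ hq).symm

theorem closeD_le {k : ℕ} {P : Set (ℕ × ℕ)} (h : closeD k P) {a a' b b' : ℕ} (ha : (a, a') ∈ P)
    (hb : (b, b') ∈ P) : a ≤ b ↔ a' ≤ b' := by
  have h1 := h _ hb _ ha
  have h2 : 0 < 2^k := by positivity
  simp only at h1
  omega

theorem minD_cases {x y A : ℕ} (h : min x A = min y A) : x = y ∨ (A ≤ x ∧ A ≤ y) := by omega

theorem closeD_ext {k : ℕ} {P : Set (ℕ × ℕ)} (h : closeD (k+1) P) {r r' q : ℕ} (hr : (r, r') ∈ P)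
    (hq : r ≤ q) : ∃ q', closeD k (insert (q, q') P) := by
  have h2 : 0 < 2^k := by positivity
  simp only [closeD, pow_succ] at h ⊢
  generalize 2^k = A at *
  have red : ∀ q', (∀ b b', (b, b') ∈ P → min (b - q) A = min (b' - q') A ∧
      min (q - b) A = min (q' - b') A) → ∃ q', ∀ p ∈ insert (q, q') P, ∀ s ∈ insert (q, q') P,
        min (s.1 - p.1) A = min (s.2 - p.2) A := by
    intro q' hq'
    refine ⟨q', ?_⟩
    rintro p (rfl | hp) s (rfl | hs)
    · simp
    · exact (hq' s.1 s.2 hs).1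
    · exact (hq' p.1 p.2 hp).2
    · have := h p hp s hs; omega
  by_cases hc : ∃ a a', (a, a') ∈ P ∧ q - a < A ∧ a - q < A
  · obtain ⟨a, a', ha, h3, h4⟩ := hc
    refine red (a' + q - a) fun b b' hb => ?_
    have e1 := h _ ha _ hb
    have e2 := h _ hb _ ha
    have e3 := h _ hr _ ha
    simp only at e1 e2 e3
    clear hr ha hb red h
    have e1 := minD_cases e1
    have e2 := minD_cases e2
    have hx : q ≤ a' + q := Nat.le_add_left _ _
    have e3 : a ≤ a' + q := by
      rcases minD_cases e3 with e | e <;> omega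
    clear * - h2 h3 h4 e1 e2 e3
    obtain ⟨s, hs⟩ : ∃ s, s = a' + q - a := ⟨_, rfl⟩
    have hs' : s + a = a' + q := by omega
    rw [← hs]
    clear hs e3
    refine ⟨?_, ?_⟩
    · rcases e1 with e1 | e1 <;> rcases e2 with e2 | e2 <;> rcases le_total b q with h5 | h5 <;>
        rcases le_total b' s with h6 | h6 <;> omega
    · rcases e1 with e1 | e1 <;> rcases e2 with e2 | e2 <;> rcases le_total b q with h5 | h5 <;>
        rcases le_total b' s with h6 | h6 <;> omega
  · push Not at hc
    have hne : {a | a ≤ q ∧ ∃ a', (a, a') ∈ P}.Nonempty := ⟨r, hq, r', hr⟩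
    have hbd : BddAbove {a | a ≤ q ∧ ∃ a', (a, a') ∈ P} := ⟨q, fun a ha => ha.1⟩
    obtain ⟨h3, a', ha⟩ := Nat.sSup_mem hne hbd
    have hmax : ∀ b b', (b, b') ∈ P → b ≤ q → b ≤ sSup {a | a ≤ q ∧ ∃ a', (a, a') ∈ P} :=
      fun b b' hb hbq => le_csSup hbd ⟨hbq, b', hb⟩
    generalize sSup {a | a ≤ q ∧ ∃ a', (a, a') ∈ P} = a at *
    refine red (a' + A) fun b b' hb => ?_
    have e1 := h _ ha _ hb
    have e2 := h _ hb _ ha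
    have c1 := hc a a' ha
    have c2 := hc b b' hb
    have c3 := hmax b b' hb
    simp only at e1 e2
    have e1 := minD_cases e1
    have e2 := minD_cases e2
    clear * - h2 h3 c1 c2 c3 e1 e2
    have c1 : a + A ≤ q := by omega
    rcases le_total b q with h5 | h5
    · have c3 := c3 h5
      have c2 : b + A ≤ q := by omega
      have : b' ≤ a' := by omega
      refine ⟨?_, ?_⟩ <;> omega
    · have c2 : q + A ≤ b := by omega
      have : a' + A * 2 ≤ b' := by omega
      refine ⟨?_, ?_⟩ <;> omega

def segD (a b : ℕ) (W : Set Node) : Set Node := {τ | ∃ j, a ≤ j ∧ j ≤ b ∧ τ = zD j} ∪ W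

structure StD (m r r' k : ℕ) (P : Set (ℕ × ℕ)) (V1 V1' : ℕ → Node) (V2 V2' : ℕ → Set Node) :
    Prop where
  close : closeD k P
  hr : (r, r') ∈ P
  hm : (m, m) ∈ P
  hb : ∀ p ∈ P, r ≤ p.1 ∧ p.1 ≤ m ∧ r' ≤ p.2 ∧ p.2 ≤ m
  fo : ∀ x, (∃ a a', (a, a') ∈ P ∧ V1 x = zD a ∧ V1' x = zD a') ∨ (V1 x = V1' x ∧ V1 x ∈ UD m)
  so : ∀ X, ∃ a a' b b' W, (a, a') ∈ P ∧ (b, b') ∈ P ∧ W ⊆ UD m ∧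
    V2 X = segD a b W ∧ V2' X = segD a' b' W

theorem StD.symm {m r r' k : ℕ} {P : Set (ℕ × ℕ)} {V1 V1' : ℕ → Node} {V2 V2' : ℕ → Set Node}
    (h : StD m r r' k P V1 V1' V2 V2') : StD m r' r k (Prod.swap ⁻¹' P) V1' V1 V2' V2 where
  close := closeD_swap h.close
  hr := h.hr
  hm := h.hm
  hb := fun p hp => by
    have := h.hb _ hp
    simp at this; omega
  fo := fun x => by
    rcases h.fo x with ⟨a, a', h1, h2, h3⟩ | ⟨h1, h2⟩
    · exact Or.inl ⟨a', a, h1, h3, h2⟩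
    · exact Or.inr ⟨h1.symm, h1 ▸ h2⟩
  so := fun X => by
    obtain ⟨a, a', b, b', W, h1, h2, h3, h4, h5⟩ := h.so X
    exact ⟨a', a, b', b, W, h1, h2, h3, h5, h4⟩

theorem StD.grow {m r r' k k' : ℕ} {P P' : Set (ℕ × ℕ)} {V1 V1' : ℕ → Node} {V2 V2' : ℕ → Set Node}
    (h : StD m r r' k P V1 V1' V2 V2') (hP : P ⊆ P') (hc : closeD k' P')
    (hb : ∀ p ∈ P', r ≤ p.1 ∧ p.1 ≤ m ∧ r' ≤ p.2 ∧ p.2 ≤ m) : StD m r r' k' P' V1 V1' V2 V2' where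
  close := hc
  hr := hP h.hr
  hm := hP h.hm
  hb := hb
  fo := fun x => by
    rcases h.fo x with ⟨a, a', h1, h2, h3⟩ | ⟨h1, h2⟩
    · exact Or.inl ⟨a, a', hP h1, h2, h3⟩
    · exact Or.inr ⟨h1, h2⟩
  so := fun X => by
    obtain ⟨a, a', b, b', W, h1, h2, h3, h4, h5⟩ := h.so X
    exact ⟨a, a', b, b', W, hP h1, hP h2, h3, h4, h5⟩

theorem closeD_mono {k : ℕ} {P : Set (ℕ × ℕ)} (h : closeD (k+1) P) : closeD k P := by
  intro p hp q hq
  have := h p hp q hq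
  rw [pow_succ] at this
  omega

theorem StD.point {m r r' k : ℕ} {P : Set (ℕ × ℕ)} {V1 V1' : ℕ → Node} {V2 V2' : ℕ → Set Node}
    (h : StD m r r' (k+1) P V1 V1' V2 V2') {q : ℕ} (h1 : r ≤ q) (h2 : q ≤ m) :
    ∃ q' P', (q, q') ∈ P' ∧ P ⊆ P' ∧ StD m r r' k P' V1 V1' V2 V2' := by
  obtain ⟨q', hq'⟩ := closeD_ext h.close h.hr h1
  refine ⟨q', insert (q, q') P, Set.mem_insert _ _, Set.subset_insert _ _,
    h.grow (Set.subset_insert _ _) hq' ?_⟩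
  rintro p (rfl | hp)
  · refine ⟨h1, h2, ?_, ?_⟩
    · exact (closeD_le hq' (Set.mem_insert_of_mem _ h.hr) (Set.mem_insert _ _)).1 h1
    · exact (closeD_le hq' (Set.mem_insert _ _) (Set.mem_insert_of_mem _ h.hm)).1 h2
  · exact h.hb p hp

theorem StD.setFO {m r r' k : ℕ} {P : Set (ℕ × ℕ)} {V1 V1' : ℕ → Node} {V2 V2' : ℕ → Set Node}
    (h : StD m r r' k P V1 V1' V2 V2') (x : ℕ) (v v' : Node)
    (hv : (∃ a a', (a, a') ∈ P ∧ v = zD a ∧ v' = zD a') ∨ (v = v' ∧ v ∈ UD m)) :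
    StD m r r' k P (Function.update V1 x v) (Function.update V1' x v') V2 V2' :=
  { h with
    fo := fun y => by
      by_cases hy : y = x
      · subst hy; simpa using hv
      · simpa [Function.update_of_ne hy] using h.fo y }

theorem StD.setSO {m r r' k : ℕ} {P : Set (ℕ × ℕ)} {V1 V1' : ℕ → Node} {V2 V2' : ℕ → Set Node}
    (h : StD m r r' k P V1 V1' V2 V2') (x : ℕ) (S S' : Set Node)
    (hv : ∃ a a' b b' W, (a, a') ∈ P ∧ (b, b') ∈ P ∧ W ⊆ UD m ∧
      S = segD a b W ∧ S' = segD a' b' W) :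
    StD m r r' k P V1 V1' (Function.update V2 x S) (Function.update V2' x S') :=
  { h with
    so := fun y => by
      by_cases hy : y = x
      · subst hy; simpa using hv
      · simpa [Function.update_of_ne hy] using h.so y }

theorem StD.forthFO {m r r' k : ℕ} {P : Set (ℕ × ℕ)} {V1 V1' : ℕ → Node} {V2 V2' : ℕ → Set Node}
    (h : StD m r r' (k+1) P V1 V1' V2 V2') (x : ℕ) (v : Node) (hv : v ∈ TD m r) :
    ∃ v' ∈ TD m r', ∃ P', StD m r r' k P' (Function.update V1 x v) (Function.update V1' x v') V2 V2' := by
  rcases hv with ⟨j, h1, h2, rfl⟩ | hv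
  · obtain ⟨q, P', hq, -, hP'⟩ := h.point h1 h2
    have := hP'.hb _ hq
    exact ⟨zD q, Or.inl ⟨q, this.2.2.1, this.2.2.2, rfl⟩, P',
      hP'.setFO x _ _ (Or.inl ⟨j, q, hq, rfl, rfl⟩)⟩
  · exact ⟨v, Or.inr hv, P, (h.grow subset_rfl (closeD_mono h.close) h.hb).setFO x _ _
      (Or.inr ⟨rfl, hv⟩)⟩

theorem StD.forthSO {m r r' k : ℕ} {P : Set (ℕ × ℕ)} {V1 V1' : ℕ → Node} {V2 V2' : ℕ → Set Node}
    (h : StD m r r' (k+1+1) P V1 V1' V2 V2') (hrm : r < m) (hrm' : r' < m) (x : ℕ) (S : Set Node)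
    (hS : S ∈ MTLdom (TD m r)) :
    ∃ S' ∈ MTLdom (TD m r'), ∃ P',
      StD m r r' k P' V1 V1' (Function.update V2 x S) (Function.update V2' x S') := by
  obtain ⟨hST, ρ, hρ⟩ := hS
  have ht := (isTreeRooted_iff _ _).1 hρ
  rcases hST ht.1 with ⟨a, ha1, ha2, rfl⟩ | hU
  · have hne : {j | j ≤ m ∧ zD j ∈ S}.Nonempty := ⟨a, ha2, ht.1⟩
    have hbd : BddAbove {j | j ≤ m ∧ zD j ∈ S} := ⟨m, fun a ha => ha.1⟩
    obtain ⟨hbm, hbS⟩ := Nat.sSup_mem hne hbd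
    have hmax : ∀ j, j ≤ m → zD j ∈ S → j ≤ sSup {j | j ≤ m ∧ zD j ∈ S} :=
      fun j h1 h2 => le_csSup hbd ⟨h1, h2⟩
    generalize sSup {j | j ≤ m ∧ zD j ∈ S} = b at *
    have hab : a ≤ b := hmax a ha2 ht.1
    obtain ⟨a', P1, hP1, -, st1⟩ := h.point ha1 ha2
    obtain ⟨b', P2, hP2, hsub, st2⟩ := st1.point (ha1.trans hab) hbm
    have hab' := (closeD_le st2.close (hsub hP1) hP2).1 hab
    have hba := st2.hb _ (hsub hP1)
    have hbb := st2.hb _ hP2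
    simp only at hba hbb
    have hmS : ∀ τ ∈ S, τ ∈ UD m → b = m := by
      intro τ h1 h2
      exact le_antisymm hbm (hmax m le_rfl (ht.2.2 τ h1 _ (zD_prefix.2 ha2) h2.1))
    refine ⟨segD a' b' (S ∩ UD m), ⟨?_, zD a', ?_⟩, P2, st2.setSO x _ _
      ⟨a, a', b, b', S ∩ UD m, hsub hP1, hP2, Set.inter_subset_right, ?_, rfl⟩⟩
    · rintro τ (⟨j, h1, h2, rfl⟩ | ⟨_, h2⟩)
      · exact Or.inl ⟨j, by omega, by omega, rfl⟩
      · exact Or.inr h2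
    · rw [isTreeRooted_iff]
      refine ⟨Or.inl ⟨a', le_rfl, hab', rfl⟩, ?_, ?_⟩
      · rintro τ (⟨j, h1, h2, rfl⟩ | ⟨_, h2⟩)
        · exact zD_prefix.2 h1
        · exact (zD_prefix.2 hba.2.2.2).trans h2.1
      · rintro τ (⟨j, h1, h2, rfl⟩ | ⟨h1, h2⟩) σ h3 h4
        · obtain ⟨i, hi, rfl⟩ := prefix_zD h4
          exact Or.inl ⟨i, zD_prefix.1 h3, hi.trans h2, rfl⟩
        · have hb' : b' = m := by
            have e1 := hmS τ h1 h2
            have := (closeD_le st2.close st2.hm hP2).1 e1.ge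
            omega
          rcases List.prefix_or_prefix_of_prefix h4 h2.1 with h5 | h5
          · obtain ⟨i, hi, rfl⟩ := prefix_zD h5
            exact Or.inl ⟨i, zD_prefix.1 h3, by omega, rfl⟩
          · rcases UD_up h2 h5 h4 with rfl | h6
            · exact Or.inl ⟨m, by omega, by omega, rfl⟩
            · exact Or.inr ⟨ht.2.2 τ h1 σ ((zD_prefix.2 ha2).trans h5) h4, h6⟩
    · ext τ
      constructor
      · intro hτ
        rcases hST hτ with ⟨j, h1, h2, rfl⟩ | hu
        · exact Or.inl ⟨j, zD_prefix.1 (ht.2.1 _ hτ), hmax j h2 hτ, rfl⟩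
        · exact Or.inr ⟨hτ, hu⟩
      · rintro (⟨j, h1, h2, rfl⟩ | ⟨h1, h2⟩)
        · exact ht.2.2 _ hbS _ (zD_prefix.2 h1) (zD_prefix.2 h2)
        · exact h1
  · have hSU : S ⊆ UD m := by
      intro τ hτ
      refine ⟨hU.1.trans (ht.2.1 τ hτ), ?_, TD_lt (hST hτ)⟩
      rintro rfl
      exact hU.2.1 ((ht.2.1 _ hτ).eq_of_length_le hU.1.length_le)
    have e : ∀ c, c < m → S = segD m c S := by
      intro c hc
      ext τ
      constructor
      · exact fun h => Or.inr h
      · rintro (⟨j, h1, h2, rfl⟩ | h)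
        · omega
        · exact h
    refine ⟨S, ⟨fun τ hτ => Or.inr (hSU hτ), ρ, hρ⟩, P,
      (h.grow subset_rfl (closeD_mono (closeD_mono h.close)) h.hb).setSO x _ _
      ⟨m, m, r, r', S, h.hm, h.hr, hSU, e r hrm, e r' hrm'⟩⟩

def rkD {AP : Type} : MSOL AP → ℕ
  | .atom _ _ => 0
  | .le _ _ => 0
  | .mem _ _ => 0
  | .not φ => rkD φ
  | .and φ ψ => max (rkD φ) (rkD ψ)
  | .exFO _ φ => rkD φ + 1
  | .exSO _ φ => rkD φ + 2

theorem StD.le_imp {m r r' k : ℕ} {P : Set (ℕ × ℕ)} {V1 V1' : ℕ → Node} {V2 V2' : ℕ → Set Node}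
    (h : StD m r r' k P V1 V1' V2 V2') (x y : ℕ) (hxy : V1 x <+: V1 y) :
    V1' x ∈ TD m r' ∧ V1' y ∈ TD m r' ∧ V1' x <+: V1' y := by
  rcases h.fo x with ⟨a, a', ha, e1, e2⟩ | ⟨e1, e2⟩ <;> rcases h.fo y with ⟨b, b', hb, e3, e4⟩ | ⟨e3, e4⟩
  · have ba := h.hb _ ha
    have bb := h.hb _ hb
    rw [e1, e3, zD_prefix, closeD_le h.close ha hb] at hxy
    rw [e2, e4]
    exact ⟨Or.inl ⟨a', ba.2.2.1, ba.2.2.2, rfl⟩, Or.inl ⟨b', bb.2.2.1, bb.2.2.2, rfl⟩, zD_prefix.2 hxy⟩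
  · have ba := h.hb _ ha
    rw [e2, ← e3]
    exact ⟨Or.inl ⟨a', ba.2.2.1, ba.2.2.2, rfl⟩, Or.inr e4, (zD_prefix.2 ba.2.2.2).trans e4.1⟩
  · have bb := h.hb _ hb
    rw [e3] at hxy
    have := zD_prefix.1 (e2.1.trans hxy)
    have hm : b = m := le_antisymm bb.2.1 this
    subst hm
    exact absurd (hxy.eq_of_length_le e2.1.length_le) e2.2.1
  · rw [← e1, ← e3]
    exact ⟨Or.inr e2, Or.inr e4, hxy⟩

theorem StD.mem_imp {m r r' k : ℕ} {P : Set (ℕ × ℕ)} {V1 V1' : ℕ → Node} {V2 V2' : ℕ → Set Node}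
    (h : StD m r r' k P V1 V1' V2 V2') (x X : ℕ) (hxy : V1 x ∈ V2 X) : V1' x ∈ V2' X := by
  obtain ⟨b, b', c, c', W, hb, hc, hW, e3, e4⟩ := h.so X
  rw [e3] at hxy
  rw [e4]
  rcases h.fo x with ⟨a, a', ha, e1, e2⟩ | ⟨e1, e2⟩
  · have ba := h.hb _ ha
    rw [e1] at hxy
    rw [e2]
    rcases hxy with ⟨j, h1, h2, h3⟩ | hw
    · obtain rfl := zD_inj.1 h3
      exact Or.inl ⟨a', (closeD_le h.close hb ha).1 h1, (closeD_le h.close ha hc).1 h2, rfl⟩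
    · exact absurd (hW hw) (zD_not_UD ba.2.1)
  · rcases hxy with ⟨j, h1, h2, h3⟩ | hw
    · have bc := h.hb _ hc
      rw [h3] at e2
      exact absurd e2 (zD_not_UD (h2.trans bc.2.1))
    · exact Or.inr (e1 ▸ hw)

theorem StD.sat {AP : Type} (φ : MSOL AP) (m : ℕ) : ∀ (r r' k : ℕ) (hr : r < m) (hr' : r' < m)
    (P : Set (ℕ × ℕ)) (V1 V1' : ℕ → Node) (V2 V2' : ℕ → Set Node),
    StD m r r' k P V1 V1' V2 V2' → rkD φ ≤ k →
    (Sat MTLdom (KD AP m r hr.le) V1 V2 φ ↔ Sat MTLdom (KD AP m r' hr'.le) V1' V2' φ) := by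
  induction φ with
  | atom a x => intro r r' k hr hr' P V1 V1' V2 V2' h hk; simp [Sat, KD]
  | le x y =>
    intro r r' k hr hr' P V1 V1' V2 V2' h hk
    rw [sat_le, sat_le]
    exact ⟨fun h1 => h.le_imp x y h1.2.2, fun h1 => h.symm.le_imp x y h1.2.2⟩
  | mem x X =>
    intro r r' k hr hr' P V1 V1' V2 V2' h hk
    rw [sat_mem, sat_mem]
    exact ⟨h.mem_imp x X, h.symm.mem_imp x X⟩
  | not φ ih =>
    intro r r' k hr hr' P V1 V1' V2 V2' h hk
    rw [sat_not, sat_not]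
    exact not_congr (ih r r' k hr hr' P V1 V1' V2 V2' h hk)
  | and φ ψ ih1 ih2 =>
    intro r r' k hr hr' P V1 V1' V2 V2' h hk
    rw [sat_and, sat_and]
    simp only [rkD, max_le_iff] at hk
    exact and_congr (ih1 r r' k hr hr' P V1 V1' V2 V2' h hk.1) (ih2 r r' k hr hr' P V1 V1' V2 V2' h hk.2)
  | exFO x φ ih =>
    intro r r' k hr hr' P V1 V1' V2 V2' h hk
    simp only [rkD] at hk
    obtain ⟨k, rfl⟩ : ∃ j, k = j + 1 := ⟨k - 1, by omega⟩
    rw [sat_exFO, sat_exFO]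
    constructor
    · rintro ⟨v, hv, hs⟩
      obtain ⟨v', hv', P', st⟩ := h.forthFO x v hv
      exact ⟨v', hv', (ih r r' k hr hr' P' _ _ _ _ st (by omega)).1 hs⟩
    · rintro ⟨v, hv, hs⟩
      obtain ⟨v', hv', P', st⟩ := h.symm.forthFO x v hv
      exact ⟨v', hv', (ih r' r k hr' hr P' _ _ _ _ st (by omega)).1 hs⟩
  | exSO X φ ih =>
    intro r r' k hr hr' P V1 V1' V2 V2' h hk
    simp only [rkD] at hk
    obtain ⟨k, rfl⟩ : ∃ j, k = j + 1 + 1 := ⟨k - 2, by omega⟩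
    rw [sat_exSO, sat_exSO]
    constructor
    · rintro ⟨v, hv, hs⟩
      obtain ⟨v', hv', P', st⟩ := h.forthSO hr hr' X v hv
      exact ⟨v', hv', (ih r r' k hr hr' P' _ _ _ _ st (by omega)).1 hs⟩
    · rintro ⟨v, hv, hs⟩
      obtain ⟨v', hv', P', st⟩ := h.symm.forthSO hr' hr X v hv
      exact ⟨v', hv', (ih r' r k hr' hr P' _ _ _ _ st (by omega)).1 hs⟩

/-! ### the sentence -/

def segF {AP : Type} (x w : ℕ) : MSOL AP := .all1 w (.imp (.not (.le w x)) (.le x w))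

theorem sat_segF {AP : Type} (D : SODom) (m r : ℕ) (hr : r ≤ m) (V1 V2) (x w : ℕ) (hx : x ≠ w)
    (hT : V1 x ∈ TD m r) :
    Sat D (KD AP m r hr) V1 V2 (segF x w) ↔ ∃ j, r ≤ j ∧ j ≤ m ∧ V1 x = zD j := by
  simp only [segF, sat_all1, sat_imp, sat_not, sat_le]
  simp only [Function.update_self, Function.update_of_ne hx]
  change (∀ τ ∈ TD m r, ¬ (τ ∈ TD m r ∧ V1 x ∈ TD m r ∧ τ <+: V1 x) →
    V1 x ∈ TD m r ∧ τ ∈ TD m r ∧ V1 x <+: τ) ↔ _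
  generalize V1 x = v at *
  constructor
  · intro h
    rcases hT with hT | hT
    · exact hT
    · exfalso
      obtain ⟨t, ht⟩ := hT.1
      cases t with
      | nil => exact hT.2.1 (by simpa using ht.symm)
      | cons b t =>
        have hb : b < 2 := hT.2.2 b (by simp [← ht])
        have hm : zD m ∈ TD m r := Or.inl ⟨m, hr, le_rfl, rfl⟩
        have hc : zD m ++ [1 - b] ∈ TD m r :=
          Or.inr (TD_child m r _ List.prefix_rfl hm (1 - b) (by omega))
        have hne : ¬ (1 - b = b) := by omega
        have := (h _ hc (by
          rintro ⟨_, _, h3⟩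
          rw [← ht, List.prefix_append_right_inj, List.cons_prefix_cons] at h3
          exact hne h3.1)).2.2
        rw [← ht, List.prefix_append_right_inj, List.cons_prefix_cons] at this
        exact hne this.1.symm
  · rintro ⟨j, h1, h2, rfl⟩ τ hτ h3
    refine ⟨hT, hτ, ?_⟩
    rcases hτ with ⟨i, h4, h5, rfl⟩ | hτ
    · rw [zD_prefix]
      by_contra h6
      exact h3 ⟨Or.inl ⟨i, h4, h5, rfl⟩, hT, zD_prefix.2 (by omega)⟩
    · exact (zD_prefix.2 h2).trans hτ.1

def chiD (AP : Type) : MSOL AP :=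
  .exSO 0 (.and (.all1 0 (.imp (.all1 1 (.le 0 1)) (.mem 0 0)))
    (.and (.all1 0 (.imp (.and (segF 0 2) (.all1 1 (.imp (segF 1 2) (.le 1 0)))) (.mem 0 0)))
      (.all1 0 (.all1 1 (.imp (.and (segF 1 2) (chF 0 1 2))
        (.and (.imp (.mem 0 0) (.not (.mem 1 0))) (.imp (.not (.mem 0 0)) (.mem 1 0))))))))

theorem chiD_sentence (AP : Type) : (chiD AP).IsSentence := by
  constructor
  · ext z; simp [chiD, MSOL.freeFO, MSOL.all1, MSOL.imp, MSOL.lt, chF, segF]; omega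
  · ext z; simp [chiD, MSOL.freeSO, MSOL.all1, MSOL.imp, MSOL.lt, chF, segF]

theorem zD_succ (j : ℕ) : zD (j+1) = zD j ++ [0] := by simp [zD, List.replicate_succ']

theorem sat_chiD (AP : Type) (m r : ℕ) (hr : r ≤ m) (V1 V2) :
    Sat (weakDom MSOdom) (KD AP m r hr) V1 V2 (chiD AP) ↔ Even (m - r) := by
  have zT : ∀ j, r ≤ j → j ≤ m → zD j ∈ (KD AP m r hr).T := fun j h1 h2 => Or.inl ⟨j, h1, h2, rfl⟩
  have hroot : ∀ τ ∈ (KD AP m r hr).T, zD r <+: τ := fun τ hτ => (KD AP m r hr).rooted.2.1 τ hτ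
  simp only [chiD, sat_exSO, sat_and, sat_all1, sat_imp, sat_not, sat_mem, sat_le]
  constructor
  · rintro ⟨X, -, h1, h2, h3⟩
    have k1 : zD r ∈ X := by
      have := h1 (zD r) (zT r le_rfl hr) (fun τ hτ => ⟨by simpa using zT r le_rfl hr, by simpa using hτ,
        by simpa using hroot τ hτ⟩)
      simpa using this
    have k2 : zD m ∈ X := by
      have := h2 (zD m) (zT m hr le_rfl) ⟨?_, ?_⟩
      · simpa using this
      · rw [sat_segF _ _ _ _ _ _ _ _ (by decide) (by change _ ∈ (KD AP m r hr).T; simpa using zT m hr le_rfl)]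
        exact ⟨m, hr, le_rfl, by simp⟩
      · intro τ hτ hs
        rw [sat_segF _ _ _ _ _ _ _ _ (by decide) (by change _ ∈ (KD AP m r hr).T; simpa using hτ)] at hs
        obtain ⟨j, a1, a2, a3⟩ := hs
        simp at a3
        subst a3
        exact ⟨by simpa using hτ, by simpa using zT m hr le_rfl, by simpa using zD_prefix.2 a2⟩
    have k3 : ∀ j, r + j < m → (zD (r + j) ∈ X ↔ zD (r + j + 1) ∉ X) := by
      intro j hj
      have := h3 (zD (r+j)) (zT _ (by omega) (by omega)) (zD (r+j+1)) (zT _ (by omega) (by omega)) ⟨?_, ?_⟩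
      · simp at this
        tauto
      · rw [sat_segF _ _ _ _ _ _ _ _ (by decide) (by change _ ∈ (KD AP m r hr).T; simpa using zT _ (by omega) (by omega))]
        exact ⟨r+j+1, by omega, by omega, by simp⟩
      · rw [sat_chF _ _ _ _ _ _ _ (by decide) (by decide)]
        exact ⟨by simpa using zT _ (by omega) (by omega), by simpa using zT _ (by omega) (by omega), 0, by simp [zD_succ]⟩
    have k4 : ∀ j, r + j ≤ m → (zD (r + j) ∈ X ↔ Even j) := by
      intro j
      induction j with
      | zero => intro _; simpa using k1
      | succ j ih =>
        intro hj
        have a := k3 j (by omega)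
        have b := ih (by omega)
        rw [Nat.even_add_one, ← b, a, not_not]
        rfl
    have := k4 (m - r) (by omega)
    rw [← this]
    simpa [Nat.add_sub_cancel' hr] using k2
  · intro he
    have hX : ∀ j, zD j ∈ {τ | ∃ j, r ≤ j ∧ j ≤ m ∧ Even (j - r) ∧ τ = zD j} ↔ (r ≤ j ∧ j ≤ m ∧ Even (j - r)) := by
      intro j
      constructor
      · rintro ⟨i, a, b, c, d⟩
        rw [zD_inj.1 d]; exact ⟨a, b, c⟩
      · rintro ⟨a, b, c⟩; exact ⟨j, a, b, c, rfl⟩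
    refine ⟨{τ | ∃ j, r ≤ j ∧ j ≤ m ∧ Even (j - r) ∧ τ = zD j}, ⟨?_, ?_⟩, ?_, ?_, ?_⟩
    · rintro τ ⟨j, a, b, _, rfl⟩; exact zT j a b
    · refine ((Set.finite_Iic m).image zD).subset ?_
      rintro τ ⟨j, a, b, _, rfl⟩; exact ⟨j, b, rfl⟩
    · intro τ hτ h
      have := h (zD r) (zT r le_rfl hr)
      simp only [Function.update_self, Function.update_of_ne (show (0:ℕ) ≠ 1 by decide)] at this ⊢
      obtain ⟨i, hi, rfl⟩ := prefix_zD this.2.2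
      have h2 := zD_prefix.1 (hroot _ hτ)
      rw [hX]
      have : i = r := le_antisymm hi h2
      subst this
      simp [hr]
    · rintro τ hτ ⟨hs, h⟩
      rw [sat_segF _ _ _ _ _ _ _ _ (by decide) (by change _ ∈ (KD AP m r hr).T; simpa using hτ)] at hs
      obtain ⟨j, a1, a2, a3⟩ := hs
      simp at a3
      subst a3
      have := h (zD m) (zT m hr le_rfl) (by
        rw [sat_segF _ _ _ _ _ _ _ _ (by decide) (by change _ ∈ (KD AP m r hr).T; simpa using zT m hr le_rfl)]
        exact ⟨m, hr, le_rfl, by simp⟩)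
      simp only [Function.update_self, Function.update_of_ne (show (0:ℕ) ≠ 1 by decide)] at this ⊢
      have h4 := zD_prefix.1 this.2.2
      have : j = m := by omega
      subst this
      rw [hX]
      exact ⟨hr, le_rfl, he⟩
    · rintro τ hτ τ' hτ' ⟨hs, hc⟩
      rw [sat_segF _ _ _ _ _ _ _ _ (by decide) (by change _ ∈ (KD AP m r hr).T; simpa using hτ')] at hs
      rw [sat_chF _ _ _ _ _ _ _ (by decide) (by decide)] at hc
      obtain ⟨j, a1, a2, a3⟩ := hs
      obtain ⟨_, _, n, hn⟩ := hc
      simp at a3 hn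
      subst a3
      have hp : τ <+: zD j := by rw [hn]; exact List.prefix_append _ _
      obtain ⟨i, hi, rfl⟩ := prefix_zD hp
      have hlen := congrArg List.length hn
      simp [zD] at hlen
      subst hlen
      have h2 := zD_prefix.1 (hroot _ hτ)
      simp only [Function.update_self, Function.update_of_ne (show (0:ℕ) ≠ 1 by decide), hX]
      have e : i + 1 - r = (i - r) + 1 := by omega
      rw [e, Nat.even_add_one]
      constructor
      · rintro ⟨_, _, h⟩ ⟨_, _, h'⟩; exact h' h
      · intro h
        exact ⟨a1, a2, fun h' => h ⟨h2, by omega, h'⟩⟩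

theorem partD_main (AP : Type) : ¬ MLogic.Leq (finBrKT AP) (WMSO AP) (MTL AP) := by
  intro h
  obtain ⟨φ, h1, -, h2⟩ := h (chiD AP) (chiD_sentence AP) trivial
  let k := rkD φ
  let m := 2 * 2^k + 2
  have hm0 : 0 < m := by simp [m]
  have hm1 : 1 < m := by simp [m]
  have e0 := h2 _ (KD_fin AP m 0 hm0.le)
  have e1 := h2 _ (KD_fin AP m 1 hm1.le)
  rw [ksat_iff _ _ _ (chiD_sentence AP) (fun _ => []) (fun _ => ∅),
    ksat_iff _ _ _ h1 (fun _ => zD m) (fun _ => segD m m ∅)] at e0 e1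
  have s0 := sat_chiD AP m 0 hm0.le (fun _ => []) (fun _ => ∅)
  have s1 := sat_chiD AP m 1 hm1.le (fun _ => []) (fun _ => ∅)
  have st : StD m 0 1 k {(0, 1), (m, m)} (fun _ => zD m) (fun _ => zD m) (fun _ => segD m m ∅)
      (fun _ => segD m m ∅) := by
    constructor
    · have : 0 < 2^k := by positivity
      rintro p (rfl | rfl) q (rfl | rfl)
      · simp
      · simp [m]; omega
      · simp only; omega
      · simp
    · simp
    · simp
    · rintro p (rfl | rfl) <;> simp <;> omega
    · intro x; exact Or.inl ⟨m, m, by simp, rfl, rfl⟩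
    · intro X; exact ⟨m, m, m, m, ∅, by simp, by simp, by simp, rfl, rfl⟩
  have key := st.sat φ m 0 1 k hm0 hm1 _ _ _ _ _ le_rfl
  change _ ↔ Sat MTLdom _ _ _ φ at e0
  change _ ↔ Sat MTLdom _ _ _ φ at e1
  change Sat (weakDom MSOdom) _ _ _ _ ↔ _ at e0
  change Sat (weakDom MSOdom) _ _ _ _ ↔ _ at e1
  rw [s0, key, ← e1, s1] at e0
  have a : Even (m - 0) := ⟨2^k + 1, by simp [m]; omega⟩
  have b := e0.1 a
  have c : m - 1 = 2 * 2^k + 1 := by simp [m]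
  rw [c] at b
  exact (Nat.not_even_iff_odd.2 ⟨2^k, rfl⟩) b

end partD
/-! ## Counting up to a threshold -/

section capB

def capB {α β : Type} (M : ℕ) (A : Set α) (B : Set β) : Prop :=
  A.encard = B.encard ∨ ((M : ℕ∞) ≤ A.encard ∧ (M : ℕ∞) ≤ B.encard)

theorem capB_symm {α β : Type} {M : ℕ} {A : Set α} {B : Set β} (h : capB M A B) : capB M B A := by
  rcases h with h | h
  · exact Or.inl h.symm
  · exact Or.inr ⟨h.2, h.1⟩

theorem capB_mono {α β : Type} {M M' : ℕ} (hM : M ≤ M') {A : Set α} {B : Set β} (h : capB M' A B) :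
    capB M A B := by
  have hM : (M : ℕ∞) ≤ M' := by exact_mod_cast hM
  rcases h with h | h
  · exact Or.inl h
  · exact Or.inr ⟨hM.trans h.1, hM.trans h.2⟩

theorem capB_union {α β : Type} {M : ℕ} {A A' : Set α} {B B' : Set β} (h : capB M A B)
    (h' : capB M A' B') (hA : Disjoint A A') (hB : Disjoint B B') : capB M (A ∪ A') (B ∪ B') := by
  unfold capB at *
  rw [Set.encard_union_eq hA, Set.encard_union_eq hB]
  rcases h with h | h
  · rcases h' with h' | h'
    · left; rw [h, h']
    · right; exact ⟨h'.1.trans le_add_self, h'.2.trans le_add_self⟩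
  · right; exact ⟨h.1.trans le_self_add, h.2.trans le_self_add⟩

theorem capB_nonempty {α β : Type} {M : ℕ} (hM : 1 ≤ M) {A : Set α} {B : Set β} (h : capB M A B)
    (hA : A.Nonempty) : B.Nonempty := by
  rw [Set.nonempty_iff_ne_empty, Ne, ← Set.encard_eq_zero] at *
  rcases h with h | h
  · rwa [← h]
  · intro h0
    rw [h0] at h
    have := h.2
    simp at this
    omega

theorem capB_split_aux {α β : Type} {M1 M2 : ℕ} {A B : Set α} {C : Set β} (hd : Disjoint A B)
    (h : capB (M1 + M2) (A ∪ B) C) (ha : A.encard < M1) :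
    ∃ C1 C2, C1 ∪ C2 = C ∧ Disjoint C1 C2 ∧ capB M1 A C1 ∧ capB M2 B C2 := by
  unfold capB at *
  rw [Set.encard_union_eq hd] at h
  have hle : A.encard ≤ C.encard := by
    rcases h with h | h
    · rw [← h]; exact le_self_add
    · refine ha.le.trans (le_trans ?_ h.2)
      push_cast; exact le_self_add
  obtain ⟨C1, h1, h2⟩ := Set.exists_subset_encard_eq hle
  refine ⟨C1, C \ C1, Set.union_sdiff_cancel h1, Set.disjoint_sdiff_right, Or.inl h2.symm, ?_⟩
  have h3 : A.encard + (C \ C1).encard = C.encard := by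
    rw [← h2, add_comm, Set.encard_sdiff_add_encard_of_subset h1]
  rw [← h3] at h
  generalize A.encard = a at *
  generalize B.encard = b at *
  generalize (C \ C1).encard = r at *
  clear h3 hle h2
  lift a to ℕ using ha.ne_top
  have ha' : a < M1 := by exact_mod_cast ha
  have key : ∀ x : ℕ∞, ((M1 + M2 : ℕ) : ℕ∞) ≤ a + x → (M2 : ℕ∞) ≤ x := by
    intro x hx
    cases x with
    | top => exact le_top
    | coe x => norm_cast at *; omega
  rcases h with h | h
  · left
    exact ENat.add_right_injective_of_ne_top (by simp) h
  · exact Or.inr ⟨key _ h.1, key _ h.2⟩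

theorem capB_split {α β : Type} {M1 M2 : ℕ} {A B : Set α} {C : Set β} (hd : Disjoint A B)
    (h : capB (M1 + M2) (A ∪ B) C) :
    ∃ C1 C2, C1 ∪ C2 = C ∧ Disjoint C1 C2 ∧ capB M1 A C1 ∧ capB M2 B C2 := by
  by_cases ha : A.encard < M1
  · exact capB_split_aux hd h ha
  by_cases hb : B.encard < M2
  · obtain ⟨C1, C2, h1, h2, h3, h4⟩ := capB_split_aux hd.symm
      (by rwa [Set.union_comm, add_comm]) hb (C := C) (M2 := M1)
    exact ⟨C2, C1, by rwa [Set.union_comm], h2.symm, h4, h3⟩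
  push Not at ha hb
  unfold capB at *
  rw [Set.encard_union_eq hd] at h
  have hc : (M1 : ℕ∞) + M2 ≤ C.encard := by
    rcases h with h | h
    · rw [← h]; exact add_le_add ha hb
    · exact_mod_cast h.2
  obtain ⟨C1, h1, h2⟩ := Set.exists_subset_encard_eq (le_self_add.trans hc)
  refine ⟨C1, C \ C1, Set.union_sdiff_cancel h1, Set.disjoint_sdiff_right, Or.inr ⟨ha, h2.ge⟩, Or.inr ⟨hb, ?_⟩⟩
  have h3 : (M1 : ℕ∞) + (C \ C1).encard = C.encard := by
    rw [← h2, add_comm, Set.encard_sdiff_add_encard_of_subset h1]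
  rw [← h3] at hc
  exact (ENat.add_le_add_iff_left (by simp)).1 hc

theorem capB_dist {α β Q : Type} [Nonempty Q] [DecidableEq Q] (M : ℕ) (h : α → Q) (s : Finset Q) :
    ∀ (A : Set α) (A' : Set β), (∀ i ∈ A, h i ∈ s) → capB (M * s.card + 1) A A' →
      ∃ h' : β → Q, (∀ i ∈ A', h' i ∈ s) ∧
        ∀ q, capB M {i | i ∈ A ∧ h i = q} {i | i ∈ A' ∧ h' i = q} := by
  induction s using Finset.induction_on with
  | empty =>
    intro A A' hA hc
    have hA0 : A = ∅ := by ext i; simpa using hA i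
    have hA0' : A' = ∅ := by
      by_contra hne
      have := capB_nonempty (by omega) (capB_symm hc) (Set.nonempty_iff_ne_empty.2 hne)
      simp [hA0] at this
    subst hA0 hA0'
    exact ⟨fun _ => Classical.arbitrary Q, by simp, fun q => Or.inl (by simp)⟩
  | insert q0 s hq ih =>
    intro A A' hA hc
    have e : A = {i | i ∈ A ∧ h i = q0} ∪ {i | i ∈ A ∧ h i ≠ q0} := by
      ext i; simp; tauto
    have hd : Disjoint {i | i ∈ A ∧ h i = q0} {i | i ∈ A ∧ h i ≠ q0} := by
      rw [Set.disjoint_left]; rintro i ⟨_, h1⟩ ⟨_, h2⟩; exact h2 h1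
    have hM : M * (insert q0 s).card + 1 = M + (M * s.card + 1) := by
      rw [Finset.card_insert_of_notMem hq]; ring
    rw [hM, e] at hc
    obtain ⟨C1, C2, h1, h2, h3, h4⟩ := capB_split hd hc
    obtain ⟨h', h5, h6⟩ := ih _ C2 (fun i hi => by
      have := hA i hi.1
      rw [Finset.mem_insert] at this
      exact this.resolve_left hi.2) h4
    classical
    refine ⟨fun i => if i ∈ C1 then q0 else h' i, ?_, ?_⟩
    · intro i hi
      by_cases hi1 : i ∈ C1
      · simp [hi1]
      · rw [← h1] at hi
        simp only [hi1, if_false]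
        exact Finset.mem_insert_of_mem (h5 i (hi.resolve_left hi1))
    · intro q
      by_cases hqq : q = q0
      · subst hqq
        convert h3 using 1
        ext i
        constructor
        · rintro ⟨hi, hi2⟩
          by_contra hi1
          simp only [hi1, if_false] at hi2
          rw [← h1] at hi
          have := h5 i (hi.resolve_left hi1)
          rw [hi2] at this
          exact hq this
        · intro hi
          refine ⟨h1 ▸ Or.inl hi, by simp [hi]⟩
      · convert h6 q using 1
        · ext i
          constructor
          · rintro ⟨hi, rfl⟩; exact ⟨⟨hi, hqq⟩, rfl⟩
          · rintro ⟨⟨hi, _⟩, rfl⟩; exact ⟨hi, rfl⟩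
        · ext i
          constructor
          · rintro ⟨hi, hi2⟩
            have hi1 : i ∉ C1 := by
              intro hi1
              simp only [hi1, if_true] at hi2
              exact hqq hi2.symm
            simp only [hi1, if_false] at hi2
            rw [← h1] at hi
            exact ⟨hi.resolve_left hi1, hi2⟩
          · rintro ⟨hi, hi2⟩
            have hi1 : i ∉ C1 := fun hi1 => Set.disjoint_left.1 h2 hi1 hi
            exact ⟨h1 ▸ Or.inr hi, by simp [hi1, hi2]⟩

theorem capB_sum {α β P : Type} [Finite P] {M : ℕ} (A : Set α) (B : Set β)
    (f : α → P) (f' : β → P)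
    (h : ∀ t, capB M {i | i ∈ A ∧ f i = t} {i | i ∈ B ∧ f' i = t}) : capB M A B := by
  classical
  have := Fintype.ofFinite P
  have key : ∀ s : Finset P, capB M {i | i ∈ A ∧ f i ∈ s} {i | i ∈ B ∧ f' i ∈ s} := by
    intro s
    induction s using Finset.induction_on with
    | empty => left; simp
    | insert t s ht ih =>
      have e1 : {i | i ∈ A ∧ f i ∈ insert t s} = {i | i ∈ A ∧ f i = t} ∪ {i | i ∈ A ∧ f i ∈ s} := by
        ext i; simp [and_or_left]
      have e2 : {i | i ∈ B ∧ f' i ∈ insert t s} = {i | i ∈ B ∧ f' i = t} ∪ {i | i ∈ B ∧ f' i ∈ s} := by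
        ext i; simp [and_or_left]
      rw [e1, e2]
      refine capB_union (h t) ih ?_ ?_
      · rw [Set.disjoint_left]; rintro i ⟨_, h1⟩ ⟨_, h2⟩; exact ht (h1 ▸ h2)
      · rw [Set.disjoint_left]; rintro i ⟨_, h1⟩ ⟨_, h2⟩; exact ht (h1 ▸ h2)
  simpa using key Finset.univ

theorem capB_distribute {α β P Q : Type} [Nonempty Q] [Finite Q] [Finite P] {M M' : ℕ}
    (hM : M * Nat.card Q + 1 ≤ M') (A : Set α) (B : Set β) (f : α → P) (f' : β → P) (h : α → Q)
    (hc : ∀ t, capB M' {i | i ∈ A ∧ f i = t} {i | i ∈ B ∧ f' i = t}) :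
    ∃ h' : β → Q, ∀ t q, capB M {i | i ∈ A ∧ f i = t ∧ h i = q} {i | i ∈ B ∧ f' i = t ∧ h' i = q} := by
  classical
  have := Fintype.ofFinite Q
  rw [Nat.card_eq_fintype_card] at hM
  have key : ∀ t, ∃ h' : β → Q, ∀ q, capB M {i | i ∈ {i | i ∈ A ∧ f i = t} ∧ h i = q}
      {i | i ∈ {i | i ∈ B ∧ f' i = t} ∧ h' i = q} := by
    intro t
    obtain ⟨h', -, h2⟩ := capB_dist M h Finset.univ _ _ (fun _ _ => Finset.mem_univ _)
      (capB_mono (by simpa using hM) (hc t))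
    exact ⟨h', h2⟩
  choose H hH using key
  refine ⟨fun i => H (f' i) i, fun t q => ?_⟩
  convert hH t q using 1
  · ext i; simp [and_assoc]
  · ext i
    constructor
    · rintro ⟨h1, rfl, h3⟩; exact ⟨⟨h1, rfl⟩, h3⟩
    · rintro ⟨⟨h1, rfl⟩, h3⟩; exact ⟨h1, rfl, h3⟩

end capB
/-! ## MSO cannot express finiteness of the branching degree -/

section partB
variable {ι : Type}

abbrev AtB (ι : Type) : Type := ι → ι → Prop × Prop × Prop

def atB (w : ι → Set Node) : AtB ι := fun a b =>
  (∃ τ ∈ w a, ∃ τ' ∈ w b, τ <+: τ', (w a ∩ w b).Nonempty, (w a).Subsingleton)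

def TpB (ι : Type) : ℕ → Type
  | 0 => AtB ι
  | k+1 => AtB ι × (ι → Set (TpB ι k))

instance TpB_finite [Finite ι] : ∀ k, Finite (TpB ι k)
  | 0 => inferInstanceAs (Finite (AtB ι))
  | k+1 =>
    have := TpB_finite k
    inferInstanceAs (Finite (AtB ι × (ι → Set (TpB ι k))))

open Classical in
noncomputable def tpB : (k : ℕ) → (ι → Set Node) → TpB ι k
  | 0, w => atB w
  | k+1, w => (atB w, fun a => Set.range fun S => tpB k (Function.update w a S))

theorem tpB_atB {k : ℕ} {w w' : ι → Set Node} (h : tpB k w = tpB k w') : atB w = atB w' := by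
  cases k with
  | zero => exact h
  | succ k => exact congrArg Prod.fst h

open Classical in
theorem tpB_move {k : ℕ} {w w' : ι → Set Node} (h : tpB (k+1) w = tpB (k+1) w') (a : ι) (S : Set Node) :
    ∃ S', tpB k (Function.update w' a S') = tpB k (Function.update w a S) := by
  have h2 : (fun a => Set.range fun S => tpB k (Function.update w a S)) =
    (fun a => Set.range fun S => tpB k (Function.update w' a S)) := congrArg Prod.snd h
  have h3 := congrFun h2 a
  have h4 : tpB k (Function.update w a S) ∈ Set.range fun S => tpB k (Function.update w a S) := ⟨S, rfl⟩
  rw [h3] at h4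
  exact h4

instance TpB_nonempty (k : ℕ) : Nonempty (TpB ι k) := ⟨tpB k fun _ => ∅⟩

noncomputable def capM (ι : Type) : ℕ → ℕ
  | 0 => 2
  | k+1 => capM ι k * Nat.card (TpB ι k) + 2

theorem capM_two (k : ℕ) : 2 ≤ capM ι k := by
  cases k <;> simp [capM]

def compB (i : ℕ) (G : ι → Set Node) : ι → Set Node := fun a => {τ | i :: τ ∈ G a}

def treeB (I : Set ℕ) : Set Node := {τ | τ = [] ∨ ∃ i ∈ I, ∃ σ, τ = i :: σ}

structure RB (k : ℕ) (I I' : Set ℕ) (G G' : ι → Set Node) : Prop where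
  sub : ∀ a, G a ⊆ treeB I
  sub' : ∀ a, G' a ⊆ treeB I'
  root : ∀ a, [] ∈ G a ↔ [] ∈ G' a
  cnt : ∀ t, capB (capM ι k) {i | i ∈ I ∧ tpB k (compB i G) = t} {i | i ∈ I' ∧ tpB k (compB i G') = t}

theorem RB.symm {k : ℕ} {I I' : Set ℕ} {G G' : ι → Set Node} (h : RB k I I' G G') :
    RB k I' I G' G :=
  ⟨h.sub', h.sub, fun a => (h.root a).symm, fun t => capB_symm (h.cnt t)⟩

theorem RB.ex1 {k : ℕ} {I I' : Set ℕ} {G G' : ι → Set Node} (h : RB k I I' G G') {i : ℕ} (hi : i ∈ I) :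
    ∃ i' ∈ I', atB (compB i G) = atB (compB i' G') := by
  obtain ⟨i', h1, h2⟩ := capB_nonempty (by have := capM_two (ι := ι) k; omega)
    (h.cnt (tpB k (compB i G))) ⟨i, hi, rfl⟩
  exact ⟨i', h1, tpB_atB h2.symm⟩

theorem RB.capAt [Finite ι] {k : ℕ} {I I' : Set ℕ} {G G' : ι → Set Node} (h : RB k I I' G G')
    (p : AtB ι → Prop) :
    capB (capM ι k) {i | i ∈ I ∧ p (atB (compB i G))} {i | i ∈ I' ∧ p (atB (compB i G'))} := by
  refine capB_sum _ _ (fun i => tpB k (compB i G)) (fun i => tpB k (compB i G')) fun t => ?_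
  by_cases ht : ∃ w : ι → Set Node, tpB k w = t ∧ p (atB w)
  · obtain ⟨w, rfl, hw⟩ := ht
    convert h.cnt (tpB k w) using 1
    · ext i
      constructor
      · rintro ⟨⟨h1, h2⟩, h3⟩; exact ⟨h1, h3⟩
      · rintro ⟨h1, h3⟩; exact ⟨⟨h1, by rw [tpB_atB h3]; exact hw⟩, h3⟩
    · ext i
      constructor
      · rintro ⟨⟨h1, h2⟩, h3⟩; exact ⟨h1, h3⟩
      · rintro ⟨h1, h3⟩; exact ⟨⟨h1, by rw [tpB_atB h3]; exact hw⟩, h3⟩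
  · have e : ∀ (J : Set ℕ) (H : ι → Set Node),
        {i | i ∈ {i | i ∈ J ∧ p (atB (compB i H))} ∧ tpB k (compB i H) = t} = ∅ := by
      intro J H
      ext i
      simp only [Set.mem_empty_iff_false, iff_false]
      rintro ⟨⟨h1, h2⟩, h3⟩
      exact ht ⟨_, h3, h2⟩
    rw [e, e]
    left; simp

theorem atB_ne {w w' : ι → Set Node} (h : atB w = atB w') {a : ι} (h1 : (w a).Nonempty) :
    (w' a).Nonempty := by
  have := congrArg (fun x => (x a a).2.1) h
  simp only [atB, Set.inter_self] at this
  rwa [← this]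

theorem RB.nonempty {k : ℕ} {I I' : Set ℕ} {G G' : ι → Set Node} (h : RB k I I' G G') {a : ι}
    (h1 : (G a).Nonempty) : (G' a).Nonempty := by
  obtain ⟨τ, hτ⟩ := h1
  rcases h.sub a hτ with rfl | ⟨i, hi, σ, rfl⟩
  · exact ⟨[], (h.root a).1 hτ⟩
  · obtain ⟨i', hi', he⟩ := h.ex1 hi
    obtain ⟨σ', hσ'⟩ := atB_ne he (a := a) ⟨σ, hτ⟩
    exact ⟨_, hσ'⟩

theorem RB.inter {k : ℕ} {I I' : Set ℕ} {G G' : ι → Set Node} (h : RB k I I' G G') {a b : ι}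
    (h1 : (G a ∩ G b).Nonempty) : (G' a ∩ G' b).Nonempty := by
  obtain ⟨τ, hτ, hτ2⟩ := h1
  rcases h.sub a hτ with rfl | ⟨i, hi, σ, rfl⟩
  · exact ⟨[], (h.root a).1 hτ, (h.root b).1 hτ2⟩
  · obtain ⟨i', hi', he⟩ := h.ex1 hi
    have := congrArg (fun x => (x a b).2.1) he
    simp only [atB] at this
    have h2 : (compB i G a ∩ compB i G b).Nonempty := ⟨σ, hτ, hτ2⟩
    rw [this] at h2
    obtain ⟨σ', h3, h4⟩ := h2
    exact ⟨_, h3, h4⟩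

theorem RB.pre {k : ℕ} {I I' : Set ℕ} {G G' : ι → Set Node} (h : RB k I I' G G') {a b : ι}
    (h1 : ∃ τ ∈ G a, ∃ τ' ∈ G b, τ <+: τ') : ∃ τ ∈ G' a, ∃ τ' ∈ G' b, τ <+: τ' := by
  obtain ⟨τ, hτ, τ', hτ', hp⟩ := h1
  rcases h.sub a hτ with rfl | ⟨i, hi, σ, rfl⟩
  · obtain ⟨τ', h2⟩ := h.nonempty ⟨_, hτ'⟩
    exact ⟨[], (h.root a).1 hτ, τ', h2, List.nil_prefix⟩
  · obtain ⟨i', hi', he⟩ := h.ex1 hi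
    have := congrArg (fun x => (x a b).1) he
    simp only [atB] at this
    obtain ⟨t, rfl⟩ := hp
    have h2 : ∃ τ ∈ compB i G a, ∃ τ' ∈ compB i G b, τ <+: τ' :=
      ⟨σ, hτ, σ ++ t, hτ', List.prefix_append _ _⟩
    rw [this] at h2
    obtain ⟨σ', h3, σ'', h4, h5⟩ := h2
    exact ⟨_, h3, _, h4, List.cons_prefix_cons.2 ⟨rfl, h5⟩⟩

theorem RB.single [Finite ι] {k : ℕ} {I I' : Set ℕ} {G G' : ι → Set Node} (h : RB k I I' G G')
    {a : ι} {τ : Node} (h1 : G a = {τ}) : ∃ τ', G' a = {τ'} := by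
  obtain ⟨τ', hτ'⟩ := h.nonempty (a := a) (by rw [h1]; simp)
  refine ⟨τ', ?_⟩
  have hT : τ ∈ G a := by rw [h1]; rfl
  -- comparing two elements of the other set
  suffices hs : (G' a).Subsingleton from
    Set.Subset.antisymm (fun σ hσ => hs hσ hτ') (by simpa using hτ')
  clear hτ' τ'
  have back : ∀ i' σ', i' :: σ' ∈ G' a → i' ∈ I' ∧ ∃ i ∈ I, ∃ σ, i :: σ ∈ G a := by
    intro i' σ' hm
    have hi' : i' ∈ I' := by
      rcases h.sub' a hm with h0 | ⟨i, hi, σ, hσ⟩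
      · simp at h0
      · simp at hσ; rw [hσ.1]; exact hi
    refine ⟨hi', ?_⟩
    obtain ⟨i, hi, he⟩ := h.symm.ex1 hi'
    obtain ⟨σ, hσ⟩ := atB_ne he (a := a) ⟨σ', hm⟩
    exact ⟨i, hi, σ, hσ⟩
  have hone : ∀ i' ∈ {i | i ∈ I' ∧ (atB (compB i G') a a).2.1},
      ∀ j' ∈ {i | i ∈ I' ∧ (atB (compB i G') a a).2.1}, i' = j' := by
    have hc := h.capAt (fun w => (w a a).2.1)
    rcases hc with hc | hc
    · have hle : {i | i ∈ I ∧ (atB (compB i G) a a).2.1}.encard ≤ 1 := by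
        rw [Set.encard_le_one_iff]
        rintro i j ⟨_, σ, hσ, -⟩ ⟨_, σ', hσ', -⟩
        have a1 : i :: σ ∈ G a := hσ
        have a2 : j :: σ' ∈ G a := hσ'
        rw [h1] at a1 a2
        have : i :: σ = j :: σ' := by
          rw [Set.mem_singleton_iff.1 a1, Set.mem_singleton_iff.1 a2]
        exact (List.cons.inj this).1
      rw [hc, Set.encard_le_one_iff] at hle
      exact fun i hi j hj => hle i j hi hj
    · exfalso
      have hle : {i | i ∈ I ∧ (atB (compB i G) a a).2.1}.encard ≤ 1 := by
        rw [Set.encard_le_one_iff]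
        rintro i j ⟨_, σ, hσ, -⟩ ⟨_, σ', hσ', -⟩
        have a1 : i :: σ ∈ G a := hσ
        have a2 : j :: σ' ∈ G a := hσ'
        rw [h1] at a1 a2
        have : i :: σ = j :: σ' := by
          rw [Set.mem_singleton_iff.1 a1, Set.mem_singleton_iff.1 a2]
        exact (List.cons.inj this).1
      have h2 := hc.1.trans hle
      have h3 := capM_two (ι := ι) k
      have h4 : capM ι k ≤ 1 := by exact_mod_cast h2
      omega
  have mix : ∀ i' σ', i' :: σ' ∈ G' a → [] ∉ G' a := by
    intro i' σ' hm h0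
    obtain ⟨_, i, _, σ, hσ⟩ := back i' σ' hm
    have h0 := (h.root a).2 h0
    rw [h1] at h0 hσ
    rw [← Set.mem_singleton_iff.1 hσ] at h0
    simp at h0
  intro x hx y hy
  rcases h.sub' a hx with rfl | ⟨i, hi, σ, rfl⟩
  · rcases h.sub' a hy with rfl | ⟨j, hj, σ', rfl⟩
    · rfl
    · exact absurd hx (mix _ _ hy)
  · rcases h.sub' a hy with rfl | ⟨j, hj, σ', rfl⟩
    · exact absurd hy (mix _ _ hx)
    · have := hone i ⟨hi, σ, hx, hx⟩ j ⟨hj, σ', hy, hy⟩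
      subst this
      obtain ⟨i0, hi0, he⟩ := h.symm.ex1 hi
      have he := congrArg (fun x => (x a a).2.2) he
      simp only [atB] at he
      have hs : (compB i0 G a).Subsingleton := by
        intro u hu v hv
        have a1 : i0 :: u ∈ G a := hu
        have a2 : i0 :: v ∈ G a := hv
        rw [h1] at a1 a2
        have : i0 :: u = i0 :: v := by
          rw [Set.mem_singleton_iff.1 a1, Set.mem_singleton_iff.1 a2]
        exact (List.cons.inj this).2
      rw [← he] at hs
      rw [hs hx hy]

open Classical in
theorem RB.move [Finite ι] {k : ℕ} {I I' : Set ℕ} {G G' : ι → Set Node} (h : RB (k+1) I I' G G')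
    (a : ι) (S : Set Node) (hS : S ⊆ treeB I) :
    ∃ S' ⊆ treeB I', RB k I I' (Function.update G a S) (Function.update G' a S') := by
  obtain ⟨h', hh⟩ := capB_distribute (M := capM ι k) (M' := capM ι (k+1)) (by simp [capM]) I I'
    (fun i => tpB (k+1) (compB i G)) (fun i => tpB (k+1) (compB i G'))
    (fun i => tpB k (compB i (Function.update G a S))) h.cnt
  have hcu : ∀ (i : ℕ) (H : ι → Set Node) (U : Set Node),
      compB i (Function.update H a U) = Function.update (compB i H) a {τ | i :: τ ∈ U} := by
    intro i H U
    funext b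
    by_cases hb : b = a
    · subst hb; simp [compB]
    · simp [compB, hb]
  have key : ∀ i', ∃ U, i' ∈ I' → tpB k (Function.update (compB i' G') a U) = h' i' := by
    intro i'
    by_cases hi' : i' ∈ I'
    · obtain ⟨i, hi, e1, e2⟩ := capB_nonempty (by have := capM_two (ι := ι) k; omega)
        (capB_symm (hh (tpB (k+1) (compB i' G')) (h' i'))) ⟨i', hi', rfl, rfl⟩
      simp only [hcu] at e2
      obtain ⟨U, hU⟩ := tpB_move e1 a {τ | i :: τ ∈ S}
      exact ⟨U, fun _ => hU.trans e2⟩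
    · exact ⟨∅, fun h => absurd h hi'⟩
  choose U hU using key
  let S' : Set Node := {τ | (τ = [] ∧ [] ∈ S) ∨ ∃ i ∈ I', ∃ σ ∈ U i, τ = i :: σ}
  have hS' : S' ⊆ treeB I' := by
    rintro τ (⟨rfl, _⟩ | ⟨i, hi, σ, _, rfl⟩)
    · exact Or.inl rfl
    · exact Or.inr ⟨i, hi, σ, rfl⟩
  have hSi : ∀ i ∈ I', {τ | i :: τ ∈ S'} = U i := by
    intro i hi
    ext τ
    constructor
    · rintro (⟨h0, _⟩ | ⟨j, hj, σ, hσ, e⟩)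
      · simp at h0
      · obtain ⟨rfl, rfl⟩ := List.cons.inj e; exact hσ
    · intro hτ; exact Or.inr ⟨i, hi, τ, hτ, rfl⟩
  refine ⟨S', hS', ?_, ?_, ?_, ?_⟩
  · intro b
    by_cases hb : b = a
    · subst hb; simpa using hS
    · simpa [hb] using h.sub b
  · intro b
    by_cases hb : b = a
    · subst hb; simpa using hS'
    · simpa [hb] using h.sub' b
  · intro b
    by_cases hb : b = a
    · subst hb
      simp [S']
    · simpa [hb] using h.root b
  · intro q
    refine capB_sum _ _ (fun i => tpB (k+1) (compB i G)) (fun i => tpB (k+1) (compB i G')) fun t => ?_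
    convert hh t q using 1
    · ext i
      constructor
      · rintro ⟨⟨h1, h2⟩, h3⟩; exact ⟨h1, h3, h2⟩
      · rintro ⟨h1, h3, h2⟩; exact ⟨⟨h1, h2⟩, h3⟩
    · ext i
      constructor
      · rintro ⟨⟨h1, h2⟩, h3⟩
        rw [hcu, hSi i h1, hU i h1] at h2
        exact ⟨h1, h3, h2⟩
      · rintro ⟨h1, h3, h2⟩
        refine ⟨⟨h1, ?_⟩, h3⟩
        rw [hcu, hSi i h1, hU i h1]
        exact h2

end partB

section partBB
variable {AP : Type}

def rkB : MSOL AP → ℕ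
  | .atom _ _ => 0
  | .le _ _ => 0
  | .mem _ _ => 0
  | .not φ => rkB φ
  | .and φ ψ => max (rkB φ) (rkB ψ)
  | .exFO _ φ => rkB φ + 1
  | .exSO _ φ => rkB φ + 1

def bdB : MSOL AP → ℕ
  | .atom _ x => x + 1
  | .le x y => max (x + 1) (y + 1)
  | .mem x y => max (x + 1) (y + 1)
  | .not φ => bdB φ
  | .and φ ψ => max (bdB φ) (bdB ψ)
  | .exFO x φ => max (x + 1) (bdB φ)
  | .exSO x φ => max (x + 1) (bdB φ)

def KB (AP : Type) (I : Set ℕ) (hI : I.Nonempty) : KripkeTree AP where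
  T := treeB I
  root := []
  rooted := by
    refine ⟨Or.inl rfl, fun _ _ => List.nil_prefix, ?_⟩
    rintro σ σ' h hp
    simp only [List.nil_append] at *
    rcases h with rfl | ⟨i, hi, σ1, rfl⟩
    · left; simpa using hp
    · cases σ' with
      | nil => left; rfl
      | cons j σ' =>
        rw [List.cons_prefix_cons] at hp
        right; exact ⟨j, hp.1 ▸ hi, σ', rfl⟩
  nonblocking := by
    rintro τ (rfl | ⟨i, hi, σ, rfl⟩)
    · obtain ⟨i, hi⟩ := hI
      exact ⟨i, Or.inr ⟨i, hi, [], rfl⟩⟩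
    · exact ⟨0, Or.inr ⟨i, hi, σ ++ [0], rfl⟩⟩
  Lab := fun _ => ∅

def stB (N : ℕ) (V1 : ℕ → Node) (V2 : ℕ → Set Node) : Fin N ⊕ Fin N → Set Node :=
  Sum.elim (fun x => {V1 x}) (fun X => V2 X)

theorem stB_upd1 (N : ℕ) (V1 V2) (x : ℕ) (hx : x < N) (τ : Node) :
    stB N (Function.update V1 x τ) V2 = Function.update (stB N V1 V2) (Sum.inl ⟨x, hx⟩) {τ} := by
  funext b
  rcases b with b | b
  · by_cases hb : b = ⟨x, hx⟩
    · subst hb; simp [stB]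
    · have : (b : ℕ) ≠ x := fun h => hb (Fin.ext h)
      simp [stB, hb, this]
  · simp [stB]

theorem stB_upd2 (N : ℕ) (V1 V2) (x : ℕ) (hx : x < N) (S : Set Node) :
    stB N V1 (Function.update V2 x S) = Function.update (stB N V1 V2) (Sum.inr ⟨x, hx⟩) S := by
  funext b
  rcases b with b | b
  · simp [stB]
  · by_cases hb : b = ⟨x, hx⟩
    · subst hb; simp [stB]
    · have : (b : ℕ) ≠ x := fun h => hb (Fin.ext h)
      simp [stB, hb, this]

theorem satB (N : ℕ) (φ : MSOL AP) : ∀ (k : ℕ) (I I' : Set ℕ) (hI : I.Nonempty) (hI' : I'.Nonempty)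
    (V1 V1' : ℕ → Node) (V2 V2' : ℕ → Set Node), rkB φ ≤ k → bdB φ ≤ N →
    RB k I I' (stB N V1 V2) (stB N V1' V2') →
    Sat MSOdom (KB AP I hI) V1 V2 φ → Sat MSOdom (KB AP I' hI') V1' V2' φ := by
  induction φ with
  | atom a x =>
    intro k I I' hI hI' V1 V1' V2 V2' _ _ _ h
    simp [Sat, KB] at h
  | le x y =>
    intro k I I' hI hI' V1 V1' V2 V2' _ hb hR h
    simp only [bdB] at hb
    rw [sat_le] at h ⊢
    have h1 := hR.pre (a := Sum.inl ⟨x, by omega⟩) (b := Sum.inl ⟨y, by omega⟩)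
      (by simpa [stB] using h.2.2)
    refine ⟨?_, ?_, by simpa [stB] using h1⟩
    · exact hR.sub' (Sum.inl ⟨x, by omega⟩) (by simp [stB])
    · exact hR.sub' (Sum.inl ⟨y, by omega⟩) (by simp [stB])
  | mem x y =>
    intro k I I' hI hI' V1 V1' V2 V2' _ hb hR h
    simp only [bdB] at hb
    rw [sat_mem] at h ⊢
    have h1 := hR.inter (a := Sum.inl ⟨x, by omega⟩) (b := Sum.inr ⟨y, by omega⟩)
      (by simpa [stB] using h)
    simpa [stB] using h1
  | not φ ih =>
    intro k I I' hI hI' V1 V1' V2 V2' hk hb hR h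
    rw [sat_not] at h ⊢
    exact fun h' => h (ih k I' I hI' hI _ _ _ _ hk hb hR.symm h')
  | and φ ψ ih1 ih2 =>
    intro k I I' hI hI' V1 V1' V2 V2' hk hb hR h
    simp only [bdB, rkB] at hb hk
    rw [sat_and] at h ⊢
    exact ⟨ih1 k I I' hI hI' _ _ _ _ (by omega) (by omega) hR h.1,
      ih2 k I I' hI hI' _ _ _ _ (by omega) (by omega) hR h.2⟩
  | exFO x φ ih =>
    intro k I I' hI hI' V1 V1' V2 V2' hk hb hR h
    simp only [bdB, rkB] at hb hk
    obtain ⟨k, rfl⟩ : ∃ k', k = k' + 1 := ⟨k - 1, by omega⟩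
    rw [sat_exFO] at h ⊢
    obtain ⟨τ, hτ, h⟩ := h
    have hx : x < N := by omega
    obtain ⟨S', hS', hR'⟩ := hR.move (Sum.inl ⟨x, hx⟩) {τ} (Set.singleton_subset_iff.2 hτ)
    obtain ⟨τ', e⟩ := hR'.single (a := Sum.inl ⟨x, hx⟩) (τ := τ) (by simp)
    simp only [Function.update_self] at e
    subst e
    refine ⟨τ', hS' rfl, ?_⟩
    refine ih k I I' hI hI' _ _ _ _ (by omega) (by omega) ?_ h
    rw [stB_upd1 _ _ _ _ hx, stB_upd1 _ _ _ _ hx]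
    convert hR'
  | exSO x φ ih =>
    intro k I I' hI hI' V1 V1' V2 V2' hk hb hR h
    simp only [bdB, rkB] at hb hk
    obtain ⟨k, rfl⟩ : ∃ k', k = k' + 1 := ⟨k - 1, by omega⟩
    rw [sat_exSO] at h ⊢
    obtain ⟨S, hS, h⟩ := h
    have hx : x < N := by omega
    obtain ⟨S', hS', hR'⟩ := hR.move (Sum.inr ⟨x, hx⟩) S hS
    refine ⟨S', hS', ?_⟩
    refine ih k I I' hI hI' _ _ _ _ (by omega) (by omega) ?_ h
    rw [stB_upd2 _ _ _ _ hx, stB_upd2 _ _ _ _ hx]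
    convert hR'

def fbrF (AP : Type) : MSOL AP :=
  .exSO 0 (.all1 0 (.all1 1 (.imp (.and (.all1 2 (.le 0 2)) (chF 0 1 2)) (.mem 1 0))))

theorem fbrF_sentence (AP : Type) : (fbrF AP).IsSentence := by
  constructor
  · ext z; simp [fbrF, MSOL.freeFO, MSOL.all1, MSOL.imp, MSOL.lt, chF]; omega
  · ext z; simp [fbrF, MSOL.freeSO, MSOL.all1, MSOL.imp, MSOL.lt, chF]

theorem sat_fbrF (AP : Type) (I : Set ℕ) (hI : I.Nonempty) (D : SODom)
    (hD : ∀ T S, S ⊆ T → IsTree S → S ∈ D T) (V1 V2) :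
    Sat (weakDom D) (KB AP I hI) V1 V2 (fbrF AP) ↔ I.Finite := by
  simp only [fbrF, sat_exSO, sat_all1, sat_imp, sat_and, sat_mem, sat_le]
  constructor
  · rintro ⟨X, ⟨_, hf⟩, h⟩
    have : (fun i : ℕ => [i]) '' I ⊆ X := by
      rintro _ ⟨i, hi, rfl⟩
      have h0 : ([] : Node) ∈ (KB AP I hI).T := Or.inl rfl
      have h1 : ([i] : Node) ∈ (KB AP I hI).T := Or.inr ⟨i, hi, [], rfl⟩
      have := h [] h0 [i] h1 ⟨fun τ hτ => ⟨by simpa using h0, by simpa using hτ, by simp⟩, by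
        rw [sat_chF _ _ _ _ _ _ _ (by decide) (by decide)]
        exact ⟨by simpa using h0, by simpa using h1, i, by simp⟩⟩
      simpa using this
    exact (hf.subset this).of_finite_image (fun i _ j _ e => by simpa using e)
  · intro hf
    refine ⟨insert [] ((fun i : ℕ => [i]) '' I), ⟨hD _ _ ?_ ⟨[], ?_⟩, (hf.image _).insert _⟩, ?_⟩
    · rintro τ (rfl | ⟨i, hi, rfl⟩)
      · exact Or.inl rfl
      · exact Or.inr ⟨i, hi, [], rfl⟩
    · refine ⟨Or.inl rfl, fun _ _ => List.nil_prefix, ?_⟩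
      rintro σ σ' h hp
      simp only [List.nil_append] at *
      rcases h with rfl | ⟨i, hi, rfl⟩
      · left; simpa using hp
      · cases σ' with
        | nil => left; rfl
        | cons j σ' =>
          simp only [List.cons_prefix_cons, List.prefix_nil] at hp
          right; exact ⟨i, hi, by simp [hp.1, hp.2]⟩
    · rintro τ hτ τ' hτ' ⟨h1, h2⟩
      rw [sat_chF _ _ _ _ _ _ _ (by decide) (by decide)] at h2
      obtain ⟨_, _, n, hn⟩ := h2
      have h3 := (h1 [] (Or.inl rfl)).2.2
      simp at h3 hn
      subst h3 hn
      simp only [Function.update_self]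
      right
      rcases hτ' with h | ⟨i, hi, σ, h⟩
      · simp at h
      · simp at h
        exact ⟨i, hi, by simp [h.1]⟩

theorem partB_main (AP : Type) (D : SODom) (hD : ∀ T S, S ⊆ T → IsTree S → S ∈ D T) :
    ¬ MLogic.Leq (allKT AP) ⟨fun _ => True, weakDom D⟩ (MSO AP) := by
  intro h
  obtain ⟨φ, h1, -, h2⟩ := h (fbrF AP) (fbrF_sentence AP) trivial
  let N := bdB φ
  let k := rkB φ
  let m := capM (Fin N ⊕ Fin N) k
  have hm : 2 ≤ m := capM_two _
  have hI : (Set.Iio m).Nonempty := ⟨0, by simp; omega⟩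
  have hU : (Set.univ : Set ℕ).Nonempty := ⟨0, trivial⟩
  have a1 := h2 (KB AP (Set.Iio m) hI) trivial
  have a2 := h2 (KB AP Set.univ hU) trivial
  rw [ksat_iff _ _ _ (fbrF_sentence AP) (fun _ => []) (fun _ => ∅),
    ksat_iff _ _ _ h1 (fun _ => []) (fun _ => ∅)] at a1 a2
  have b1 := (sat_fbrF AP (Set.Iio m) hI D hD (fun _ => []) (fun _ => ∅)).2 (Set.finite_Iio m)
  have b2 : ¬ _ := fun h => Set.infinite_univ ((sat_fbrF AP Set.univ hU D hD (fun _ => []) (fun _ => ∅)).1 h)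
  refine b2 (a2.2 (satB N φ k (Set.Iio m) Set.univ hI hU _ _ _ _ le_rfl le_rfl ?_ (a1.1 b1)))
  have hsub : ∀ J a, stB N (fun _ => []) (fun _ => ∅) a ⊆ treeB J := by
    rintro J (a | a) τ hτ
    · left; simpa [stB] using hτ
    · simp [stB] at hτ
  refine ⟨hsub _, hsub _, fun _ => Iff.rfl, fun t => ?_⟩
  have hc : ∀ i, compB i (stB N (fun _ => []) (fun _ => ∅)) = fun _ => ∅ := by
    intro i
    funext a
    rcases a with a | a <;> ext τ <;> simp [compB, stB]
  simp only [hc]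
  by_cases ht : tpB k (fun _ : Fin N ⊕ Fin N => (∅ : Set Node)) = t
  · right
    simp only [ht, and_true, Set.ofPred_mem_eq, Set.encard_univ]
    refine ⟨?_, by simp⟩
    rw [show Set.Iio m = ((Finset.range m : Finset ℕ) : Set ℕ) by ext; simp,
      Set.encard_coe_eq_coe_finsetCard]
    simp [m]
  · left; simp [ht]

end partBB

/-- over all Kripke trees, MSO ≁ WMSO, MTL ≁ WMTL, MSO ≁ WMTL,
MTL ≁ WMSO; over finitely-branching Kripke trees, WMSO < MSO, WMTL < MTL,
and MTL ≁ WMSO. -/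
theorem stmt10 (AP : Type) [Fintype AP] :
    MLogic.Incomp (allKT AP) (MSO AP) (WMSO AP) ∧
    MLogic.Incomp (allKT AP) (MTL AP) (WMTL AP) ∧
    MLogic.Incomp (allKT AP) (MSO AP) (WMTL AP) ∧
    MLogic.Incomp (allKT AP) (MTL AP) (WMSO AP) ∧
    MLogic.Lt (finBrKT AP) (WMSO AP) (MSO AP) ∧
    MLogic.Lt (finBrKT AP) (WMTL AP) (MTL AP) ∧
    MLogic.Incomp (finBrKT AP) (MTL AP) (WMSO AP) := by
  have hsub : finBrKT AP ⊆ allKT AP := fun _ _ => trivial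
  have sD : ∀ T, ∀ S ∈ MSOdom T, S ⊆ T := fun _ _ h => h
  have sD' : ∀ T S, S ⊆ T → IsTree S → S ∈ MSOdom T := fun _ _ h _ => h
  have tD : ∀ T, ∀ S ∈ MTLdom T, S ⊆ T := fun _ _ h => h.1
  have tD' : ∀ T S, S ⊆ T → IsTree S → S ∈ MTLdom T := fun _ _ h h' => ⟨h, h'⟩
  have sE : ∀ T S, S ∈ MSOdom T ↔ S ⊆ T ∧ True := fun _ _ => ⟨fun h => ⟨h, trivial⟩, fun h => h.1⟩
  have tE : ∀ T S, S ∈ MTLdom T ↔ S ⊆ T ∧ IsTree S := fun _ _ => Iff.rfl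
  have a1 : ¬ MLogic.Leq (finBrKT AP) (MSO AP) (WMSO AP) :=
    partA_main AP MSOdom MSOdom (fun _ => True) sD sD' sE
  have a2 : ¬ MLogic.Leq (finBrKT AP) (MSO AP) (WMTL AP) :=
    partA_main AP MSOdom MTLdom IsTree sD sD' tE
  have a3 : ¬ MLogic.Leq (finBrKT AP) (MTL AP) (WMSO AP) :=
    partA_main AP MTLdom MSOdom (fun _ => True) tD tD' sE
  have a4 : ¬ MLogic.Leq (finBrKT AP) (MTL AP) (WMTL AP) :=
    partA_main AP MTLdom MTLdom IsTree tD tD' tE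
  have b1 : ¬ MLogic.Leq (allKT AP) (WMSO AP) (MSO AP) := partB_main AP MSOdom sD'
  have b2 : ¬ MLogic.Leq (allKT AP) (WMTL AP) (MSO AP) := partB_main AP MTLdom tD'
  refine ⟨⟨fun h => a1 (leq_mono hsub h), b1⟩,
    ⟨fun h => a4 (leq_mono hsub h), fun h => b2 (leq_trans h (mtl_leq_mso _))⟩,
    ⟨fun h => a2 (leq_mono hsub h), b2⟩,
    ⟨fun h => a3 (leq_mono hsub h), fun h => b1 (leq_trans h (mtl_leq_mso _))⟩,
    ⟨wmso_leq_mso, a1⟩, ⟨wmtl_leq_mtl, a4⟩, ⟨a3, partD_main AP⟩⟩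
end
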